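/- Assume the family Ψ_n satisfies properties (P1)–(P6). Then for every n ≥ 0: Z_n(x₁,…,x_n) = (∏_{i=1}^n ϑ₄(2(η+x_i),p²) ϑ₁(η+x_i) ϑ₁(η−x_i)) · Y_n(x₁,…,x_n), where for n = 2k, Y_{2k} = ((−1)^k / ϑ₄(0,p²)^{2k}) · ℍ_{2k}(x₁,…,x_{2k}) · ℍ_{2(k+1)}(x₁,…,x_{2k}, β₂, η+λ), and for n = 2k+1, Y_{2k+1} = ((−1)^k ϑ₂(η+λ) / ϑ₄(0,p²)^{2k+1}) · ℍ_{2(k+1)}(x₁,…,x_{2k+1}, β₂) · ℍ_{2(k+1)}(x₁,…,x_{2k+1}, η+λ), with β₂ = η + π/2 and ℍ denoting the elliptic Tsuchiya determinant (which is symmetric in all its arguments). -/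

import Mathlib

noncomputable section

open Complex
open scoped BigOperators

/-- Jacobi theta function `ϑ₁(z|τ)` with nome `p = e^{iπτ}` (Whittaker–Watson convention). -/
def th1 (z τ : ℂ) : ℂ :=
  -Complex.I * ∑' n : ℤ, (-1 : ℂ) ^ n *
    Complex.exp ((Real.pi : ℂ) * Complex.I * τ * ((n : ℂ) + 1/2) ^ 2 + (2 * (n : ℂ) + 1) * Complex.I * z)

/-- Jacobi theta function `ϑ₂(z|τ)`. -/
def th2 (z τ : ℂ) : ℂ :=
  ∑' n : ℤ,
    Complex.exp ((Real.pi : ℂ) * Complex.I * τ * ((n : ℂ) + 1/2) ^ 2 + (2 * (n : ℂ) + 1) * Complex.I * z)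

/-- Jacobi theta function `ϑ₃(z|τ)`. -/
def th3 (z τ : ℂ) : ℂ :=
  ∑' n : ℤ, Complex.exp ((Real.pi : ℂ) * Complex.I * τ * (n : ℂ) ^ 2 + 2 * (n : ℂ) * Complex.I * z)

/-- Jacobi theta function `ϑ₄(z|τ)`. -/
def th4 (z τ : ℂ) : ℂ :=
  ∑' n : ℤ, (-1 : ℂ) ^ n *
    Complex.exp ((Real.pi : ℂ) * Complex.I * τ * (n : ℂ) ^ 2 + 2 * (n : ℂ) * Complex.I * z)

/-- The crossing parameter `η = π/3`. -/
def ηc : ℂ := (Real.pi : ℂ) / 3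

/-- The elliptic nome `p = e^{iπτ}`. -/
def pnome (τ : ℂ) : ℂ := Complex.exp ((Real.pi : ℂ) * Complex.I * τ)

/-- `ζ = (ϑ₁(η,p²)/ϑ₄(η,p²))²`. -/
def zet (τ : ℂ) : ℂ := (th1 ηc (2 * τ) / th4 ηc (2 * τ)) ^ 2

/-- The nome `p` is real with `0 < p < 1`. -/
def preal (τ : ℂ) : Prop := (pnome τ).im = 0 ∧ 0 < (pnome τ).re ∧ (pnome τ).re < 1

/-- A tuple given by a list of prescribed entries, padded by zeros. -/
def padded {n : ℕ} (l : List ℂ) : Fin n → ℂ := fun j => l.getD (j : ℕ) 0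

/-- Extension of a tuple by a list of prescribed further entries (padded by zeros). -/
def extL {m n : ℕ} (w : Fin m → ℂ) (l : List ℂ) : Fin n → ℂ :=
  fun j => if h : (j : ℕ) < m then w ⟨j, h⟩ else l.getD ((j : ℕ) - m) 0

/-- First `k` entries of a `2k`-tuple. -/
def firstHalf {k : ℕ} (x : Fin (2 * k) → ℂ) : Fin k → ℂ :=
  fun i => x ⟨(i : ℕ), by have := i.2; omega⟩

/-- Last `k` entries of a `2k`-tuple. -/
def secondHalf {k : ℕ} (x : Fin (2 * k) → ℂ) : Fin k → ℂ :=
  fun i => x ⟨k + (i : ℕ), by have := i.2; omega⟩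

/-- `𝕙(x,y) = ϑ₁(x−y+η)ϑ₁(x−y−η)ϑ₁(x+y+η)ϑ₁(x+y−η)`. -/
def hh (τ x y : ℂ) : ℂ :=
  th1 (x - y + ηc) τ * th1 (x - y - ηc) τ * th1 (x + y + ηc) τ * th1 (x + y - ηc) τ

/-- `𝔻(x₁,…,x_k) = ∏_{i<j} ϑ₁(x_j−x_i)ϑ₁(x_j+x_i)`. -/
def vdTheta (τ : ℂ) {k : ℕ} (y : Fin k → ℂ) : ℂ :=
  ∏ i : Fin k, ∏ j : Fin k, if i < j then th1 (y j - y i) τ * th1 (y j + y i) τ else 1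

/-- The elliptic Tsuchiya determinant `ℍ_{2k}(x₁,…,x_k; x_{k+1},…,x_{2k})`. -/
def tsuchiya (τ : ℂ) (k : ℕ) (x : Fin (2 * k) → ℂ) : ℂ :=
  (∏ i : Fin k, ∏ j : Fin k, hh τ (firstHalf x i) (secondHalf x j))
    / (vdTheta τ (firstHalf x) * vdTheta τ (secondHalf x))
    * Matrix.det (Matrix.of fun i j : Fin k => (hh τ (firstHalf x i) (secondHalf x j))⁻¹)

/-- The expression defining the elliptic Tsuchiya determinant is well defined:
the Vandermonde-type denominators and the entries `𝕙(x_i,x_{j+k})` are nonzero. -/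
def tsuDefined (τ : ℂ) (k : ℕ) (x : Fin (2 * k) → ℂ) : Prop :=
  (∀ i j : Fin k, i ≠ j →
    th1 (firstHalf x j - firstHalf x i) τ ≠ 0 ∧ th1 (firstHalf x j + firstHalf x i) τ ≠ 0) ∧
  (∀ i j : Fin k, i ≠ j →
    th1 (secondHalf x j - secondHalf x i) τ ≠ 0 ∧ th1 (secondHalf x j + secondHalf x i) τ ≠ 0) ∧
  (∀ i j : Fin k, hh τ (firstHalf x i) (secondHalf x j) ≠ 0)

/-- `h(w,w') = 1 − (3+ζ²)ww' + (1−ζ²)ww'(w+w')`. -/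
def hpol (ζ w w' : ℂ) : ℂ := 1 - (3 + ζ ^ 2) * w * w' + (1 - ζ ^ 2) * w * w' * (w + w')

/-- Vandermonde product `Δ(w₁,…,w_k) = ∏_{i<j}(w_j − w_i)`. -/
def vdm {k : ℕ} (y : Fin k → ℂ) : ℂ :=
  ∏ i : Fin k, ∏ j : Fin k, if i < j then y j - y i else 1

/-- The determinant-ratio expression defining the polynomial `H_{2k}`. -/
def Hratio (ζ : ℂ) (k : ℕ) (w : Fin (2 * k) → ℂ) : ℂ :=
  (∏ i : Fin k, ∏ j : Fin k, hpol ζ (firstHalf w i) (secondHalf w j))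
    / (vdm (firstHalf w) * vdm (secondHalf w))
    * Matrix.det (Matrix.of fun i j : Fin k => (hpol ζ (firstHalf w i) (secondHalf w j))⁻¹)

/-- The expression `Hratio` is well defined at `w`. -/
def HratioDefined (ζ : ℂ) (k : ℕ) (w : Fin (2 * k) → ℂ) : Prop :=
  (∀ i j : Fin k, i ≠ j → firstHalf w i ≠ firstHalf w j) ∧
  (∀ i j : Fin k, i ≠ j → secondHalf w i ≠ secondHalf w j) ∧
  (∀ i j : Fin k, hpol ζ (firstHalf w i) (secondHalf w j) ≠ 0)

/-- `H` is the family of Rosengren–Zinn-Justin polynomials `H_{2k}` for parameter `ζ`: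
for each `k`, `H k` is a polynomial function of the `2k` variables agreeing with the
determinant-ratio formula wherever the latter is defined, and `H 0 = 1`. -/
def IsHFamily (ζ : ℂ) (H : (k : ℕ) → (Fin (2 * k) → ℂ) → ℂ) : Prop :=
  (∀ w, H 0 w = 1) ∧
  (∀ k : ℕ, ∃ P : MvPolynomial (Fin (2 * k)) ℂ, ∀ w, H k w = MvPolynomial.eval w P) ∧
  (∀ (k : ℕ) (w : Fin (2 * k) → ℂ), HratioDefined ζ k w → H k w = Hratio ζ k w)

/-- Vertex weight `a(u)`. -/
def av (τ u : ℂ) : ℂ := th4 (2*ηc) (2*τ) * th1 (u + 2*ηc) (2*τ) * th4 u (2*τ)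
/-- Vertex weight `b(u)`. -/
def bv (τ u : ℂ) : ℂ := th4 (2*ηc) (2*τ) * th4 (u + 2*ηc) (2*τ) * th1 u (2*τ)
/-- Vertex weight `c(u)`. -/
def cv (τ u : ℂ) : ℂ := th1 (2*ηc) (2*τ) * th4 (u + 2*ηc) (2*τ) * th4 u (2*τ)
/-- Vertex weight `d(u)`. -/
def dv (τ u : ℂ) : ℂ := th1 (2*ηc) (2*τ) * th1 (u + 2*ηc) (2*τ) * th1 u (2*τ)
/-- `r(u) = a(u) + b(u)`. -/
def rv (τ u : ℂ) : ℂ := av τ u + bv τ u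

/-- Entries of the `R`-matrix of the eight-vertex model, in the basis `{↑↑,↑↓,↓↑,↓↓}`
identified with `Fin 2 × Fin 2` (`↑ = 0`, `↓ = 1`). -/
def Rent (τ u : ℂ) (p q : Fin 2 × Fin 2) : ℂ :=
  if p = q then (if p.1 = p.2 then av τ u else bv τ u)
  else if q = (p.2, p.1) then cv τ u
  else if p.1 = p.2 ∧ q.1 = q.2 then dv τ u
  else 0

/-- Entries of `Ř(u) = 𝒫 R(u)`. -/
def Rcheckent (τ u : ℂ) (p q : Fin 2 × Fin 2) : ℂ := Rent τ u (p.2, p.1) q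

/-- The boundary vector `χ(x) ∈ ℂ²⊗ℂ²`. -/
def chiV (τ lam x : ℂ) : Fin 2 × Fin 2 → ℂ := fun p =>
  if p = ((0 : Fin 2), (1 : Fin 2)) then th1 (x + lam) (2*τ) * th4 (x - lam - 2*ηc) (2*τ)
  else if p = ((1 : Fin 2), (0 : Fin 2)) then th1 (x - lam - 2*ηc) (2*τ) * th4 (x + lam) (2*τ)
  else 0

/-- The boundary vector `χ̄(x) ∈ ℂ²⊗ℂ²`. -/
def chibarV (τ lam x : ℂ) : Fin 2 × Fin 2 → ℂ := fun p =>
  if p = ((0 : Fin 2), (0 : Fin 2)) then th1 (x + lam) (2*τ) * th1 (x - lam - 2*ηc) (2*τ)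
  else if p = ((1 : Fin 2), (1 : Fin 2)) then th4 (x - lam - 2*ηc) (2*τ) * th4 (x + lam) (2*τ)
  else 0

/-- A family `Ψ_n(u₁,…,u_{2n+1}) ∈ (ℂ²)^{⊗(2n+1)}`, represented by its components
with respect to spin configurations `α : Fin (2n+1) → Fin 2` (`↑ = 0`, `↓ = 1`). -/
abbrev PsiFam := (n : ℕ) → (Fin (2 * n + 1) → ℂ) → (Fin (2 * n + 1) → Fin 2) → ℂ

/-- The action of `Ř(u)` on tensor factors `i`, `j` of `(ℂ²)^{⊗L}`. -/
def applyRc (τ u : ℂ) {L : ℕ} (i j : Fin L) (ψ : (Fin L → Fin 2) → ℂ) :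
    (Fin L → Fin 2) → ℂ := fun α =>
  ∑ s : Fin 2, ∑ t : Fin 2,
    Rcheckent τ u (α i, α j) (s, t) * ψ (Function.update (Function.update α i s) j t)

/-- Spin flip. -/
def flipS : Fin 2 → Fin 2 := fun s => if s = 0 then 1 else 0

/-- Components of the singlet `s = ↑↓ − ↓↑`. -/
def singletC : Fin 2 → Fin 2 → ℂ := fun s t =>
  if s = 0 ∧ t = 1 then 1 else if s = 1 ∧ t = 0 then -1 else 0

/-- Delete the entries at positions `i`, `i+1` from a tuple. -/
def delTwo {α : Type*} {n : ℕ} (i : ℕ) (u : Fin (2 * (n + 1) + 1) → α) : Fin (2 * n + 1) → α :=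
  fun j => if _h : (j : ℕ) < i then u ⟨j, by have := j.2; omega⟩
           else u ⟨(j : ℕ) + 2, by have := j.2; omega⟩

/-- The components of `Ψ_n` are entire functions of each `u_i`. -/
def PsiEntire (Ψ : PsiFam) : Prop :=
  ∀ (n : ℕ) (u : Fin (2*n+1) → ℂ) (i : Fin (2*n+1)) (α : Fin (2*n+1) → Fin 2),
    Differentiable ℂ fun z => Ψ n (Function.update u i z) α

/-- (P1): the exchange relations. -/
def PsiP1 (τ : ℂ) (Ψ : PsiFam) : Prop :=
  ∀ (n : ℕ) (u : Fin (2*n+1) → ℂ) (i j : Fin (2*n+1)), (j : ℕ) = (i : ℕ) + 1 →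
    applyRc τ (u j - u i) i j (Ψ n u)
      = fun α => rv τ (u j - u i) * Ψ n (fun l => u (Equiv.swap i j l)) α

/-- (P2): local spin flips. -/
def PsiP2 (τ : ℂ) (Ψ : PsiFam) : Prop :=
  ∀ (n : ℕ) (u : Fin (2*n+1) → ℂ) (i : Fin (2*n+1)) (α : Fin (2*n+1) → Fin 2),
    Ψ n u (Function.update α i (flipS (α i)))
      = (-(pnome τ)) ^ n * Complex.exp (-Complex.I * ∑ j, (u j - u i))
        * Ψ n (Function.update u i (u i + Real.pi * τ)) α

/-- (P3): quasi-periodicity of `Ψ_n` in each `u_i`. -/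
def PsiP3 (τ : ℂ) (Ψ : PsiFam) : Prop :=
  ∀ (n : ℕ) (u : Fin (2*n+1) → ℂ) (i : Fin (2*n+1)),
    (Ψ n (Function.update u i (u i + Real.pi))
      = fun α => (∏ j ∈ Finset.univ.erase i, (if α j = 0 then (1:ℂ) else -1)) * Ψ n u α) ∧
    (Ψ n (Function.update u i (u i + 2 * Real.pi * τ))
      = fun α => (pnome τ ^ (4*n))⁻¹ *
          Complex.exp (-2 * Complex.I * ∑ j, (u i - u j)) * Ψ n u α)

/-- (P4): the wheel condition. -/
def PsiP4 (Ψ : PsiFam) : Prop :=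
  ∀ (n : ℕ) (u : Fin (2*n+1) → ℂ),
    (∃ i j k : Fin (2*n+1), i < j ∧ j < k ∧ u j = u i + 2*ηc ∧ u k = u i + 4*ηc) →
    Ψ n u = 0

/-- (P5): the reduction relations. -/
def PsiP5 (τ : ℂ) (Ψ : PsiFam) : Prop :=
  ∀ (n : ℕ) (u : Fin (2*(n+1)+1) → ℂ) (i : ℕ) (hi : i + 1 < 2*(n+1)+1),
    u ⟨i+1, hi⟩ = u ⟨i, by omega⟩ + 2*ηc →
    Ψ (n+1) u = fun α =>
      (∏ j ∈ (Finset.univ.erase (⟨i, by omega⟩ : Fin (2*(n+1)+1))).erase ⟨i+1, hi⟩,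
          th1 (u ⟨i, by omega⟩ - u j - 2*ηc) τ)
        * singletC (α ⟨i, by omega⟩) (α ⟨i+1, hi⟩)
        * Ψ n (delTwo i u) (delTwo i α)

/-- (P6): `Ψ₀ = ↑ + ↓`. -/
def PsiP6 (Ψ : PsiFam) : Prop := ∀ u α, Ψ 0 u α = 1

/-- The inhomogeneity parameters `(x₁,−x₁,…,x_n,−x_n,0)`. -/
def interleave {n : ℕ} (x : Fin n → ℂ) : Fin (2*n+1) → ℂ := fun j =>
  if h : (j : ℕ) < 2*n then
    (if (j : ℕ) % 2 = 0 then x ⟨(j:ℕ)/2, by omega⟩ else -x ⟨(j:ℕ)/2, by omega⟩)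
  else 0

/-- Components of `χ(x)`. -/
def chiC (τ lam x : ℂ) (s t : Fin 2) : ℂ :=
  if s = 0 ∧ t = 1 then th1 (x + lam) (2*τ) * th4 (x - lam - 2*ηc) (2*τ)
  else if s = 1 ∧ t = 0 then th1 (x - lam - 2*ηc) (2*τ) * th4 (x + lam) (2*τ)
  else 0

/-- Components of `χ̄(x)`. -/
def chibarC (τ lam x : ℂ) (s t : Fin 2) : ℂ :=
  if s = 0 ∧ t = 0 then th1 (x + lam) (2*τ) * th1 (x - lam - 2*ηc) (2*τ)
  else if s = 1 ∧ t = 1 then th4 (x - lam - 2*ηc) (2*τ) * th4 (x + lam) (2*τ)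
  else 0

/-- The scalar product `Z_n(x₁,…,x_n) = ⟨ξ_n(x₁,…,x_n), Ψ_n(x₁,−x₁,…,x_n,−x_n,0)⟩`. -/
def Zfun (τ lam : ℂ) (Ψ : PsiFam) (n : ℕ) (x : Fin n → ℂ) : ℂ :=
  ∑ α : Fin (2*n+1) → Fin 2,
    (∏ m : Fin n, chiC τ lam (x m)
        (α ⟨2*(m:ℕ), by have := m.2; omega⟩) (α ⟨2*(m:ℕ)+1, by have := m.2; omega⟩))
      * (if α ⟨2*n, by omega⟩ = 0 then (1:ℂ) else 0)
      * Ψ n (interleave x) α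

/-- The scalar product `Z̄_n^±(x₁,…,x_n)`, with `ε = ±1`. -/
def Zbarfun (τ lam ε : ℂ) (Ψ : PsiFam) (n : ℕ) (x : Fin n → ℂ) : ℂ :=
  ∑ α : Fin (2*n+1) → Fin 2,
    (∏ m : Fin n, chibarC τ lam (x m)
        (α ⟨2*(m:ℕ), by have := m.2; omega⟩) (α ⟨2*(m:ℕ)+1, by have := m.2; omega⟩))
      * (if α ⟨2*n, by omega⟩ = 0 then (1:ℂ) else ε)
      * Ψ n (interleave x) α

/-- The normalisation constant `𝒩_n`. -/
def Ncoef (τ : ℂ) (n : ℕ) : ℂ :=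
  (-1 : ℂ) ^ ((n+1)/2) * (th1 ηc τ ^ (n^2))⁻¹ * (th4 0 (2*τ) / th4 ηc (2*τ)) ^ (n*(n+1)/2)

/-- The vector `ψ_n = 𝒩_n Ψ_n(0,…,0)`. -/
def psiH (τ : ℂ) (Ψ : PsiFam) (n : ℕ) (α : Fin (2*n+1) → Fin 2) : ℂ :=
  Ncoef τ n * Ψ n (fun _ => 0) α

/-- The scalar product `S_n(μ) = ((⟨↑↓| + μ⟨↓↑|)^{⊗n} ⊗ ⟨↑|) ψ_n`. -/
def Sfun (τ : ℂ) (Ψ : PsiFam) (n : ℕ) (μ : ℂ) : ℂ :=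
  ∑ α : Fin (2*n+1) → Fin 2,
    (∏ m : Fin n,
      (if α ⟨2*(m:ℕ), by have := m.2; omega⟩ = 0 ∧ α ⟨2*(m:ℕ)+1, by have := m.2; omega⟩ = 1
        then (1:ℂ)
       else if α ⟨2*(m:ℕ), by have := m.2; omega⟩ = 1 ∧ α ⟨2*(m:ℕ)+1, by have := m.2; omega⟩ = 0
        then μ
       else 0))
      * (if α ⟨2*n, by omega⟩ = 0 then (1:ℂ) else 0) * psiH τ Ψ n α

/-- The scalar product `S̄_n^±(ν) = ((⟨↑↑| + ν⟨↓↓|)^{⊗n} ⊗ (⟨↑| ± ⟨↓|)) ψ_n`, with `ε = ±1`. -/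
def Sbarfun (τ ε : ℂ) (Ψ : PsiFam) (n : ℕ) (ν : ℂ) : ℂ :=
  ∑ α : Fin (2*n+1) → Fin 2,
    (∏ m : Fin n,
      (if α ⟨2*(m:ℕ), by have := m.2; omega⟩ = 0 ∧ α ⟨2*(m:ℕ)+1, by have := m.2; omega⟩ = 0
        then (1:ℂ)
       else if α ⟨2*(m:ℕ), by have := m.2; omega⟩ = 1 ∧ α ⟨2*(m:ℕ)+1, by have := m.2; omega⟩ = 1
        then ν
       else 0))
      * (if α ⟨2*n, by omega⟩ = 0 then (1:ℂ) else ε) * psiH τ Ψ n α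

/-- The alternating spin configuration `↑↓↑↓⋯↑`. -/
def altConf {L : ℕ} : Fin L → Fin 2 := fun j => if (j : ℕ) % 2 = 0 then 0 else 1

/-- The fully polarised spin configuration `↓⋯↓`. -/
def downConf {L : ℕ} : Fin L → Fin 2 := fun _ => 1

/-- The spin configuration `↑⋯↑↓` with a single `↓` at the last site. -/
def lastDownConf {n : ℕ} : Fin (2*n+1) → Fin 2 := fun j => if (j : ℕ) = 2*n then 1 else 0

/-- `J₂ = −1/2`. -/
def J2c : ℂ := -(1/2)
/-- `J₃ = 1/(1+ζ)`. -/
def J3c (ζ : ℂ) : ℂ := 1/(1+ζ)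
/-- `J₄ = 1/(1−ζ)`. -/
def J4c (ζ : ℂ) : ℂ := 1/(1-ζ)
/-- `μ̄ = (μ−1)²/((ζ²−1)μ)`. -/
def mubar (ζ μ : ℂ) : ℂ := (μ - 1)^2 / ((ζ^2 - 1)*μ)
/-- `ν̄ = (ν−ζ)(νζ−1)/((ζ²−1)ν)`. -/
def nubar (ζ ν : ℂ) : ℂ := (ν - ζ)*(ν*ζ - 1) / ((ζ^2 - 1)*ν)

/-- The elliptic function `w(x)`. -/
def wfun (τ x : ℂ) : ℂ :=
  th4 ηc (2*τ) / th4 0 (2*τ) * th1 x τ ^ 2 / (th1 (x - ηc) τ * th1 (x + ηc) τ)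

/-- `β₂ = η + π/2`. -/
def β2c : ℂ := ηc + (Real.pi : ℂ)/2
/-- `β₃ = η + π/2 + πτ/2`. -/
def β3c (τ : ℂ) : ℂ := ηc + (Real.pi : ℂ)/2 + (Real.pi : ℂ)*τ/2
/-- `β₄ = η + πτ/2`. -/
def β4c (τ : ℂ) : ℂ := ηc + (Real.pi : ℂ)*τ/2

/-- `f` is an (even) theta function of degree `m`, nome `p = e^{iπτ}` and norm `0`
with respect to each of its variables. -/
def ThetaLike (τ : ℂ) (m : ℕ) {n : ℕ} (X : (Fin n → ℂ) → ℂ) : Prop :=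
  ∀ (x : Fin n → ℂ) (i : Fin n),
    Differentiable ℂ (fun z => X (Function.update x i z)) ∧
    (∀ z, X (Function.update x i (z + Real.pi)) = X (Function.update x i z)) ∧
    (∀ z, X (Function.update x i (z + Real.pi * τ))
        = ((-(pnome τ)) ^ m)⁻¹ * Complex.exp (-2 * Complex.I * ((m : ℂ) * z))
            * X (Function.update x i z)) ∧
    (∀ z, X (Function.update x i (-z)) = X (Function.update x i z))



section

/-! ### Theta functions: series, symmetries, quasi-periodicity -/

lemma th1_term_eq (z τ : ℂ) (n : ℤ) :
    (-1 : ℂ) ^ n * cexp ((Real.pi : ℂ) * I * τ * ((n : ℂ) + 1/2) ^ 2 + (2 * (n : ℂ) + 1) * I * z)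
      = cexp (Real.pi * I * τ / 4 + I * z)
        * jacobiTheta₂_term n (z / Real.pi + τ / 2 + 1 / 2) τ := by
  have hpi : (Real.pi : ℂ) ≠ 0 := by exact_mod_cast Real.pi_ne_zero
  rw [show (-1 : ℂ) = cexp (Real.pi * I) from Complex.exp_pi_mul_I.symm, ← Complex.exp_int_mul,
    jacobiTheta₂_term, ← Complex.exp_add, ← Complex.exp_add]
  congr 1
  field_simp
  ring

lemma th2_term_eq (z τ : ℂ) (n : ℤ) :
    cexp ((Real.pi : ℂ) * I * τ * ((n : ℂ) + 1/2) ^ 2 + (2 * (n : ℂ) + 1) * I * z)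
      = cexp (Real.pi * I * τ / 4 + I * z)
        * jacobiTheta₂_term n (z / Real.pi + τ / 2) τ := by
  have hpi : (Real.pi : ℂ) ≠ 0 := by exact_mod_cast Real.pi_ne_zero
  rw [jacobiTheta₂_term, ← Complex.exp_add]
  congr 1
  field_simp
  ring

lemma th4_term_eq (z τ : ℂ) (n : ℤ) :
    (-1 : ℂ) ^ n * cexp ((Real.pi : ℂ) * I * τ * (n : ℂ) ^ 2 + 2 * (n : ℂ) * I * z)
      = jacobiTheta₂_term n (z / Real.pi + 1 / 2) τ := by
  have hpi : (Real.pi : ℂ) ≠ 0 := by exact_mod_cast Real.pi_ne_zero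
  rw [show (-1 : ℂ) = cexp (Real.pi * I) from Complex.exp_pi_mul_I.symm, ← Complex.exp_int_mul,
    jacobiTheta₂_term, ← Complex.exp_add]
  congr 1
  field_simp
  ring

lemma th1_eq_jacobiTheta₂ (z τ : ℂ) : th1 z τ
    = -I * (cexp (Real.pi * I * τ / 4 + I * z)
        * jacobiTheta₂ (z / Real.pi + τ / 2 + 1 / 2) τ) := by
  simp only [th1, th1_term_eq, tsum_mul_left, jacobiTheta₂]

lemma th4_eq_jacobiTheta₂ (z τ : ℂ) : th4 z τ = jacobiTheta₂ (z / Real.pi + 1 / 2) τ := by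
  simp only [th4, th4_term_eq, jacobiTheta₂]

lemma differentiable_jacobiTheta₂_fst {τ : ℂ} (hτ : 0 < τ.im) :
    Differentiable ℂ (fun z => jacobiTheta₂ z τ) :=
  fun z => differentiableAt_jacobiTheta₂_fst z hτ

lemma differentiable_th1 {τ : ℂ} (hτ : 0 < τ.im) : Differentiable ℂ (fun z => th1 z τ) := by
  simp only [th1_eq_jacobiTheta₂]
  have := (differentiable_jacobiTheta₂_fst hτ).comp
    (show Differentiable ℂ (fun z : ℂ => z / Real.pi + τ / 2 + 1 / 2) by fun_prop)
  simp only [Function.comp_def] at this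
  fun_prop

lemma differentiable_th4 {τ : ℂ} (hτ : 0 < τ.im) : Differentiable ℂ (fun z => th4 z τ) := by
  simp only [th4_eq_jacobiTheta₂]
  exact (differentiable_jacobiTheta₂_fst hτ).comp
    (show Differentiable ℂ (fun z : ℂ => z / Real.pi + 1 / 2) by fun_prop)

lemma neg_one_zpow_int_neg (n : ℤ) : (-1 : ℂ) ^ (-n) = (-1) ^ n := by
  rw [zpow_neg, ← inv_zpow]; norm_num

lemma th1_neg (z τ : ℂ) : th1 (-z) τ = -th1 z τ := by
  unfold th1
  rw [← (Equiv.subLeft (-1 : ℤ)).tsum_eq, ← mul_neg, ← tsum_neg]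
  congr 1
  refine tsum_congr fun n => ?_
  rw [Equiv.subLeft_apply, ← neg_mul]
  congr 1
  · rw [show (-1 : ℤ) - n = -n - 1 by ring, zpow_sub_one₀ (by norm_num), neg_one_zpow_int_neg]
    norm_num
  · congr 1; push_cast; ring

lemma th4_neg (z τ : ℂ) : th4 (-z) τ = th4 z τ := by
  unfold th4
  rw [← (Equiv.neg ℤ).tsum_eq]
  refine tsum_congr fun n => ?_
  rw [Equiv.neg_apply, neg_one_zpow_int_neg]
  congr 2; push_cast; ring

lemma th1_add_pi (z τ : ℂ) : th1 (z + Real.pi) τ = -th1 z τ := by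
  unfold th1
  rw [← mul_neg, ← tsum_neg]
  congr 1
  refine tsum_congr fun n => ?_
  rw [← mul_neg]
  congr 1
  rw [← neg_one_mul, show (-1 : ℂ) = cexp (Real.pi * I + n * (2 * Real.pi * I)) by
    rw [Complex.exp_add, Complex.exp_int_mul_two_pi_mul_I, Complex.exp_pi_mul_I]; ring,
    ← Complex.exp_add]
  congr 1; ring

lemma th4_add_pi (z τ : ℂ) : th4 (z + Real.pi) τ = th4 z τ := by
  unfold th4
  refine tsum_congr fun n => ?_
  congr 1
  rw [← one_mul (cexp (_ + 2 * (n : ℂ) * I * z)), ← Complex.exp_int_mul_two_pi_mul_I n,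
    ← Complex.exp_add]
  congr 1; ring

lemma th1_add_pi_tau (z τ : ℂ) :
    th1 (z + Real.pi * τ) τ = -(pnome τ)⁻¹ * cexp (-2 * I * z) * th1 z τ := by
  unfold th1 pnome
  conv_rhs => rw [← (Equiv.addRight (1 : ℤ)).tsum_eq, mul_left_comm _ (-I), ← tsum_mul_left]
  congr 1
  refine tsum_congr fun n => ?_
  rw [Equiv.coe_addRight, zpow_add_one₀ (by norm_num), ← Complex.exp_neg]
  trans (-1 : ℂ) ^ n * (cexp (-(Real.pi * I * τ)) * cexp (-2 * I * z) *
      cexp (Real.pi * I * τ * (((n + 1 : ℤ) : ℂ) + 1 / 2) ^ 2 +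
        (2 * ((n + 1 : ℤ) : ℂ) + 1) * I * z))
  · rw [← Complex.exp_add, ← Complex.exp_add]
    congr 2; push_cast; ring
  · ring

lemma th1_add_pi_tau' (z τ : ℂ) :
    th1 (z + Real.pi * τ) (2 * τ)
      = I * cexp (-(Real.pi * I * τ / 2)) * cexp (-I * z) * th4 z (2 * τ) := by
  unfold th1 th4
  conv_rhs => rw [← (Equiv.addRight (1 : ℤ)).tsum_eq]
  rw [← tsum_mul_left, ← tsum_mul_left]
  refine tsum_congr fun n => ?_
  rw [Equiv.coe_addRight, zpow_add_one₀ (by norm_num)]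
  trans -I * (-1 : ℂ) ^ n * (cexp (-(Real.pi * I * τ / 2)) * cexp (-I * z) *
      cexp (Real.pi * I * (2 * τ) * ((n + 1 : ℤ) : ℂ) ^ 2 + 2 * ((n + 1 : ℤ) : ℂ) * I * z))
  · rw [← Complex.exp_add, ← Complex.exp_add, ← mul_assoc]
    congr 2; push_cast; ring
  · ring

lemma th4_add_pi_tau' (z τ : ℂ) :
    th4 (z + Real.pi * τ) (2 * τ)
      = I * cexp (-(Real.pi * I * τ / 2)) * cexp (-I * z) * th1 z (2 * τ) := by
  unfold th1 th4
  rw [show ∀ a b S : ℂ, I * a * b * (-I * S) = a * b * S from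
    fun a b S => by linear_combination (-a * b * S) * I_sq, ← tsum_mul_left]
  refine tsum_congr fun n => ?_
  trans (-1 : ℂ) ^ n * (cexp (-(Real.pi * I * τ / 2)) * cexp (-I * z) *
      cexp (Real.pi * I * (2 * τ) * ((n : ℂ) + 1 / 2) ^ 2 + (2 * (n : ℂ) + 1) * I * z))
  · rw [← Complex.exp_add, ← Complex.exp_add]
    congr 2; ring
  · ring

lemma th2_eq_th1 (z τ : ℂ) : th2 z τ = th1 (z + Real.pi / 2) τ := by
  unfold th1 th2
  rw [← tsum_mul_left]
  refine tsum_congr fun n => ?_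
  have h : cexp ((Real.pi : ℂ) * I * τ * ((n : ℂ) + 1/2) ^ 2
      + (2 * (n : ℂ) + 1) * I * (z + Real.pi / 2))
      = cexp ((Real.pi : ℂ) * I * τ * ((n : ℂ) + 1/2) ^ 2 + (2 * (n : ℂ) + 1) * I * z)
        * (cexp (Real.pi * I) ^ n * cexp (Real.pi / 2 * I)) := by
    rw [← Complex.exp_int_mul, ← Complex.exp_add, ← Complex.exp_add]
    congr 1; ring
  rw [h, Complex.exp_pi_mul_I, Complex.exp_pi_div_two_mul_I]
  have h2 : (-1 : ℂ) ^ n * (-1) ^ n = 1 := by rw [← mul_zpow]; norm_num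
  linear_combination (-(cexp ((Real.pi : ℂ) * I * τ * ((n : ℂ) + 1/2) ^ 2
    + (2 * (n : ℂ) + 1) * I * z))) * h2 + (cexp ((Real.pi : ℂ) * I * τ * ((n : ℂ) + 1/2) ^ 2
    + (2 * (n : ℂ) + 1) * I * z)) * ((-1 : ℂ) ^ n * (-1) ^ n) * I_sq

lemma differentiable_th2 {τ : ℂ} (hτ : 0 < τ.im) : Differentiable ℂ (fun z => th2 z τ) := by
  simp only [th2_eq_th1]
  exact (differentiable_th1 hτ).comp (by fun_prop)

lemma two_mul_im_pos {τ : ℂ} (hτ : 0 < τ.im) : 0 < (2 * τ).im := by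
  simpa using hτ

/-- Even sublattice of `ℤ × ℤ`. -/
private def latEven (q : ℤ × ℤ) : ℤ × ℤ := (q.1 + q.2, q.1 - q.2)
/-- Odd coset of `ℤ × ℤ`. -/
private def latOdd (q : ℤ × ℤ) : ℤ × ℤ := (q.1 + q.2, q.1 - q.2 - 1)

private lemma latEven_injective : Function.Injective latEven := by
  rintro ⟨a, b⟩ ⟨c, d⟩ h
  simp only [latEven, Prod.mk.injEq] at h ⊢
  omega

private lemma latOdd_injective : Function.Injective latOdd := by
  rintro ⟨a, b⟩ ⟨c, d⟩ h
  simp only [latOdd, Prod.mk.injEq] at h ⊢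
  omega

private lemma isCompl_range_lat : IsCompl (Set.range latEven) (Set.range latOdd) := by
  rw [isCompl_iff, Set.disjoint_iff, codisjoint_iff]
  constructor
  · rintro ⟨m, n⟩ ⟨⟨⟨a, b⟩, h⟩, ⟨⟨c, d⟩, h'⟩⟩
    simp only [latEven, latOdd, Prod.mk.injEq] at h h'
    exact absurd h' (by omega)
  · rw [Set.top_eq_univ, Set.eq_univ_iff_forall]
    rintro ⟨m, n⟩
    rcases Int.even_or_odd' (m + n) with ⟨k, hk | hk⟩
    · left
      exact ⟨(k, m - k), by simp only [latEven, Prod.mk.injEq]; omega⟩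
    · right
      exact ⟨(k + 1, m - k - 1), by simp only [latOdd, Prod.mk.injEq]; omega⟩

lemma summable_norm_th1_term {τ : ℂ} (hτ : 0 < τ.im) (z : ℂ) : Summable fun n : ℤ =>
    ‖(-1 : ℂ) ^ n * cexp ((Real.pi : ℂ) * I * τ * ((n : ℂ) + 1/2) ^ 2
      + (2 * (n : ℂ) + 1) * I * z)‖ := by
  simp only [th1_term_eq]
  exact (((summable_jacobiTheta₂_term_iff _ _).mpr hτ).mul_left _).norm

lemma summable_norm_th2_term {τ : ℂ} (hτ : 0 < τ.im) (z : ℂ) : Summable fun n : ℤ =>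
    ‖cexp ((Real.pi : ℂ) * I * τ * ((n : ℂ) + 1/2) ^ 2 + (2 * (n : ℂ) + 1) * I * z)‖ := by
  simp only [th2_term_eq]
  exact (((summable_jacobiTheta₂_term_iff _ _).mpr hτ).mul_left _).norm

lemma summable_norm_th4_term {τ : ℂ} (hτ : 0 < τ.im) (z : ℂ) : Summable fun n : ℤ =>
    ‖(-1 : ℂ) ^ n * cexp ((Real.pi : ℂ) * I * τ * (n : ℂ) ^ 2 + 2 * (n : ℂ) * I * z)‖ := by
  simp only [th4_term_eq]
  exact ((summable_jacobiTheta₂_term_iff _ _).mpr hτ).norm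

/-- Addition formula relating the nomes `p²` and `p`. -/
theorem th1_mul_th4_add {τ : ℂ} (hτ : 0 < τ.im) (u v : ℂ) :
    th1 (u + v) (2 * τ) * th4 (u - v) (2 * τ) + th4 (u + v) (2 * τ) * th1 (u - v) (2 * τ)
      = th1 u τ * th2 v τ := by
  have hτ2 := two_mul_im_pos hτ
  unfold th1 th2 th4
  simp only [mul_assoc (-I)]
  rw [mul_left_comm _ (-I), ← mul_add]
  congr 1
  rw [tsum_mul_tsum_of_summable_norm (summable_norm_th1_term hτ2 _) (summable_norm_th4_term hτ2 _),
    tsum_mul_tsum_of_summable_norm (summable_norm_th4_term hτ2 _) (summable_norm_th1_term hτ2 _),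
    tsum_mul_tsum_of_summable_norm (summable_norm_th1_term hτ _) (summable_norm_th2_term hτ _)]
  have hS := summable_mul_of_summable_norm (summable_norm_th1_term hτ u)
    (summable_norm_th2_term hτ v)
  set F : ℤ × ℤ → ℂ := fun x => ((-1 : ℂ) ^ x.1 * cexp ((Real.pi : ℂ) * I * τ *
    ((x.1 : ℂ) + 1/2) ^ 2 + (2 * (x.1 : ℂ) + 1) * I * u)) *
    cexp ((Real.pi : ℂ) * I * τ * ((x.2 : ℂ) + 1/2) ^ 2 + (2 * (x.2 : ℂ) + 1) * I * v) with hF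
  have hE : HasSum (F ∘ Subtype.val) _ := (latEven_injective.hasSum_range_iff (f := F)).mpr
    ((hS.comp_injective latEven_injective).hasSum)
  have hO : HasSum (F ∘ Subtype.val) _ := (latOdd_injective.hasSum_range_iff (f := F)).mpr
    ((hS.comp_injective latOdd_injective).hasSum)
  rw [(HasSum.add_isCompl isCompl_range_lat hE hO).tsum_eq]
  congr 1
  · refine tsum_congr fun q => ?_
    simp only [hF, latEven, Function.comp]
    rw [zpow_add₀ (by norm_num)]
    trans (-1 : ℂ) ^ q.1 * (-1) ^ q.2 * (cexp (Real.pi * I * (2 * τ) * ((q.1 : ℂ) + 1 / 2) ^ 2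
        + (2 * (q.1 : ℂ) + 1) * I * (u + v)) *
        cexp (Real.pi * I * (2 * τ) * (q.2 : ℂ) ^ 2 + 2 * (q.2 : ℂ) * I * (u - v)))
    · ring
    · rw [mul_assoc _ _ (cexp (_ + _ * I * v)), ← Complex.exp_add, ← Complex.exp_add]
      congr 2; push_cast; ring
  · refine tsum_congr fun q => ?_
    simp only [hF, latOdd, Function.comp]
    rw [zpow_add₀ (by norm_num)]
    trans (-1 : ℂ) ^ q.1 * (-1) ^ q.2 * (cexp (Real.pi * I * (2 * τ) * (q.1 : ℂ) ^ 2
        + 2 * (q.1 : ℂ) * I * (u + v)) *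
        cexp (Real.pi * I * (2 * τ) * ((q.2 : ℂ) + 1 / 2) ^ 2
        + (2 * (q.2 : ℂ) + 1) * I * (u - v)))
    · ring
    · rw [mul_assoc _ _ (cexp (_ + _ * I * v)), ← Complex.exp_add, ← Complex.exp_add]
      congr 2; push_cast; ring

end

section

/-! ### Entire functions: division and Liouville arguments -/

lemma exists_entire_factor {f g : ℂ → ℂ} (hf : Differentiable ℂ f) (hg : Differentiable ℂ g)
    (h0 : ∀ z, g z = 0 → f z = 0 ∧ deriv g z ≠ 0) :
    ∃ h : ℂ → ℂ, Differentiable ℂ h ∧ ∀ z, f z = g z * h z := by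
  classical
  refine ⟨fun z => if g z = 0 then deriv f z / deriv g z else f z / g z, fun z₀ => ?_, fun z => ?_⟩
  · by_cases hz : g z₀ = 0
    · have hslope : ∀ {k : ℂ → ℂ}, Differentiable ℂ k → Differentiable ℂ (dslope k z₀) :=
        fun {k} hk => by
          have := (Complex.differentiableOn_dslope (s := Set.univ) (c := z₀) Filter.univ_mem).mpr
            hk.differentiableOn
          exact differentiableOn_univ.mp this
      have hgz : dslope g z₀ z₀ ≠ 0 := by rw [dslope_same]; exact (h0 z₀ hz).2
      have hev : ∀ᶠ z in nhds z₀, dslope g z₀ z ≠ 0 :=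
        (hslope hg).continuous.continuousAt.eventually_ne hgz
      have hd : DifferentiableAt ℂ (fun z => dslope f z₀ z / dslope g z₀ z) z₀ :=
        ((hslope hf) z₀).fun_div ((hslope hg) z₀) hgz
      refine hd.congr_of_eventuallyEq ?_
      filter_upwards [hev] with z hz'
      have hfz := sub_smul_dslope f z₀ z
      have hgz' := sub_smul_dslope g z₀ z
      rw [hz, sub_zero, smul_eq_mul] at hgz'
      rw [(h0 z₀ hz).1, sub_zero, smul_eq_mul] at hfz
      by_cases hzz : z = z₀
      · subst hzz; simp [hz, dslope_same]
      · have : g z ≠ 0 := by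
          rw [← hgz']; exact mul_ne_zero (sub_ne_zero.mpr hzz) hz'
        simp only [this, if_false]
        rw [← hfz, ← hgz', mul_div_mul_left _ _ (sub_ne_zero.mpr hzz)]
    · have hev : ∀ᶠ z in nhds z₀, g z ≠ 0 := hg.continuous.continuousAt.eventually_ne hz
      refine ((hf z₀).fun_div (hg z₀) hz).congr_of_eventuallyEq ?_
      filter_upwards [hev] with z hz'
      simp [hz']
  · by_cases hz : g z = 0
    · simp [hz, (h0 z hz).1]
    · simp only [hz, if_false]
      field_simp

lemma entire_eq_of_mul_eq {k f g : ℂ → ℂ} (hk : Differentiable ℂ k) (hne : ∃ w, k w ≠ 0)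
    (hf : Differentiable ℂ f) (hg : Differentiable ℂ g) (h : ∀ z, k z * f z = k z * g z) (z : ℂ) :
    f z = g z := by
  have hev : ∀ᶠ w in nhdsWithin z {z}ᶜ, k w ≠ 0 := by
    have han : AnalyticOnNhd ℂ k Set.univ := fun w _ => hk.analyticAt w
    rcases (han z trivial).eventually_eq_zero_or_eventually_ne_zero with h0 | h0
    · have := han.eqOn_zero_of_preconnected_of_eventuallyEq_zero isPreconnected_univ trivial h0
      obtain ⟨w, hw⟩ := hne
      exact absurd (this (Set.mem_univ w)) hw
    · exact h0
  have hev2 : ∀ᶠ w in nhdsWithin z {z}ᶜ, f w = g w :=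
    hev.mono fun w hw => mul_left_cancel₀ hw (h w)
  exact tendsto_nhds_unique_of_eventuallyEq
    (hf.continuous.continuousAt.tendsto.mono_left nhdsWithin_le_nhds)
    (hg.continuous.continuousAt.tendsto.mono_left nhdsWithin_le_nhds) hev2

lemma exists_lattice_reduction {τ : ℂ} (hτ : 0 < τ.im) (z : ℂ) : ∃ (m n : ℤ) (s t : ℝ),
    s ∈ Set.Icc (0 : ℝ) 1 ∧ t ∈ Set.Icc (0 : ℝ) 1 ∧
      z = (s * Real.pi + t * (Real.pi * τ) : ℂ) + m * Real.pi + n * (Real.pi * τ) := by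
  set b : ℝ := z.im / (Real.pi * τ.im) with hb
  set a : ℝ := (z.re - b * Real.pi * τ.re) / Real.pi with ha
  have hpi := Real.pi_pos
  refine ⟨⌊a⌋, ⌊b⌋, Int.fract a, Int.fract b, ⟨Int.fract_nonneg _, (Int.fract_lt_one _).le⟩,
    ⟨Int.fract_nonneg _, (Int.fract_lt_one _).le⟩, ?_⟩
  have hz : z = (a : ℂ) * Real.pi + b * (Real.pi * τ) := by
    apply Complex.ext
    · simp [ha]; field_simp; ring
    · rw [show z.im = b * (Real.pi * τ.im) by rw [hb]; field_simp]
      simp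
  have h1 : (a : ℂ) = (Int.fract a : ℝ) + (⌊a⌋ : ℤ) := by
    exact_mod_cast (Int.fract_add_floor a).symm
  have h2 : (b : ℂ) = (Int.fract b : ℝ) + (⌊b⌋ : ℤ) := by
    exact_mod_cast (Int.fract_add_floor b).symm
  rw [hz]
  conv_lhs => rw [h1, h2]
  ring

lemma apply_add_int_mul {β : Type*} {k : ℂ → β} {w : ℂ} (h : ∀ z, k (z + w) = k z) (m : ℤ) (z : ℂ) :
    k (z + m * w) = k z := by
  induction m using Int.induction_on generalizing z with
  | zero => simp
  | succ i ih => rw [← ih z, ← h (z + (i : ℤ) * w)]; congr 1; push_cast; ring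
  | pred i ih => rw [← ih z, ← h (z + ((-(i : ℤ) - 1 : ℤ) : ℂ) * w)]; congr 1; push_cast; ring

lemma entire_const_of_norm_periodic {τ : ℂ} (hτ : 0 < τ.im) {h : ℂ → ℂ} (hd : Differentiable ℂ h)
    (h1 : ∀ z, ‖h (z + Real.pi)‖ = ‖h z‖) (h2 : ∀ z, ‖h (z + Real.pi * τ)‖ = ‖h z‖) (z w : ℂ) :
    h z = h w := by
  apply hd.apply_eq_apply_of_bounded
  have hK : IsCompact ((fun q : ℝ × ℝ => (q.1 * Real.pi + q.2 * (Real.pi * τ) : ℂ)) ''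
      (Set.Icc (0 : ℝ) 1 ×ˢ Set.Icc (0 : ℝ) 1)) :=
    (isCompact_Icc.prod isCompact_Icc).image (by fun_prop)
  obtain ⟨C, hC⟩ := hK.exists_bound_of_continuousOn hd.continuous.continuousOn
  rw [isBounded_iff_forall_norm_le]
  refine ⟨C, ?_⟩
  rintro _ ⟨z, rfl⟩
  obtain ⟨m, n, s, t, hs, ht, rfl⟩ := exists_lattice_reduction hτ z
  have e2 := apply_add_int_mul (k := fun z => ‖h z‖) h2 n
    ((s * Real.pi + t * (Real.pi * τ) : ℂ) + m * Real.pi)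
  have e1 := apply_add_int_mul (k := fun z => ‖h z‖) h1 m (s * Real.pi + t * (Real.pi * τ) : ℂ)
  rw [e2, e1]
  exact hC _ ⟨(s, t), ⟨hs, ht⟩, rfl⟩

/-! ### The infinite product and the zeros of `ϑ₁` -/

/-- The `q`-Pochhammer product `∏_{n ≥ 0} (1 - qⁿ w)`. -/
def qPoch (q w : ℂ) : ℂ := ∏' n : ℕ, (1 + -(q ^ n * w))

lemma summable_norm_qPoch {q : ℂ} (hq : ‖q‖ < 1) (w : ℂ) :
    Summable fun n : ℕ => ‖-(q ^ n * w)‖ := by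
  simp only [norm_neg, norm_mul, norm_pow]
  exact (summable_geometric_of_lt_one (norm_nonneg _) hq).mul_right _

lemma qPoch_eq {q : ℂ} (hq : ‖q‖ < 1) (w : ℂ) : qPoch q w = (1 - w) * qPoch q (q * w) := by
  unfold qPoch
  have hm : Multipliable fun n : ℕ => (1 + -(q ^ (n + 1) * w)) := by
    apply multipliable_one_add_of_summable
    exact (summable_nat_add_iff 1).mpr (summable_norm_qPoch hq w)
  have h0 := tprod_eq_zero_mul' (f := fun n : ℕ => (1 + -(q ^ n * w))) hm
  have h1 : (fun n : ℕ => (1 + -(q ^ (n + 1) * w))) = fun n => 1 + -(q ^ n * (q * w)) := by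
    funext n; rw [pow_succ]; ring
  rw [h0, h1, pow_zero, one_mul, sub_eq_add_neg]

lemma qPoch_ne_zero {q : ℂ} (hq : ‖q‖ < 1) {w : ℂ} (hw : ∀ n : ℕ, q ^ n * w ≠ 1) :
    qPoch q w ≠ 0 := by
  apply tprod_one_add_ne_zero_of_summable
  · intro n h
    apply hw n
    linear_combination -h
  · exact summable_norm_qPoch hq w

lemma differentiable_qPoch {q : ℂ} (hq : ‖q‖ < 1) : Differentiable ℂ (qPoch q) := by
  rw [← differentiableOn_univ]
  have : HasProdLocallyUniformlyOn (fun (n : ℕ) (w : ℂ) => 1 + -(q ^ n * w)) (qPoch q)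
      Set.univ := by
    apply hasProdLocallyUniformlyOn_of_forall_compact isOpen_univ
    intro K _ hK
    obtain ⟨C, hC⟩ := hK.exists_bound_of_continuousOn continuousOn_id
    refine ((summable_geometric_of_lt_one (norm_nonneg _) hq).mul_right
      C).hasProdUniformlyOn_nat_one_add hK (.of_forall fun n x hx => ?_) (fun _ => by fun_prop)
    rw [norm_neg, norm_mul, norm_pow]
    exact mul_le_mul_of_nonneg_left (hC x hx) (by positivity)
  exact this.differentiableOn (.of_forall fun _ => by
    simpa [Finset.prod_fn] using DifferentiableOn.finsetProd (fun _ _ => by fun_prop)) isOpen_univ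

lemma norm_pnome_lt_one {τ : ℂ} (hτ : 0 < τ.im) : ‖pnome τ‖ < 1 := by
  rw [pnome, Complex.norm_exp, Real.exp_lt_one_iff]
  simp
  have := mul_pos Real.pi_pos hτ
  linarith

lemma norm_pnome_sq_lt_one {τ : ℂ} (hτ : 0 < τ.im) : ‖pnome τ ^ 2‖ < 1 := by
  rw [norm_pow]
  exact pow_lt_one₀ (norm_nonneg _) (norm_pnome_lt_one hτ) (by norm_num)

/-- The product form of `ϑ₁`, up to normalisation. -/
def thetaProd (τ z : ℂ) : ℂ :=
  cexp (-(I * z)) * (qPoch (pnome τ ^ 2) (cexp (2 * I * z))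
    * qPoch (pnome τ ^ 2) (pnome τ ^ 2 * cexp (-(2 * I * z))))

lemma pnome_sq (τ : ℂ) : pnome τ ^ 2 = cexp (2 * I * (Real.pi * τ)) := by
  rw [pnome, ← Complex.exp_nat_mul]; congr 1; push_cast; ring

lemma differentiable_thetaProd {τ : ℂ} (hτ : 0 < τ.im) : Differentiable ℂ (thetaProd τ) := by
  unfold thetaProd
  have hE := differentiable_qPoch (norm_pnome_sq_lt_one hτ)
  have h1 := hE.comp (show Differentiable ℂ fun z : ℂ => cexp (2 * I * z) by fun_prop)
  have h2 := hE.comp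
    (show Differentiable ℂ fun z : ℂ => pnome τ ^ 2 * cexp (-(2 * I * z)) by fun_prop)
  simp only [Function.comp_def] at h1 h2
  fun_prop

lemma exp_two_I_mul_add_pi (z : ℂ) : cexp (2 * I * (z + Real.pi)) = cexp (2 * I * z) := by
  rw [mul_add, Complex.exp_add, show 2 * I * (Real.pi : ℂ) = 2 * Real.pi * I by ring,
    Complex.exp_two_pi_mul_I, mul_one]

lemma thetaProd_add_pi (τ z : ℂ) : thetaProd τ (z + Real.pi) = -thetaProd τ z := by
  unfold thetaProd
  rw [Complex.exp_neg (2 * I * _), exp_two_I_mul_add_pi, ← Complex.exp_neg,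
    show cexp (-(I * (z + Real.pi))) = -cexp (-(I * z)) by
      rw [show -(I * (z + Real.pi)) = -(I * z) + -(Real.pi * I) by ring, Complex.exp_add,
        Complex.exp_neg (_ * I), Complex.exp_pi_mul_I]; norm_num]
  ring

lemma thetaProd_add_pi_tau {τ : ℂ} (hτ : 0 < τ.im) (z : ℂ) :
    thetaProd τ (z + Real.pi * τ) = -(pnome τ)⁻¹ * cexp (-2 * I * z) * thetaProd τ z := by
  have hq := norm_pnome_sq_lt_one hτ
  unfold thetaProd
  have e1 : cexp (2 * I * (z + Real.pi * τ)) = pnome τ ^ 2 * cexp (2 * I * z) := by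
    rw [pnome_sq, ← Complex.exp_add]; congr 1; ring
  have e2 : pnome τ ^ 2 * cexp (-(2 * I * (z + Real.pi * τ))) = cexp (-(2 * I * z)) := by
    rw [pnome_sq, ← Complex.exp_add]; congr 1; ring
  have e3 : cexp (-(I * (z + Real.pi * τ))) = cexp (-(I * z)) * (pnome τ)⁻¹ := by
    rw [pnome, ← Complex.exp_neg, ← Complex.exp_add]; congr 1; ring
  rw [e1, e2, e3, qPoch_eq hq (cexp (2 * I * z)), qPoch_eq hq (cexp (-(2 * I * z))),
    show -2 * I * z = -(2 * I * z) by ring]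
  have e4 : cexp (2 * I * z) * cexp (-(2 * I * z)) = 1 := by rw [← Complex.exp_add]; simp
  linear_combination (cexp (-(I * z)) * (pnome τ)⁻¹ * qPoch (pnome τ ^ 2)
    (pnome τ ^ 2 * cexp (2 * I * z)) * qPoch (pnome τ ^ 2) (pnome τ ^ 2 * cexp (-(2 * I * z)))) * -e4

/-- The period lattice `πℤ + πτℤ`. -/
def IsLat (τ z : ℂ) : Prop := ∃ m n : ℤ, z = m * Real.pi + n * (Real.pi * τ)

lemma isLat_of_pow_mul_exp {τ z : ℂ} {n : ℤ} (h : (pnome τ ^ 2) ^ n * cexp (2 * I * z) = 1) :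
    IsLat τ z := by
  have hpi : (Real.pi : ℂ) ≠ 0 := by exact_mod_cast Real.pi_ne_zero
  rw [pnome_sq, ← Complex.exp_int_mul, ← Complex.exp_add, Complex.exp_eq_one_iff] at h
  obtain ⟨m, hm⟩ := h
  refine ⟨m, -n, ?_⟩
  have : 2 * I * z = 2 * I * (m * Real.pi + (-n : ℤ) * (Real.pi * τ)) := by
    push_cast; linear_combination hm
  exact mul_left_cancel₀ (by simp) this

lemma thetaProd_ne_zero {τ : ℂ} (hτ : 0 < τ.im) {z : ℂ} (hz : ¬ IsLat τ z) :
    thetaProd τ z ≠ 0 := by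
  have hq := norm_pnome_sq_lt_one hτ
  refine mul_ne_zero (Complex.exp_ne_zero _) (mul_ne_zero ?_ ?_)
  · refine qPoch_ne_zero hq fun n h => hz (isLat_of_pow_mul_exp (n := n) ?_)
    exact_mod_cast h
  · refine qPoch_ne_zero hq fun n h => hz (isLat_of_pow_mul_exp (n := -(n + 1 : ℤ)) ?_)
    have : pnome τ ^ 2 ≠ 0 := pow_ne_zero _ (Complex.exp_ne_zero _)
    rw [← inv_inj, inv_one, mul_inv, ← zpow_neg, neg_neg, ← Complex.exp_neg, ← h,
      zpow_add₀ this]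
    simp; ring

lemma deriv_add_period {f : ℂ → ℂ} (hf : Differentiable ℂ f) {w a : ℂ} {c : ℂ → ℂ}
    (hc : Differentiable ℂ c) (h : ∀ z, f (z + w) = c z * f z) (ha : f a = 0) :
    deriv f (a + w) = c a * deriv f a := by
  have h1 : deriv (fun z => f (z + w)) a = deriv f (a + w) := deriv_comp_add_const f w a
  rw [← h1, funext h, deriv_fun_mul (hc a) (hf a), ha]
  ring

lemma zero_simple_add_period {f : ℂ → ℂ} (hf : Differentiable ℂ f) {w : ℂ} {c : ℂ → ℂ}
    (hc : Differentiable ℂ c) (hc0 : ∀ z, c z ≠ 0) (h : ∀ z, f (z + w) = c z * f z) (z : ℂ) :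
    (f (z + w) = 0 ∧ deriv f (z + w) ≠ 0) ↔ (f z = 0 ∧ deriv f z ≠ 0) := by
  have h0 : f (z + w) = 0 ↔ f z = 0 := by simp [h, hc0]
  rw [h0]
  refine and_congr_right fun hz => ?_
  rw [deriv_add_period hf hc h hz]
  simp [hc0]

lemma thetaProd_zero {τ : ℂ} (hτ : 0 < τ.im) : thetaProd τ 0 = 0 ∧ deriv (thetaProd τ) 0 ≠ 0 := by
  have hq := norm_pnome_sq_lt_one hτ
  have hE := differentiable_qPoch hq
  have h1 := hE.comp
    (show Differentiable ℂ fun z : ℂ => pnome τ ^ 2 * cexp (2 * I * z) by fun_prop)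
  have h2 := hE.comp
    (show Differentiable ℂ fun z : ℂ => pnome τ ^ 2 * cexp (-(2 * I * z)) by fun_prop)
  have hG : Differentiable ℂ (fun z : ℂ => cexp (-(I * z)) *
      (qPoch (pnome τ ^ 2) (pnome τ ^ 2 * cexp (2 * I * z)) *
      qPoch (pnome τ ^ 2) (pnome τ ^ 2 * cexp (-(2 * I * z))))) := by
    simp only [Function.comp_def] at h1 h2
    fun_prop
  have heq : thetaProd τ = fun z => (1 - cexp (2 * I * z)) * (cexp (-(I * z)) *
      (qPoch (pnome τ ^ 2) (pnome τ ^ 2 * cexp (2 * I * z)) *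
      qPoch (pnome τ ^ 2) (pnome τ ^ 2 * cexp (-(2 * I * z))))) := by
    funext z
    rw [thetaProd, qPoch_eq hq (cexp (2 * I * z))]
    ring
  have hd : HasDerivAt (fun z : ℂ => 1 - cexp (2 * I * z)) (-(2 * I)) 0 := by
    have := (((hasDerivAt_id (0 : ℂ)).const_mul (2 * I)).cexp).const_sub 1
    simpa using this
  constructor
  · simp [heq]
  · rw [heq, deriv_fun_mul hd.differentiableAt (hG 0), hd.deriv]
    have hne : qPoch (pnome τ ^ 2) (pnome τ ^ 2) ≠ 0 := by
      refine qPoch_ne_zero hq fun n h => ?_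
      rw [← pow_succ] at h
      have := congrArg norm h
      rw [norm_pow, norm_one] at this
      exact absurd this (pow_lt_one₀ (norm_nonneg _) hq (by simp)).ne
    simpa using hne

lemma zero_simple_thetaProd_of_isLat {τ : ℂ} (hτ : 0 < τ.im) {z : ℂ} (hz : IsLat τ z) :
    thetaProd τ z = 0 ∧ deriv (thetaProd τ) z ≠ 0 := by
  obtain ⟨m, n, rfl⟩ := hz
  have hd := differentiable_thetaProd hτ
  have k1 := zero_simple_add_period hd (w := Real.pi) (c := fun _ => -1) (by fun_prop)
    (by simp) (fun z => by rw [thetaProd_add_pi]; ring)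
  have k2 := zero_simple_add_period hd (w := Real.pi * τ)
    (c := fun z => -(pnome τ)⁻¹ * cexp (-2 * I * z)) (by fun_prop)
    (by simp [pnome]) (thetaProd_add_pi_tau hτ)
  have e1 := apply_add_int_mul (k := fun z => thetaProd τ z = 0 ∧ deriv (thetaProd τ) z ≠ 0)
    (fun z => propext (k1 z)) m 0
  have e2 := apply_add_int_mul (k := fun z => thetaProd τ z = 0 ∧ deriv (thetaProd τ) z ≠ 0)
    (fun z => propext (k2 z)) n (m * Real.pi)
  rw [zero_add] at e1
  rw [e2, e1]
  exact thetaProd_zero hτ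

lemma th1_eq_zero_of_isLat {τ z : ℂ} (hz : IsLat τ z) : th1 z τ = 0 := by
  obtain ⟨m, n, rfl⟩ := hz
  have e1 := apply_add_int_mul (k := fun z => th1 z τ = 0) (w := Real.pi)
    (fun z => by simp [th1_add_pi]) m 0
  have e2 := apply_add_int_mul (k := fun z => th1 z τ = 0) (w := Real.pi * τ)
    (fun z => by simp [th1_add_pi_tau, pnome]) n (m * Real.pi)
  rw [zero_add] at e1
  rw [e2, e1]
  have := th1_neg 0 τ
  rw [neg_zero] at this
  exact self_eq_neg.mp this

lemma exists_jacobiTheta₂_ne_zero {τ : ℂ} (hτ : 0 < τ.im) : ∃ z, jacobiTheta₂ z τ ≠ 0 := by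
  by_contra! hcon
  have hinteg : HasSum (fun n : ℤ => ∫ x in (0:ℝ)..1, jacobiTheta₂_term n (x : ℂ) τ)
      (∫ x in (0:ℝ)..1, ∑' n : ℤ, jacobiTheta₂_term n (x : ℂ) τ) := by
    let f : ℤ → C(ℝ, ℂ) := fun n =>
      ⟨fun x => jacobiTheta₂_term n (x : ℂ) τ, by unfold jacobiTheta₂_term; fun_prop⟩
    refine intervalIntegral.hasSum_intervalIntegral_of_summable_norm (f := f) ?_
    refine Summable.of_nonneg_of_le (fun _ => norm_nonneg _) (fun n => ?_)
      (((summable_jacobiTheta₂_term_iff 0 τ).mpr hτ).norm)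
    rw [ContinuousMap.norm_le _ (norm_nonneg _)]
    intro x
    simp [f, norm_jacobiTheta₂_term]
  have hz : (∫ x in (0:ℝ)..1, ∑' n : ℤ, jacobiTheta₂_term n (x : ℂ) τ) = 0 := by
    have : ∀ x : ℝ, ∑' n : ℤ, jacobiTheta₂_term n (x : ℂ) τ = 0 := fun x => hcon x
    simp [this]
  have hterm : (fun n : ℤ => ∫ x in (0:ℝ)..1, jacobiTheta₂_term n (x : ℂ) τ)
      = fun n => if n = 0 then 1 else 0 := by
    funext n
    split_ifs with hn
    · subst hn; simp [jacobiTheta₂_term]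
    · have hc : (2 * Real.pi * I * n : ℂ) ≠ 0 := by simp [hn, Real.pi_ne_zero]
      have : ∀ x : ℝ, jacobiTheta₂_term n (x : ℂ) τ
          = cexp (Real.pi * I * n ^ 2 * τ) * cexp (2 * Real.pi * I * n * x) := fun x => by
        rw [jacobiTheta₂_term, ← Complex.exp_add]; congr 1; ring
      simp only [this]
      rw [intervalIntegral.integral_const_mul, integral_exp_mul_complex hc]
      have h1 : cexp (2 * Real.pi * I * n * ((1 : ℝ) : ℂ)) = 1 := by
        rw [← Complex.exp_int_mul_two_pi_mul_I n]; congr 1; push_cast; ring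
      rw [h1]; simp
  rw [hz, hterm] at hinteg
  have := hinteg.unique (hasSum_ite_eq (0 : ℤ) (1 : ℂ))
  exact zero_ne_one this

theorem th1_eq_const_mul_thetaProd {τ : ℂ} (hτ : 0 < τ.im) :
    ∃ c : ℂ, c ≠ 0 ∧ ∀ z, th1 z τ = c * thetaProd τ z := by
  obtain ⟨h, hd, hh⟩ := exists_entire_factor (differentiable_th1 hτ) (differentiable_thetaProd hτ)
    (fun z hz => by
      have hl : IsLat τ z := by
        by_contra hl
        exact thetaProd_ne_zero hτ hl hz
      exact ⟨th1_eq_zero_of_isLat hl, (zero_simple_thetaProd_of_isLat hτ hl).2⟩)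
  have hne : ∃ w, thetaProd τ w ≠ 0 := by
    by_contra! hcon
    exact (thetaProd_zero hτ).2 (by rw [funext hcon]; simp)
  have p1 : ∀ z, h (z + Real.pi) = h z := by
    refine entire_eq_of_mul_eq (differentiable_thetaProd hτ) hne (hd.comp (by fun_prop)) hd fun z => ?_
    have := hh (z + Real.pi)
    rw [th1_add_pi, thetaProd_add_pi, hh z] at this
    linear_combination this
  have p2 : ∀ z, h (z + Real.pi * τ) = h z := by
    refine entire_eq_of_mul_eq (differentiable_thetaProd hτ) hne (hd.comp (by fun_prop)) hd fun z => ?_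
    have := hh (z + Real.pi * τ)
    rw [th1_add_pi_tau, thetaProd_add_pi_tau hτ, hh z] at this
    have hne : -(pnome τ)⁻¹ * cexp (-2 * I * z) ≠ 0 := by simp [pnome]
    refine mul_left_cancel₀ hne ?_
    linear_combination -this
  have hconst := entire_const_of_norm_periodic hτ hd (fun z => by rw [p1]) (fun z => by rw [p2])
  refine ⟨h 0, fun h0 => ?_, fun z => by rw [hh z, hconst z 0, mul_comm]⟩
  obtain ⟨z, hz⟩ := exists_jacobiTheta₂_ne_zero hτ
  have hpi : (Real.pi : ℂ) ≠ 0 := by exact_mod_cast Real.pi_ne_zero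
  have := th1_eq_jacobiTheta₂ ((z - τ / 2 - 1 / 2) * Real.pi) τ
  rw [hh, hconst _ 0, h0, mul_zero, mul_div_cancel_right₀ _ hpi,
    show z - τ / 2 - 1 / 2 + τ / 2 + 1 / 2 = z by ring] at this
  simp [hz] at this

theorem th1_eq_zero_iff {τ : ℂ} (hτ : 0 < τ.im) (z : ℂ) : th1 z τ = 0 ↔ IsLat τ z := by
  refine ⟨fun h => ?_, th1_eq_zero_of_isLat⟩
  obtain ⟨c, hc, hcz⟩ := th1_eq_const_mul_thetaProd hτ
  by_contra hl
  rw [hcz] at h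
  exact mul_ne_zero hc (thetaProd_ne_zero hτ hl) h

theorem deriv_th1_ne_zero {τ : ℂ} (hτ : 0 < τ.im) {z : ℂ} (hz : th1 z τ = 0) :
    deriv (fun z => th1 z τ) z ≠ 0 := by
  obtain ⟨c, hc, hcz⟩ := th1_eq_const_mul_thetaProd hτ
  rw [funext hcz, deriv_const_mul_field]
  exact mul_ne_zero hc (zero_simple_thetaProd_of_isLat hτ ((th1_eq_zero_iff hτ z).mp hz)).2

end

section

/-! ### Consequences of the addition formula -/

lemma th2_mul_th1_eq {τ : ℂ} (hτ : 0 < τ.im) (u v : ℂ) :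
    th1 (u + v) (2 * τ) * th4 (u - v) (2 * τ) - th4 (u + v) (2 * τ) * th1 (u - v) (2 * τ)
      = th2 u τ * th1 v τ := by
  have := th1_mul_th4_add hτ v u
  rw [show v - u = -(u - v) by ring, th1_neg, th4_neg, add_comm v u] at this
  linear_combination this

lemma th1_mul_th4_eq {τ : ℂ} (hτ : 0 < τ.im) (x y : ℂ) :
    2 * (th1 x (2 * τ) * th4 y (2 * τ))
      = th1 ((x + y) / 2) τ * th2 ((x - y) / 2) τ + th2 ((x + y) / 2) τ * th1 ((x - y) / 2) τ := by
  have h1 := th1_mul_th4_add hτ ((x + y) / 2) ((x - y) / 2)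
  have h2 := th2_mul_th1_eq hτ ((x + y) / 2) ((x - y) / 2)
  rw [show (x + y) / 2 + (x - y) / 2 = x by ring, show (x + y) / 2 - (x - y) / 2 = y by ring]
    at h1 h2
  linear_combination h1 + h2

lemma th1_zero (τ : ℂ) : th1 0 τ = 0 := th1_eq_zero_of_isLat ⟨0, 0, by simp⟩

lemma th1_mul_th4_self {τ : ℂ} (hτ : 0 < τ.im) (z : ℂ) :
    2 * (th1 z (2 * τ) * th4 z (2 * τ)) = th1 z τ * th2 0 τ := by
  have := th1_mul_th4_eq hτ z z
  rw [show (z + z) / 2 = z by ring, show (z - z) / 2 = 0 by ring, th1_zero] at this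
  linear_combination this

lemma th1_two_mul {τ : ℂ} (hτ : 0 < τ.im) (u : ℂ) :
    th1 (2 * u) (2 * τ) * th4 0 (2 * τ) = th1 u τ * th2 u τ := by
  have := th1_mul_th4_add hτ u u
  rw [show u + u = 2 * u by ring, show u - u = 0 by ring, th1_zero] at this
  linear_combination this

lemma th1_pi_sub (z τ : ℂ) : th1 (Real.pi - z) τ = th1 z τ := by
  rw [show (Real.pi : ℂ) - z = -z + Real.pi by ring, th1_add_pi, th1_neg, neg_neg]

lemma th1_sub_pi (z τ : ℂ) : th1 (z - Real.pi) τ = -th1 z τ := by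
  have := th1_add_pi (z - Real.pi) τ
  rw [sub_add_cancel] at this
  rw [this, neg_neg]

lemma isLat_real_mul_pi {τ : ℂ} (hτ : 0 < τ.im) {r : ℝ} (h : IsLat τ (r * Real.pi)) :
    ∃ m : ℤ, r = m := by
  obtain ⟨m, n, h⟩ := h
  have him := congrArg Complex.im h
  simp at him
  have hn : n = 0 := by
    rcases him with h | h
    · exact h
    · exact absurd h hτ.ne'
  refine ⟨m, ?_⟩
  have hre := congrArg Complex.re h
  simpa [hn, Real.pi_ne_zero] using hre

lemma th1_rat_ne_zero {τ : ℂ} (hτ : 0 < τ.im) {z : ℂ} (a b : ℤ) (hz : b * z = a * Real.pi)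
    (hab : ¬ b ∣ a) : th1 z τ ≠ 0 := by
  have hb : b ≠ 0 := by
    rintro rfl
    have : a = 0 := by
      simpa [Real.pi_ne_zero] using hz
    exact hab (by simp [this])
  intro h
  rw [th1_eq_zero_iff hτ] at h
  have hz' : z = ((a / b : ℝ) : ℂ) * Real.pi := by
    have : (b : ℂ) ≠ 0 := by exact_mod_cast hb
    push_cast
    field_simp
    linear_combination hz
  rw [hz'] at h
  obtain ⟨m, hm⟩ := isLat_real_mul_pi hτ h
  have hb' : (b : ℝ) ≠ 0 := by exact_mod_cast hb
  rw [div_eq_iff hb'] at hm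
  exact hab ⟨m, by rw [mul_comm]; exact_mod_cast hm⟩

lemma th1_eta_ne_zero {τ : ℂ} (hτ : 0 < τ.im) : th1 ηc τ ≠ 0 :=
  th1_rat_ne_zero hτ 1 3 (by rw [ηc]; push_cast; ring) (by norm_num)

lemma th2_zero_ne_zero {τ : ℂ} (hτ : 0 < τ.im) : th2 0 τ ≠ 0 := by
  rw [th2_eq_th1]
  exact th1_rat_ne_zero hτ 1 2 (by push_cast; ring) (by norm_num)

lemma th2_eta_ne_zero {τ : ℂ} (hτ : 0 < τ.im) : th2 ηc τ ≠ 0 := by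
  rw [th2_eq_th1]
  exact th1_rat_ne_zero hτ 5 6 (by rw [ηc]; push_cast; ring) (by norm_num)

lemma th4_eq_zero_iff {τ : ℂ} (hτ : 0 < τ.im) (z : ℂ) :
    th4 z (2 * τ) = 0 ↔ IsLat (2 * τ) (z + Real.pi * τ) := by
  rw [← th1_eq_zero_iff (two_mul_im_pos hτ), th1_add_pi_tau']
  simp

lemma th4_real_ne_zero {τ : ℂ} (hτ : 0 < τ.im) (r : ℝ) : th4 r (2 * τ) ≠ 0 := by
  rw [Ne, th4_eq_zero_iff hτ]
  rintro ⟨m, n, h⟩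
  have him := congrArg Complex.im h
  simp at him
  have h2 : (Real.pi * τ.im) * (1 - 2 * n) = 0 := by linear_combination him
  have h3 : (1 : ℝ) - 2 * n = 0 := by
    rcases mul_eq_zero.mp h2 with h | h
    · exact absurd h (mul_pos Real.pi_pos hτ).ne'
    · exact h
  have : (1 : ℤ) - 2 * n = 0 := by exact_mod_cast h3
  omega

lemma th4_zero_ne_zero {τ : ℂ} (hτ : 0 < τ.im) : th4 0 (2 * τ) ≠ 0 := by
  simpa using th4_real_ne_zero hτ 0

lemma th4_two_eta_ne_zero {τ : ℂ} (hτ : 0 < τ.im) : th4 (2 * ηc) (2 * τ) ≠ 0 := by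
  have := th4_real_ne_zero hτ (2 * (Real.pi / 3))
  push_cast at this
  exact this

lemma th1_two_eta (τ : ℂ) : th1 (2 * ηc) τ = th1 ηc τ := by
  rw [← th1_pi_sub ηc]; congr 1; rw [ηc]; ring

lemma th4_two_eta_mul {τ : ℂ} (hτ : 0 < τ.im) :
    2 * (th4 (2 * ηc) (2 * τ) * th2 ηc τ) = th4 0 (2 * τ) * th2 0 τ := by
  have h1 := th1_mul_th4_self hτ (2 * ηc)
  have h2 := th1_two_mul hτ ηc
  rw [th1_two_eta τ] at h1
  refine mul_left_cancel₀ (th1_eta_ne_zero hτ) ?_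
  linear_combination th4 0 (2 * τ) * h1 - 2 * th4 (2 * ηc) (2 * τ) * h2

lemma rv_eq {τ : ℂ} (hτ : 0 < τ.im) (u : ℂ) :
    rv τ u = th4 (2 * ηc) (2 * τ) * th2 ηc τ * th1 (u + ηc) τ := by
  have := th1_mul_th4_add hτ (u + ηc) ηc
  rw [show u + ηc + ηc = u + 2 * ηc by ring, show u + ηc - ηc = u by ring] at this
  rw [rv, av, bv]
  linear_combination th4 (2 * ηc) (2 * τ) * this

lemma th4_add_two_pi_tau (z τ : ℂ) : th4 (z + 2 * (Real.pi * τ)) (2 * τ)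
    = -(pnome τ ^ 2)⁻¹ * cexp (-2 * I * z) * th4 z (2 * τ) := by
  rw [show z + 2 * (Real.pi * τ) = z + Real.pi * τ + Real.pi * τ by ring, th4_add_pi_tau',
    th1_add_pi_tau', pnome_sq, ← Complex.exp_neg]
  have : cexp (-(Real.pi * I * τ / 2)) * cexp (-I * (z + Real.pi * τ)) *
      cexp (-(Real.pi * I * τ / 2)) * cexp (-I * z)
      = cexp (-(2 * I * (Real.pi * τ))) * cexp (-2 * I * z) := by
    simp only [← Complex.exp_add]; congr 1; ring
  linear_combination -th4 z (2 * τ) * this + cexp (-(Real.pi * I * τ / 2)) *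
    cexp (-I * (z + Real.pi * τ)) * cexp (-(Real.pi * I * τ / 2)) * cexp (-I * z) *
    th4 z (2 * τ) * I_sq

/-! ### Quasi-periodic entire functions -/

/-- Entire functions `f` with `f (z + π) = ε f z` and `f (z + πτ) = C e^{-2iNz} f z`. -/
structure QP (τ : ℂ) (N : ℕ) (ε C : ℂ) (f : ℂ → ℂ) : Prop where
  diff : Differentiable ℂ f
  per : ∀ z, f (z + Real.pi) = ε * f z
  qper : ∀ z, f (z + Real.pi * τ) = C * cexp (-2 * I * (N * z)) * f z

namespace QP

variable {τ : ℂ} {N M : ℕ} {ε ε' C C' : ℂ} {f g : ℂ → ℂ}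

lemma mul (hf : QP τ N ε C f) (hg : QP τ M ε' C' g) :
    QP τ (N + M) (ε * ε') (C * C') (fun z => f z * g z) where
  diff := hf.diff.fun_mul hg.diff
  per z := by rw [hf.per, hg.per]; ring
  qper z := by
    rw [hf.qper, hg.qper, show -2 * I * (((N + M : ℕ) : ℂ) * z)
      = -2 * I * (N * z) + -2 * I * (M * z) by push_cast; ring, Complex.exp_add]
    ring

lemma const_mul (hf : QP τ N ε C f) (c : ℂ) : QP τ N ε C (fun z => c * f z) where
  diff := hf.diff.const_mul c
  per z := by rw [hf.per]; ring
  qper z := by rw [hf.qper]; ring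

lemma add (hf : QP τ N ε C f) (hg : QP τ N ε C g) : QP τ N ε C (fun z => f z + g z) where
  diff := hf.diff.fun_add hg.diff
  per z := by rw [hf.per, hg.per]; ring
  qper z := by rw [hf.qper, hg.qper]; ring

lemma zero : QP τ N ε C (fun _ => 0) where
  diff := by fun_prop
  per z := by simp
  qper z := by simp

lemma sum {ι : Type*} (s : Finset ι) {F : ι → ℂ → ℂ} (h : ∀ i ∈ s, QP τ N ε C (F i)) :
    QP τ N ε C (fun z => ∑ i ∈ s, F i z) := by
  classical
  induction s using Finset.induction_on with
  | empty => simpa using zero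
  | insert a s ha ih =>
    simp only [Finset.sum_insert ha]
    exact (h a (by simp)).add (ih fun i hi => h i (by simp [hi]))

lemma sub (hf : QP τ N ε C f) (hg : QP τ N ε C g) : QP τ N ε C (fun z => f z - g z) where
  diff := hf.diff.fun_sub hg.diff
  per z := by rw [hf.per, hg.per]; ring
  qper z := by rw [hf.qper, hg.qper]; ring

lemma one : QP τ 0 1 1 (fun _ => 1) where
  diff := by fun_prop
  per z := by simp
  qper z := by simp

lemma congr' (hf : QP τ N ε C f) (hN : N = M) (hε : ε = ε') (hC : C = C') : QP τ M ε' C' f := by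
  subst hN hε hC; exact hf

end QP

lemma QP_th1_sub {τ : ℂ} (hτ : 0 < τ.im) (a : ℂ) :
    QP τ 1 (-1) (-(pnome τ)⁻¹ * cexp (2 * I * a)) (fun z => th1 (z - a) τ) where
  diff := (differentiable_th1 hτ).comp (by fun_prop)
  per z := by rw [show z + Real.pi - a = z - a + Real.pi by ring, th1_add_pi]; ring
  qper z := by
    rw [show z + Real.pi * τ - a = z - a + Real.pi * τ by ring, th1_add_pi_tau,
      show -2 * I * (z - a) = 2 * I * a + -2 * I * (((1 : ℕ) : ℂ) * z) by push_cast; ring,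
      Complex.exp_add]
    ring

lemma pnome_ne_zero (τ : ℂ) : pnome τ ≠ 0 := Complex.exp_ne_zero _

lemma exists_th1_sub_ne_zero {τ : ℂ} (hτ : 0 < τ.im) (a : ℂ) : ∃ w, th1 (w - a) τ ≠ 0 :=
  ⟨a + ηc, by rw [add_sub_cancel_left]; exact th1_eta_ne_zero hτ⟩

namespace QP

variable {τ : ℂ} {N M : ℕ} {ε ε' C C' : ℂ} {f g : ℂ → ℂ}

lemma eq_zero_add_lat (hf : QP τ N ε C f) (hε : ε ≠ 0) (hC : C ≠ 0) {a z : ℂ} (ha : f a = 0)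
    (hz : IsLat τ (z - a)) : f z = 0 := by
  obtain ⟨m, n, hmn⟩ := hz
  have e1 := apply_add_int_mul (k := fun z => f z = 0) (w := Real.pi)
    (fun z => by simp [hf.per, hε]) m a
  have e2 := apply_add_int_mul (k := fun z => f z = 0) (w := Real.pi * τ)
    (fun z => by simp [hf.qper, hC]) n (a + m * Real.pi)
  rw [show z = a + m * Real.pi + n * (Real.pi * τ) by linear_combination hmn, e2, e1]
  exact ha

/-- Division by a theta factor at a zero. -/
lemma exists_factor (hτ : 0 < τ.im) (hf : QP τ (N + 1) ε C f) (hε : ε ≠ 0) (hC : C ≠ 0)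
    {a : ℂ} (ha : f a = 0) :
    ∃ g, QP τ N (-ε) (C * (-(pnome τ) * cexp (-(2 * I * a)))) g ∧
      ∀ z, f z = th1 (z - a) τ * g z := by
  have hq := QP_th1_sub hτ a
  obtain ⟨g, hg, hfg⟩ := exists_entire_factor hf.diff hq.diff (fun z hz => by
    refine ⟨hf.eq_zero_add_lat hε hC ha ((th1_eq_zero_iff hτ _).mp hz), ?_⟩
    rw [deriv_comp_sub_const (fun z => th1 z τ)]
    exact deriv_th1_ne_zero hτ hz)
  refine ⟨g, ⟨hg, ?_, ?_⟩, hfg⟩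
  · refine entire_eq_of_mul_eq hq.diff (exists_th1_sub_ne_zero hτ a) (hg.comp (by fun_prop))
      (hg.const_mul _) fun z => ?_
    have := hf.per z
    rw [hfg, hfg, hq.per] at this
    linear_combination -this
  · refine entire_eq_of_mul_eq hq.diff (exists_th1_sub_ne_zero hτ a) (hg.comp (by fun_prop))
      (by have := hg; fun_prop) fun z => ?_
    have := hf.qper z
    rw [hfg, hfg, hq.qper, show -2 * I * (((N + 1 : ℕ) : ℂ) * z)
      = -2 * I * (N * z) + -2 * I * z by push_cast; ring, Complex.exp_add,
      show -2 * I * (((1 : ℕ) : ℂ) * z) = -2 * I * z by push_cast; ring] at this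
    have hp := pnome_ne_zero τ
    have hE : cexp (2 * I * a) * cexp (-(2 * I * a)) = 1 := by rw [← Complex.exp_add]; simp
    have hz := Complex.exp_ne_zero (-2 * I * z)
    have hz2 := Complex.exp_ne_zero (2 * I * a)
    have hA : (pnome τ)⁻¹ * pnome τ = 1 := inv_mul_cancel₀ hp
    have hne : -(pnome τ)⁻¹ * cexp (2 * I * a) * cexp (-2 * I * z) ≠ 0 := by simp [hp]
    refine mul_left_cancel₀ hne ?_
    linear_combination this - C * cexp (-2 * I * (N * z)) * cexp (-2 * I * z) * th1 (z - a) τ *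
      g z * ((pnome τ)⁻¹ * pnome τ) * hE - C * cexp (-2 * I * (N * z)) * cexp (-2 * I * z) *
      th1 (z - a) τ * g z * hA

lemma eq_zero_of_degree_zero (hτ : 0 < τ.im) (hf : QP τ 0 ε C f) (hε : ‖ε‖ = 1) (hC : C ≠ 0)
    {a : ℂ} (ha : f a = 0) (z : ℂ) : f z = 0 := by
  set κ : ℝ := Real.log ‖C‖ / (Real.pi * τ.im) with hκ
  have hconst := entire_const_of_norm_periodic hτ (h := fun z => f z * cexp (I * (κ * z)))
    (by have := hf.diff; fun_prop)
    (fun z => by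
      rw [hf.per, norm_mul, norm_mul, norm_mul, hε, one_mul, Complex.norm_exp, Complex.norm_exp]
      congr 2; simp)
    (fun z => by
      rw [hf.qper, norm_mul, norm_mul, norm_mul, norm_mul, Complex.norm_exp (I * _),
        Complex.norm_exp (I * _)]
      have e1 : (I * (κ * (z + Real.pi * τ))).re = -Real.log ‖C‖ + (I * (κ * z)).re := by
        have : κ * (Real.pi * τ.im) = Real.log ‖C‖ := by
          rw [hκ, div_mul_cancel₀ _ (mul_pos Real.pi_pos hτ).ne']
        simp
        linear_combination -this
      rw [e1, Real.exp_add, Real.exp_neg, Real.exp_log (norm_pos_iff.mpr hC)]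
      have := norm_pos_iff.mpr hC
      simp
      field_simp) z a
  simp only [ha, zero_mul] at hconst
  exact (mul_eq_zero.mp hconst).resolve_right (Complex.exp_ne_zero _)

/-- A quasi-periodic function with more zeros than its degree vanishes. -/
theorem eq_zero_of_zeros (hτ : 0 < τ.im) (hf : QP τ N ε C f) (hε : ‖ε‖ = 1) (hC : C ≠ 0)
    (l : List ℂ) (hl : N < l.length) (hp : l.Pairwise fun a b => th1 (b - a) τ ≠ 0)
    (h0 : ∀ a ∈ l, f a = 0) (z : ℂ) : f z = 0 := by
  induction l generalizing N ε C f with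
  | nil => simp at hl
  | cons a l ih =>
    rw [List.pairwise_cons] at hp
    cases N with
    | zero => exact hf.eq_zero_of_degree_zero hτ hε hC (h0 a (by simp)) z
    | succ N =>
      have hε0 : ε ≠ 0 := by rintro rfl; simp at hε
      obtain ⟨g, hg, hfg⟩ := hf.exists_factor hτ hε0 hC (h0 a (by simp))
      rw [hfg, ih hg (by simpa using hε) (by simp [hC, pnome_ne_zero]) (by simpa using hl) hp.2
        (fun b hb => ?_), mul_zero]
      have := h0 b (by simp [hb])
      rw [hfg] at this
      exact (mul_eq_zero.mp this).resolve_left (hp.1 b hb)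

/-- Division by a list of theta factors at zeros. -/
theorem exists_factor_list (hτ : 0 < τ.im) (l : List ℂ) (hf : QP τ (N + l.length) ε C f)
    (hε : ‖ε‖ = 1) (hC : C ≠ 0) (hp : l.Pairwise fun a b => th1 (b - a) τ ≠ 0)
    (h0 : ∀ a ∈ l, f a = 0) :
    ∃ g, QP τ N ((-1) ^ l.length * ε)
      (C * (l.map fun a => -(pnome τ) * cexp (-(2 * I * a))).prod) g ∧
      ∀ z, f z = (l.map fun a => th1 (z - a) τ).prod * g z := by
  induction l generalizing ε C f with
  | nil => exact ⟨f, by simpa using hf, by simp⟩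
  | cons a l ih =>
    rw [List.pairwise_cons] at hp
    have hε0 : ε ≠ 0 := by rintro rfl; simp at hε
    obtain ⟨g, hg, hfg⟩ := exists_factor (N := N + l.length) hτ hf hε0 hC (h0 a (by simp))
    obtain ⟨k, hk, hgk⟩ := ih hg (by simpa using hε) (by simp [hC, pnome_ne_zero]) hp.2
      (fun b hb => by
        have := h0 b (by simp [hb])
        rw [hfg] at this
        exact (mul_eq_zero.mp this).resolve_left (hp.1 b hb))
    refine ⟨k, hk.congr' rfl ?_ ?_, fun z => ?_⟩
    · rw [List.length_cons, pow_succ]; ring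
    · rw [List.map_cons, List.prod_cons]; ring
    · rw [hfg, hgk, List.map_cons, List.prod_cons]; ring

end QP

end

section

/-! ### Interpolation and joint analyticity -/

lemma exists_mul_ne_zero {f g : ℂ → ℂ} (hf : Differentiable ℂ f) (hg : Differentiable ℂ g)
    (hf0 : ∃ z, f z ≠ 0) (hg0 : ∃ z, g z ≠ 0) : ∃ z, f z * g z ≠ 0 := by
  by_contra! h
  obtain ⟨z, hz⟩ := hg0
  exact hz (entire_eq_of_mul_eq hf hf0 hg (differentiable_const 0)
    (fun z => by rw [h, mul_zero]) z)

lemma exists_inequivalent_points {τ : ℂ} (hτ : 0 < τ.im) (M : ℕ) :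
    ∃ a : Fin (M + 1) → ℂ, ∀ i j, i ≠ j → th1 (a j - a i) τ ≠ 0 := by
  refine ⟨fun m => m * Real.pi / (M + 1 : ℕ), fun i j hij => ?_⟩
  have hM : ((M + 1 : ℕ) : ℂ) ≠ 0 := by exact_mod_cast Nat.succ_ne_zero M
  refine th1_rat_ne_zero hτ ((j : ℤ) - i) ((M + 1 : ℕ) : ℤ) ?_ ?_
  · push_cast at hM ⊢; field_simp
  · intro hd
    apply hij
    have hlt : |((j : ℤ) - i)| < ((M + 1 : ℕ) : ℤ) := by
      rw [abs_lt]
      have := i.2; have := j.2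
      constructor <;> omega
    have := Int.eq_zero_of_abs_lt_dvd hd hlt
    ext; omega

/-- The space of quasi-periodic entire functions of fixed type. -/
def QPspace (τ : ℂ) (N : ℕ) (ε C : ℂ) : Submodule ℂ (ℂ → ℂ) where
  carrier := {f | QP τ N ε C f}
  add_mem' hf hg := hf.add hg
  zero_mem' := QP.zero
  smul_mem' c _ hf := hf.const_mul c

lemma exists_interpolation {τ : ℂ} (hτ : 0 < τ.im) (M : ℕ) {ε C : ℂ} (hε : ‖ε‖ = 1) (hC : C ≠ 0) :
    ∃ (a : Fin (M + 1) → ℂ) (L : Fin (M + 1) → ℂ → ℂ), (∀ m, Differentiable ℂ (L m)) ∧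
      ∀ g, QP τ M ε C g → ∀ z, g z = ∑ m, g (a m) * L m z := by
  classical
  obtain ⟨a, ha⟩ := exists_inequivalent_points hτ M
  let ev : QPspace τ M ε C →ₗ[ℂ] (Fin (M + 1) → ℂ) :=
    { toFun := fun g m => (g : ℂ → ℂ) (a m)
      map_add' := fun _ _ => rfl
      map_smul' := fun _ _ => rfl }
  have hker : LinearMap.ker ev = ⊥ := by
    rw [LinearMap.ker_eq_bot']
    rintro ⟨g, hg⟩ h
    have hg' : QP τ M ε C g := hg
    ext z
    refine hg'.eq_zero_of_zeros hτ hε hC (List.ofFn a) (by simp) ?_ ?_ z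
    · rw [List.pairwise_ofFn]
      exact fun i j hij => ha i j hij.ne
    · intro b hb
      obtain ⟨m, rfl⟩ := (List.mem_ofFn' a b).mp hb
      exact congrFun h m
  obtain ⟨inv, hinv⟩ := LinearMap.exists_leftInverse_of_injective ev hker
  refine ⟨a, fun m => (inv (Pi.single m 1) : ℂ → ℂ), fun m => (inv (Pi.single m 1)).2.diff, ?_⟩
  intro g hg z
  have h1 : inv (ev ⟨g, hg⟩) = ⟨g, hg⟩ := LinearMap.congr_fun hinv ⟨g, hg⟩
  have h2 : ev ⟨g, hg⟩ = ∑ m, g (a m) • (Pi.single m 1 : Fin (M + 1) → ℂ) := by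
    ext k; simp [ev, Finset.sum_apply, Pi.single_apply]
  rw [h2, map_sum] at h1
  have h3 := congrArg (fun v : QPspace τ M ε C => (v : ℂ → ℂ) z) h1
  simp only [map_smul, Submodule.coe_sum, Finset.sum_apply, Submodule.coe_smul, Pi.smul_apply,
    smul_eq_mul] at h3
  exact h3.symm

lemma differentiable_antidiagonal {τ : ℂ} (hτ : 0 < τ.im) (N : ℕ) {ε c : ℂ} (hε : ‖ε‖ = 1)
    (hc : c ≠ 0) {F : ℂ → ℂ → ℂ}
    (h1 : ∀ w, QP τ N ε (c * cexp (2 * I * w)) (fun z => F z w))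
    (h2 : ∀ z, Differentiable ℂ (fun w => F z w)) :
    Differentiable ℂ (fun z => F z (-z)) := by
  have hG : ∀ w, QP τ (N + 1) (ε * -1) (c * (-(pnome τ)⁻¹ * cexp (2 * I * ηc)))
      (fun z => F z w * th1 (z - (ηc - w)) τ) := by
    intro w
    refine ((h1 w).mul (QP_th1_sub hτ (ηc - w))).congr' rfl rfl ?_
    rw [show 2 * I * ηc = 2 * I * w + 2 * I * (ηc - w) by ring, Complex.exp_add]
    ring
  obtain ⟨a, L, hL, hinteg⟩ := exists_interpolation hτ (N + 1) (ε := ε * -1)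
    (C := c * (-(pnome τ)⁻¹ * cexp (2 * I * ηc))) (by simpa using hε) (by simp [hc, pnome_ne_zero])
  have key : ∀ z, F z (-z) * th1 (-ηc) τ
      = ∑ m, (F (a m) (-z) * th1 (a m - (ηc - -z)) τ) * L m z := by
    intro z
    have := hinteg _ (hG (-z)) z
    rw [show z - (ηc - -z) = -ηc by ring] at this
    exact this
  have hd : Differentiable ℂ (fun z => F z (-z) * th1 (-ηc) τ) := by
    simp only [key]
    refine Differentiable.fun_sum fun m _ => ?_
    have e1 : Differentiable ℂ (fun z => F (a m) (-z)) := (h2 (a m)).comp differentiable_neg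
    have e2 : Differentiable ℂ (fun z => th1 (a m - (ηc - -z)) τ) :=
      (differentiable_th1 hτ).comp (by fun_prop)
    exact (e1.fun_mul e2).fun_mul (hL m)
  have hne : th1 (-ηc) τ ≠ 0 := by rw [th1_neg]; exact neg_ne_zero.mpr (th1_eta_ne_zero hτ)
  have : (fun z => F z (-z)) = fun z => (F z (-z) * th1 (-ηc) τ) * (th1 (-ηc) τ)⁻¹ := by
    funext z; field_simp
  rw [this]
  exact hd.mul_const _

end

section

/-! ### Weights and the scalar product -/

section Sites

variable {n : ℕ}

/-- The first site of the `m`-th pair. -/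
def siteA (m : Fin n) : Fin (2 * n + 1) := ⟨2 * (m : ℕ), by have := m.2; omega⟩

/-- The second site of the `m`-th pair. -/
def siteB (m : Fin n) : Fin (2 * n + 1) := ⟨2 * (m : ℕ) + 1, by have := m.2; omega⟩

/-- The last site. -/
def siteL : Fin (2 * n + 1) := ⟨2 * n, by omega⟩

lemma siteA_ne_siteB (m m' : Fin n) : siteA m ≠ siteB m' := by
  intro h; have := congrArg Fin.val h; simp [siteA, siteB] at this; omega

lemma siteL_ne_siteB (m : Fin n) : (siteL : Fin (2 * n + 1)) ≠ siteB m := by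
  intro h; have e := congrArg Fin.val h; have := m.2; simp only [siteL, siteB] at e; omega

lemma siteL_ne_siteA (m : Fin n) : (siteL : Fin (2 * n + 1)) ≠ siteA m := by
  intro h; have e := congrArg Fin.val h; have := m.2; simp only [siteL, siteA] at e; omega

lemma siteA_injective : Function.Injective (siteA : Fin n → _) := by
  intro m m' h; have := congrArg Fin.val h; simp [siteA] at this; exact Fin.ext this

lemma siteB_injective : Function.Injective (siteB : Fin n → _) := by
  intro m m' h; have := congrArg Fin.val h; simp [siteB] at this; exact Fin.ext this

/-- The weight of a spin configuration, given the weights of the pairs. -/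
def pairWeight (h : Fin n → Fin 2 → Fin 2 → ℂ) (α : Fin (2 * n + 1) → Fin 2) : ℂ :=
  (∏ m, h m (α (siteA m)) (α (siteB m))) * (if α siteL = 0 then (1 : ℂ) else 0)

/-- The weight of a spin configuration without the contribution of a set of pairs. -/
def restWeight (S : Finset (Fin n)) (h : Fin n → Fin 2 → Fin 2 → ℂ)
    (α : Fin (2 * n + 1) → Fin 2) : ℂ :=
  (∏ m ∈ Sᶜ, h m (α (siteA m)) (α (siteB m))) * (if α siteL = 0 then (1 : ℂ) else 0)

lemma Zfun_eq_sum (τ lam : ℂ) (Ψ : PsiFam) (x : Fin n → ℂ) :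
    Zfun τ lam Ψ n x
      = ∑ α, pairWeight (fun m => chiC τ lam (x m)) α * Ψ n (interleave x) α := rfl

lemma pairWeight_eq (S : Finset (Fin n)) (h : Fin n → Fin 2 → Fin 2 → ℂ)
    (α : Fin (2 * n + 1) → Fin 2) :
    pairWeight h α = (∏ m ∈ S, h m (α (siteA m)) (α (siteB m))) * restWeight S h α := by
  rw [pairWeight, restWeight, ← mul_assoc, Finset.prod_mul_prod_compl]

lemma restWeight_congr {S : Finset (Fin n)} {h h' : Fin n → Fin 2 → Fin 2 → ℂ}
    {α β : Fin (2 * n + 1) → Fin 2} (hh : ∀ m ∉ S, h m = h' m)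
    (hA : ∀ m ∉ S, α (siteA m) = β (siteA m)) (hB : ∀ m ∉ S, α (siteB m) = β (siteB m))
    (hL : α siteL = β siteL) : restWeight S h α = restWeight S h' β := by
  unfold restWeight
  rw [hL]
  congr 1
  refine Finset.prod_congr rfl fun m hm => ?_
  have hm' := Finset.mem_compl.mp hm
  rw [hh m hm', hA m hm', hB m hm']

lemma restWeight_single_congr {m : Fin n} {h h' : Fin n → Fin 2 → Fin 2 → ℂ}
    {α β : Fin (2 * n + 1) → Fin 2} (hh : ∀ m' ≠ m, h m' = h' m')
    (hab : ∀ l, l ≠ siteA m → l ≠ siteB m → α l = β l) :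
    restWeight {m} h α = restWeight {m} h' β := by
  refine restWeight_congr (fun m' hm' => hh m' (by simpa using hm')) (fun m' hm' => ?_)
    (fun m' hm' => ?_) ?_
  · exact hab _ (fun e => hm' (by simp [siteA_injective e])) (siteA_ne_siteB _ _)
  · exact hab _ (siteA_ne_siteB _ _).symm (fun e => hm' (by simp [siteB_injective e]))
  · exact hab _ (siteL_ne_siteA _) (siteL_ne_siteB _)

lemma pairWeight_single (m : Fin n) (h : Fin n → Fin 2 → Fin 2 → ℂ)
    (α : Fin (2 * n + 1) → Fin 2) :
    pairWeight h α = h m (α (siteA m)) (α (siteB m)) * restWeight {m} h α := by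
  rw [pairWeight_eq {m}, Finset.prod_singleton]

lemma interleave_siteA (x : Fin n → ℂ) (m : Fin n) : interleave x (siteA m) = x m := by
  have := m.2
  have h : 2 * (m : ℕ) < 2 * n := by omega
  simp [interleave, siteA, h]

lemma interleave_siteB (x : Fin n → ℂ) (m : Fin n) : interleave x (siteB m) = -x m := by
  have := m.2
  have h : 2 * (m : ℕ) + 1 < 2 * n := by omega
  have h2 : (2 * (m : ℕ) + 1) / 2 = m := by omega
  simp [interleave, siteB, h, h2]

lemma interleave_siteL (x : Fin n → ℂ) : interleave x siteL = 0 := by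
  simp [interleave, siteL]

lemma site_cases (l : Fin (2 * n + 1)) :
    (∃ m, l = siteA m) ∨ (∃ m, l = siteB m) ∨ l = siteL := by
  have hl := l.2
  by_cases h : (l : ℕ) < 2 * n
  · rcases Nat.mod_two_eq_zero_or_one l with h0 | h0
    · exact Or.inl ⟨⟨(l : ℕ) / 2, by omega⟩, Fin.ext (by simp [siteA]; omega)⟩
    · exact Or.inr (Or.inl ⟨⟨(l : ℕ) / 2, by omega⟩, Fin.ext (by simp [siteB]; omega)⟩)
  · exact Or.inr (Or.inr (Fin.ext (by simp [siteL]; omega)))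

lemma interleave_update (x : Fin n → ℂ) (m : Fin n) (z : ℂ) :
    interleave (Function.update x m z)
      = Function.update (Function.update (interleave x) (siteA m) z) (siteB m) (-z) := by
  funext l
  rcases site_cases l with ⟨m', rfl⟩ | ⟨m', rfl⟩ | rfl
  · rw [interleave_siteA, Function.update_of_ne (siteA_ne_siteB _ _)]
    by_cases hm : m' = m
    · subst hm; simp
    · rw [Function.update_of_ne hm, Function.update_of_ne (fun e => hm (siteA_injective e)),
        interleave_siteA]
  · rw [interleave_siteB]
    by_cases hm : m' = m
    · subst hm; simp
    · rw [Function.update_of_ne hm, Function.update_of_ne (fun e => hm (siteB_injective e)),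
        Function.update_of_ne (siteA_ne_siteB _ _).symm, interleave_siteB]
  · rw [interleave_siteL, Function.update_of_ne (siteL_ne_siteB _),
      Function.update_of_ne (siteL_ne_siteA _), interleave_siteL]

lemma site_bijective : Function.Bijective
    (Sum.elim (Sum.elim siteA siteB) (fun _ : Unit => siteL) :
      (Fin n ⊕ Fin n) ⊕ Unit → Fin (2 * n + 1)) := by
  constructor
  · rintro ((m | m) | m) ((m' | m') | m') h <;> simp only [Sum.elim_inl, Sum.elim_inr] at h
    · rw [siteA_injective h]
    · exact absurd h (siteA_ne_siteB _ _)
    · exact absurd h.symm (siteL_ne_siteA _)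
    · exact absurd h.symm (siteA_ne_siteB _ _)
    · rw [siteB_injective h]
    · exact absurd h.symm (siteL_ne_siteB _)
    · exact absurd h (siteL_ne_siteA _)
    · exact absurd h (siteL_ne_siteB _)
    · rfl
  · intro l
    rcases site_cases l with ⟨m, rfl⟩ | ⟨m, rfl⟩ | rfl
    · exact ⟨Sum.inl (Sum.inl m), rfl⟩
    · exact ⟨Sum.inl (Sum.inr m), rfl⟩
    · exact ⟨Sum.inr (), rfl⟩

@[to_additive]
lemma prod_sites {M : Type*} [CommMonoid M] (u : Fin (2 * n + 1) → M) :
    ∏ l, u l = (∏ m, u (siteA m) * u (siteB m)) * u siteL := by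
  rw [← (Equiv.ofBijective _ site_bijective).prod_comp, Fintype.prod_sum_type,
    Fintype.prod_sum_type, Finset.prod_mul_distrib]
  simp [Equiv.ofBijective]

lemma sum_interleave (x : Fin n → ℂ) : ∑ l, interleave x l = 0 := by
  rw [sum_sites]
  simp [interleave_siteA, interleave_siteB, interleave_siteL]

end Sites

end

section

/-! ### Quasi-periodicity of the scalar product -/

lemma flipS_flipS (s : Fin 2) : flipS (flipS s) = s := by
  fin_cases s <;> rfl

lemma differentiable_chiC {τ : ℂ} (hτ : 0 < τ.im) (lam : ℂ) (s t : Fin 2) :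
    Differentiable ℂ (fun x => chiC τ lam x s t) := by
  have h1 := differentiable_th1 (two_mul_im_pos hτ)
  have h4 := differentiable_th4 (two_mul_im_pos hτ)
  unfold chiC
  split_ifs
  · exact (h1.comp (by fun_prop)).fun_mul (h4.comp (by fun_prop))
  · exact (h1.comp (by fun_prop)).fun_mul (h4.comp (by fun_prop))
  · exact differentiable_const _

lemma differentiable_chiC_lam {τ : ℂ} (hτ : 0 < τ.im) (x : ℂ) (s t : Fin 2) :
    Differentiable ℂ (fun lam => chiC τ lam x s t) := by
  have h1 := differentiable_th1 (two_mul_im_pos hτ)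
  have h4 := differentiable_th4 (two_mul_im_pos hτ)
  unfold chiC
  split_ifs
  · exact (h1.comp (by fun_prop)).fun_mul (h4.comp (by fun_prop))
  · exact (h1.comp (by fun_prop)).fun_mul (h4.comp (by fun_prop))
  · exact differentiable_const _

lemma chiC_add_pi (τ lam x : ℂ) (s t : Fin 2) :
    chiC τ lam (x + Real.pi) s t = -chiC τ lam x s t := by
  unfold chiC
  rw [show x + Real.pi + lam = x + lam + Real.pi by ring,
    show x + Real.pi - lam - 2 * ηc = x - lam - 2 * ηc + Real.pi by ring]
  simp only [th1_add_pi, th4_add_pi]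
  split_ifs <;> ring

lemma chiC_self (τ lam x : ℂ) (s : Fin 2) : chiC τ lam x s s = 0 := by
  fin_cases s <;> simp [chiC]

lemma chiC_add_pi_tau (τ lam x : ℂ) (s t : Fin 2) :
    chiC τ lam (x + Real.pi * τ) s t
      = -(pnome τ)⁻¹ * cexp (-2 * I * (x - ηc)) * chiC τ lam x (flipS s) (flipS t) := by
  have e1 : ∀ a b : ℂ, I * cexp (-(Real.pi * I * τ / 2)) * cexp (-I * a)
      * (I * cexp (-(Real.pi * I * τ / 2)) * cexp (-I * b))
      = -(pnome τ)⁻¹ * cexp (-I * (a + b)) := by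
    intro a b
    rw [pnome, ← Complex.exp_neg,
      show -I * (a + b) = -I * a + -I * b by ring, Complex.exp_add,
      show -(Real.pi * I * τ) = -(Real.pi * I * τ / 2) + -(Real.pi * I * τ / 2) by ring,
      Complex.exp_add]
    linear_combination (cexp (-(Real.pi * I * τ / 2)) * cexp (-I * a)
      * (cexp (-(Real.pi * I * τ / 2)) * cexp (-I * b))) * Complex.I_mul_I
  have e2 := e1 (x + lam) (x - lam - 2 * ηc)
  rw [show -I * (x + lam + (x - lam - 2 * ηc)) = -2 * I * (x - ηc) by ring] at e2
  rw [← e2]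
  unfold chiC
  rw [show x + Real.pi * τ + lam = x + lam + Real.pi * τ by ring,
    show x + Real.pi * τ - lam - 2 * ηc = x - lam - 2 * ηc + Real.pi * τ by ring]
  simp only [th1_add_pi_tau', th4_add_pi_tau']
  fin_cases s <;> fin_cases t <;> simp [flipS] <;> ring

section

variable {τ : ℂ} {Ψ : PsiFam} {n : ℕ}

lemma sum_update {L : ℕ} (u : Fin L → ℂ) (a : Fin L) (z : ℂ) :
    ∑ l, Function.update u a z l = (∑ l, u l) - u a + z := by
  rw [Finset.sum_update_of_mem (Finset.mem_univ _), Finset.sdiff_singleton_eq_erase,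
    ← Finset.add_sum_erase _ _ (Finset.mem_univ a)]
  ring

lemma norm_prod_sign {L : ℕ} (S : Finset (Fin L)) (α : Fin L → Fin 2) :
    ‖∏ j ∈ S, (if α j = 0 then (1 : ℂ) else -1)‖ = 1 := by
  rw [norm_prod]
  refine Finset.prod_eq_one fun j _ => ?_
  split_ifs <;> simp

lemma QP_Psi (hent : PsiEntire Ψ) (h3 : PsiP3 τ Ψ) (u : Fin (2 * n + 1) → ℂ)
    (a : Fin (2 * n + 1)) (α : Fin (2 * n + 1) → Fin 2) :
    QP (2 * τ) (2 * n) (∏ j ∈ Finset.univ.erase a, (if α j = 0 then (1 : ℂ) else -1))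
      ((pnome τ ^ (4 * n))⁻¹ * cexp (2 * I * ((∑ l, u l) - u a)))
      (fun z => Ψ n (Function.update u a z) α) where
  diff := hent n u a α
  per z := by
    have := congrFun (h3 n (Function.update u a z) a).1 α
    simpa using this
  qper z := by
    have := congrFun (h3 n (Function.update u a z) a).2 α
    simp only [Function.update_self, Function.update_idem] at this
    rw [show z + Real.pi * (2 * τ) = z + 2 * Real.pi * τ by ring, this,
      Finset.sum_sub_distrib, sum_update, mul_assoc _ (cexp _) (cexp _), ← Complex.exp_add]
    congr 3
    simp
    ring

lemma differentiable_Psi_antidiagonal (hτ : 0 < τ.im) (hent : PsiEntire Ψ) (h3 : PsiP3 τ Ψ)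
    (u : Fin (2 * n + 1) → ℂ) {a b : Fin (2 * n + 1)} (hab : a ≠ b)
    (α : Fin (2 * n + 1) → Fin 2) :
    Differentiable ℂ (fun z => Ψ n (Function.update (Function.update u a z) b (-z)) α) := by
  refine differentiable_antidiagonal (two_mul_im_pos hτ) (2 * n)
    (ε := ∏ j ∈ Finset.univ.erase a, (if α j = 0 then (1 : ℂ) else -1))
    (c := (pnome τ ^ (4 * n))⁻¹ * cexp (2 * I * ((∑ l, u l) - u a - u b)))
    (F := fun z w => Ψ n (Function.update (Function.update u a z) b w) α)
    (norm_prod_sign _ _) (by simp [pnome_ne_zero]) (fun w => ?_) (fun z => hent n _ b α)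
  have := QP_Psi hent h3 (Function.update u b w) a α
  simp only [Function.update_comm hab.symm] at this
  refine this.congr' rfl rfl ?_
  rw [sum_update, Function.update_of_ne hab, mul_assoc _ (cexp _) (cexp _), ← Complex.exp_add]
  congr 2
  ring

lemma differentiable_Zfun (hτ : 0 < τ.im) (hent : PsiEntire Ψ) (h3 : PsiP3 τ Ψ) (lam : ℂ)
    (x : Fin n → ℂ) (m : Fin n) :
    Differentiable ℂ (fun z => Zfun τ lam Ψ n (Function.update x m z)) := by
  simp only [Zfun_eq_sum, interleave_update, pairWeight]
  refine Differentiable.fun_sum fun α _ => ?_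
  refine Differentiable.fun_mul (Differentiable.mul_const ?_ _)
    (differentiable_Psi_antidiagonal hτ hent h3 _ (siteA_ne_siteB m m) α)
  refine Differentiable.fun_finsetProd fun m' _ => ?_
  by_cases hm : m' = m
  · subst hm; simpa using differentiable_chiC hτ lam _ _
  · simp [Function.update_of_ne hm]

lemma differentiable_Zfun_lam (hτ : 0 < τ.im) (x : Fin n → ℂ) :
    Differentiable ℂ (fun lam => Zfun τ lam Ψ n x) := by
  simp only [Zfun_eq_sum, pairWeight]
  refine Differentiable.fun_sum fun α _ => ?_
  refine Differentiable.mul_const (Differentiable.mul_const ?_ _) _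
  exact Differentiable.fun_finsetProd fun m' _ => differentiable_chiC_lam hτ _ _ _

lemma Psi_sub_pi (h3 : PsiP3 τ Ψ) (u : Fin (2 * n + 1) → ℂ) (b : Fin (2 * n + 1))
    (α : Fin (2 * n + 1) → Fin 2) :
    Ψ n (Function.update u b (u b - Real.pi)) α
      = (∏ j ∈ Finset.univ.erase b, (if α j = 0 then (1 : ℂ) else -1)) * Ψ n u α := by
  have := congrFun (h3 n (Function.update u b (u b - Real.pi)) b).1 α
  simp only [Function.update_self, sub_add_cancel, Function.update_idem,
    Function.update_eq_self] at this
  rw [this, ← mul_assoc, ← Finset.prod_mul_distrib, Finset.prod_eq_one, one_mul]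
  intro j _
  split_ifs <;> simp

lemma prod_erase_sign_mul {L : ℕ} {a b : Fin L} {α : Fin L → Fin 2}
    (h : α a ≠ α b) :
    (∏ j ∈ Finset.univ.erase b, (if α j = 0 then (1 : ℂ) else -1))
      * (∏ j ∈ Finset.univ.erase a, (if α j = 0 then (1 : ℂ) else -1)) = -1 := by
  set s : Fin L → ℂ := fun j => if α j = 0 then (1 : ℂ) else -1 with hs
  have hsq : ∀ j, s j * s j = 1 := by intro j; simp only [hs]; split_ifs <;> simp
  have hab' : s a * s b = -1 := by
    simp only [hs]
    have : ∀ p q : Fin 2, p ≠ q →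
        (if p = 0 then (1 : ℂ) else -1) * (if q = 0 then (1 : ℂ) else -1) = -1 := by
      intro p q hpq
      fin_cases p <;> fin_cases q <;> simp at hpq ⊢
    exact this _ _ h
  have hb := Finset.mul_prod_erase Finset.univ s (Finset.mem_univ b)
  have ha := Finset.mul_prod_erase Finset.univ s (Finset.mem_univ a)
  have hall : (∏ j, s j) * (∏ j, s j) = 1 := by
    rw [← Finset.prod_mul_distrib]; exact Finset.prod_eq_one fun j _ => hsq j
  have e : (s a * s b) * ((∏ j ∈ Finset.univ.erase b, s j) * ∏ j ∈ Finset.univ.erase a, s j) = 1 := by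
    rw [← hall]; nth_rewrite 1 [← hb]; rw [← ha]; ring
  rw [hab'] at e
  linear_combination -e

lemma Psi_flip (h2 : PsiP2 τ Ψ) (u : Fin (2 * n + 1) → ℂ) (a : Fin (2 * n + 1))
    (α : Fin (2 * n + 1) → Fin 2) :
    Ψ n (Function.update u a (u a + Real.pi * τ)) α
      = ((-(pnome τ)) ^ n)⁻¹ * cexp (I * ∑ j, (u j - u a))
        * Ψ n u (Function.update α a (flipS (α a))) := by
  rw [h2 n u a α]
  have h0 : (-(pnome τ)) ^ n ≠ 0 := pow_ne_zero _ (neg_ne_zero.mpr (pnome_ne_zero τ))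
  rw [show -I * ∑ j, (u j - u a) = -(I * ∑ j, (u j - u a)) by ring, Complex.exp_neg]
  have := Complex.exp_ne_zero (I * ∑ j, (u j - u a))
  field_simp

lemma Psi_flip_sub (h2 : PsiP2 τ Ψ) (u : Fin (2 * n + 1) → ℂ) (b : Fin (2 * n + 1))
    (α : Fin (2 * n + 1) → Fin 2) :
    Ψ n (Function.update u b (u b - Real.pi * τ)) α
      = (-(pnome τ)) ^ n * cexp (-I * ((∑ j, u j) - (2 * n + 1) * u b + 2 * n * (Real.pi * τ)))
        * Ψ n u (Function.update α b (flipS (α b))) := by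
  have := h2 n (Function.update u b (u b - Real.pi * τ)) b (Function.update α b (flipS (α b)))
  simp only [Function.update_self, Function.update_idem, flipS_flipS, Function.update_eq_self,
    sub_add_cancel] at this
  rw [this, Finset.sum_sub_distrib, sum_update]
  congr 4
  simp
  ring

/-- Simultaneous spin flip of two sites. -/
def flipTwo {L : ℕ} (a b : Fin L) (α : Fin L → Fin 2) : Fin L → Fin 2 :=
  Function.update (Function.update α b (flipS (α b))) a (flipS (α a))

lemma flipTwo_flipTwo {L : ℕ} {a b : Fin L} (hab : a ≠ b) (α : Fin L → Fin 2) :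
    flipTwo a b (flipTwo a b α) = α := by
  funext l
  unfold flipTwo
  by_cases h : l = a
  · subst h; simp [flipS_flipS]
  · by_cases h' : l = b
    · subst h'; simp [h, flipS_flipS]
    · simp [h, h']

lemma QP_Zfun (hτ : 0 < τ.im) (hent : PsiEntire Ψ) (h2 : PsiP2 τ Ψ) (h3 : PsiP3 τ Ψ) (lam : ℂ)
    (x : Fin n → ℂ) (m : Fin n) :
    QP τ (2 * n + 2) 1 (-((pnome τ) ^ (2 * n + 2))⁻¹ * cexp (2 * I * ηc))
      (fun z => Zfun τ lam Ψ n (Function.update x m z)) where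
  diff := differentiable_Zfun hτ hent h3 lam x m
  per z := by
    simp only [Zfun_eq_sum, one_mul]
    refine Finset.sum_congr rfl fun α _ => ?_
    by_cases h : α (siteA m) = α (siteB m)
    · rw [pairWeight_single m, pairWeight_single m]; simp [h, chiC_self]
    have hab := siteA_ne_siteB m m
    set u := interleave (Function.update x m z) with hu
    have e : interleave (Function.update x m (z + Real.pi))
        = Function.update (Function.update u (siteA m) (u (siteA m) + Real.pi)) (siteB m)
          (Function.update u (siteA m) (u (siteA m) + Real.pi) (siteB m) - Real.pi) := by
      rw [Function.update_of_ne hab.symm, hu, interleave_siteA, interleave_siteB,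
        ← Function.update_idem (a := m) (v := z) (w := z + Real.pi) (f := x), interleave_update]
      simp; congr 1; ring
    rw [e, Psi_sub_pi h3, congrFun (h3 n u (siteA m)).1 α, ← mul_assoc (∏ j ∈ _, _),
      prod_erase_sign_mul h, pairWeight_single m, pairWeight_single m,
      restWeight_single_congr (h' := fun m' => chiC τ lam (Function.update x m z m')) (β := α)
        (fun m' hm' => by simp [hm']) (fun _ _ _ => rfl)]
    simp [chiC_add_pi]
  qper z := by
    simp only [Zfun_eq_sum]
    have hab := siteA_ne_siteB m m
    set u := interleave (Function.update x m z) with hu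
    have hsum : ∑ j, u j = 0 := sum_interleave _
    have hua : u (siteA m) = z := by rw [hu, interleave_siteA]; simp
    have hub : u (siteB m) = -z := by rw [hu, interleave_siteB]; simp
    have e : interleave (Function.update x m (z + Real.pi * τ))
        = Function.update (Function.update u (siteA m) (u (siteA m) + Real.pi * τ)) (siteB m)
          (Function.update u (siteA m) (u (siteA m) + Real.pi * τ) (siteB m) - Real.pi * τ) := by
      rw [Function.update_of_ne hab.symm, hua, hub, hu,
        ← Function.update_idem (a := m) (v := z) (w := z + Real.pi * τ) (f := x), interleave_update]
      congr 1; ring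
    rw [e, Finset.mul_sum]
    refine Finset.sum_nbij' (flipTwo (siteA m) (siteB m)) (flipTwo (siteA m) (siteB m))
      (by simp) (by simp) (fun α _ => flipTwo_flipTwo hab α) (fun α _ => flipTwo_flipTwo hab α) ?_
    intro α _
    rw [Psi_flip_sub h2, Psi_flip h2, sum_update, Finset.sum_sub_distrib, hsum,
      Function.update_of_ne hab.symm, hua, hub, pairWeight_single m, pairWeight_single m,
      restWeight_single_congr (h' := fun m' => chiC τ lam (Function.update x m z m'))
        (β := flipTwo (siteA m) (siteB m) α)
        (fun m' hm' => by simp [hm']) (fun l hl hl' => by simp [flipTwo, hl, hl'])]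
    have e3 : Function.update (Function.update α (siteB m) (flipS (α (siteB m)))) (siteA m)
        (flipS (Function.update α (siteB m) (flipS (α (siteB m))) (siteA m)))
        = flipTwo (siteA m) (siteB m) α := by
      rw [Function.update_of_ne hab]; rfl
    have e4 : flipTwo (siteA m) (siteB m) α (siteA m) = flipS (α (siteA m)) := by simp [flipTwo]
    have e5 : flipTwo (siteA m) (siteB m) α (siteB m) = flipS (α (siteB m)) := by
      simp [flipTwo, hab.symm]
    rw [e3, e4, e5]
    simp only [Function.update_self, chiC_add_pi_tau]
    have h0 : (-(pnome τ)) ^ n ≠ 0 := pow_ne_zero _ (neg_ne_zero.mpr (pnome_ne_zero τ))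
    have hp := pnome_ne_zero τ
    have e6 : (pnome τ)⁻¹ * cexp (-2 * I * (z - ηc))
        * cexp (-I * (0 - z + (z + Real.pi * τ) - (2 * n + 1) * -z + 2 * n * (Real.pi * τ)))
        * cexp (I * (0 - ∑ j : Fin (2 * n + 1), z))
        = ((pnome τ) ^ (2 * n + 2))⁻¹ * cexp (2 * I * ηc)
          * cexp (-2 * I * ((2 * n + 2 : ℕ) * z)) := by
      rw [pnome, ← Complex.exp_nat_mul, ← Complex.exp_neg, ← Complex.exp_neg]
      simp only [← Complex.exp_add]
      congr 1
      simp
      ring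
    generalize chiC τ lam z (flipS (α (siteA m))) (flipS (α (siteB m))) = q at *
    generalize restWeight {m} (fun m' => chiC τ lam (Function.update x m z m'))
      (flipTwo (siteA m) (siteB m) α) = q' at *
    generalize Ψ n u (flipTwo (siteA m) (siteB m) α) = q'' at *
    have e7 : (-(pnome τ)) ^ n * ((-(pnome τ)) ^ n)⁻¹ = 1 := mul_inv_cancel₀ h0
    linear_combination (-q * q' * q'') * e6 - (q * q' * q'' * (pnome τ)⁻¹ * cexp (-2 * I * (z - ηc))
        * cexp (-I * (0 - z + (z + Real.pi * τ) - (2 * n + 1) * -z + 2 * n * (Real.pi * τ)))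
        * cexp (I * (0 - ∑ j : Fin (2 * n + 1), z))) * e7

end

end

section

/-! ### Transposition of the `Ř`-matrix -/

lemma Rcheckent_comm (τ u : ℂ) (p q : Fin 2 × Fin 2) : Rcheckent τ u p q = Rcheckent τ u q p := by
  obtain ⟨p1, p2⟩ := p
  obtain ⟨q1, q2⟩ := q
  fin_cases p1 <;> fin_cases p2 <;> fin_cases q1 <;> fin_cases q2 <;> simp [Rcheckent, Rent]

lemma sum_mul_applyRc (τ u : ℂ) {L : ℕ} {i j : Fin L} (hij : i ≠ j)
    (W ψ : (Fin L → Fin 2) → ℂ) :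
    ∑ α, W α * applyRc τ u i j ψ α = ∑ α, applyRc τ u i j W α * ψ α := by
  simp only [applyRc, Finset.mul_sum, Finset.sum_mul]
  simp only [← Fintype.sum_prod_type']
  let e : (Fin L → Fin 2) × Fin 2 × Fin 2 → (Fin L → Fin 2) × Fin 2 × Fin 2 := fun q =>
    (Function.update (Function.update q.1 i q.2.1) j q.2.2, q.1 i, q.1 j)
  have he : ∀ q, e (e q) = q := by
    rintro ⟨α, s, t⟩
    simp only [e, Prod.mk.injEq]
    refine ⟨?_, ?_, ?_⟩
    · funext l
      by_cases h : l = j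
      · subst h; simp
      · by_cases h' : l = i
        · subst h'; simp [h]
        · simp [h, h']
    · simp [hij]
    · simp
  refine Finset.sum_nbij' e e (by simp) (by simp) (fun q _ => he q) (fun q _ => he q) ?_
  rintro ⟨α, s, t⟩ _
  have h1 := congrArg Prod.fst (he (α, s, t))
  simp only [e] at h1 ⊢
  rw [h1, Rcheckent_comm]
  simp only [Function.update_self, Function.update_of_ne hij]
  ring

lemma rv_mul_sum {τ : ℂ} {Ψ : PsiFam} (h1 : PsiP1 τ Ψ) {n : ℕ} (u : Fin (2 * n + 1) → ℂ)
    {i j : Fin (2 * n + 1)} (hij : (j : ℕ) = (i : ℕ) + 1) (W : (Fin (2 * n + 1) → Fin 2) → ℂ) :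
    rv τ (u j - u i) * ∑ α, W α * Ψ n (fun l => u (Equiv.swap i j l)) α
      = ∑ α, applyRc τ (u j - u i) i j W α * Ψ n u α := by
  rw [← sum_mul_applyRc τ _ (by rintro rfl; omega), h1 n u i j hij, Finset.mul_sum]
  exact Finset.sum_congr rfl fun α _ => by ring

lemma th2_neg (z τ : ℂ) : th2 (-z) τ = th2 z τ := by
  rw [th2_eq_th1, th2_eq_th1, ← th1_pi_sub]
  congr 1
  ring

section Theta

variable {τ : ℂ}

lemma th1_th4_add (hτ : 0 < τ.im)
    (x y : ℂ) : th1 x (2 * τ) * th4 y (2 * τ) + th4 x (2 * τ) * th1 y (2 * τ)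
    = th1 ((x + y) / 2) τ * th2 ((x - y) / 2) τ := by
  have e1 := th1_mul_th4_eq hτ x y
  have e2 := th1_mul_th4_eq hτ y x
  rw [add_comm y x, show (y - x) / 2 = -((x - y) / 2) by ring, th1_neg, th2_neg] at e2
  linear_combination (e1 + e2) / 2

lemma th1_th4_sub (hτ : 0 < τ.im)
    (x y : ℂ) : th1 x (2 * τ) * th4 y (2 * τ) - th4 x (2 * τ) * th1 y (2 * τ)
    = th2 ((x + y) / 2) τ * th1 ((x - y) / 2) τ := by
  have e1 := th1_mul_th4_eq hτ x y
  have e2 := th1_mul_th4_eq hτ y x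
  rw [add_comm y x, show (y - x) / 2 = -((x - y) / 2) by ring, th1_neg, th2_neg] at e2
  linear_combination (e1 - e2) / 2

lemma chiC_add (hτ : 0 < τ.im) (lam x : ℂ) :
    chiC τ lam x 0 1 + chiC τ lam x 1 0 = th1 (x - ηc) τ * th2 (lam + ηc) τ := by
  have := th1_th4_add hτ (x + lam) (x - lam - 2 * ηc)
  rw [show (x + lam + (x - lam - 2 * ηc)) / 2 = x - ηc by ring,
    show (x + lam - (x - lam - 2 * ηc)) / 2 = lam + ηc by ring] at this
  simp [chiC]
  linear_combination this

lemma chiC_sub (hτ : 0 < τ.im) (lam x : ℂ) :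
    chiC τ lam x 0 1 - chiC τ lam x 1 0 = th2 (x - ηc) τ * th1 (lam + ηc) τ := by
  have := th1_th4_sub hτ (x + lam) (x - lam - 2 * ηc)
  rw [show (x + lam + (x - lam - 2 * ηc)) / 2 = x - ηc by ring,
    show (x + lam - (x - lam - 2 * ηc)) / 2 = lam + ηc by ring] at this
  simp [chiC]
  linear_combination this

lemma Rcheckent_chiC (hτ : 0 < τ.im) (lam x : ℂ) (p q : Fin 2) :
    ∑ s : Fin 2, ∑ t : Fin 2, Rcheckent τ (-x - x) (p, q) (s, t) * chiC τ lam (-x) s t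
      = th4 (2 * ηc - 2 * x) (2 * τ) * th1 (ηc + x) τ * th2 (ηc + x) τ * chiC τ lam x p q := by
  have a1 := chiC_add hτ lam x
  have a2 := chiC_add hτ lam (-x)
  have s1 := chiC_sub hτ lam x
  have s2 := chiC_sub hτ lam (-x)
  have c1 := th1_th4_add hτ (-x - x) (2 * ηc)
  have c2 := th1_th4_sub hτ (-x - x) (2 * ηc)
  rw [show (-x - x + 2 * ηc) / 2 = -(x - ηc) by ring,
    show (-x - x - 2 * ηc) / 2 = -(ηc + x) by ring, th1_neg, th2_neg] at c1
  rw [show (-x - x + 2 * ηc) / 2 = -(x - ηc) by ring,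
    show (-x - x - 2 * ηc) / 2 = -(ηc + x) by ring, th1_neg, th2_neg] at c2
  rw [show -x - ηc = -(ηc + x) by ring, th1_neg] at a2
  rw [show -x - ηc = -(ηc + x) by ring, th2_neg] at s2
  have hw : -x - x + 2 * ηc = 2 * ηc - 2 * x := by ring
  have hS : (bv τ (-x - x) + cv τ (-x - x)) * (chiC τ lam (-x) 0 1 + chiC τ lam (-x) 1 0)
      = th4 (2 * ηc - 2 * x) (2 * τ) * th1 (ηc + x) τ * th2 (ηc + x) τ
        * (chiC τ lam x 0 1 + chiC τ lam x 1 0) := by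
    rw [a1, a2, bv, cv, hw]
    linear_combination (-th4 (2 * ηc - 2 * x) (2 * τ) * th1 (ηc + x) τ * th2 (lam + ηc) τ) * c1
  have hD : (cv τ (-x - x) - bv τ (-x - x)) * (chiC τ lam (-x) 0 1 - chiC τ lam (-x) 1 0)
      = th4 (2 * ηc - 2 * x) (2 * τ) * th1 (ηc + x) τ * th2 (ηc + x) τ
        * (chiC τ lam x 0 1 - chiC τ lam x 1 0) := by
    rw [s1, s2, bv, cv, hw]
    linear_combination (-th4 (2 * ηc - 2 * x) (2 * τ) * th2 (ηc + x) τ * th1 (lam + ηc) τ) * c2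
  simp only [Fin.sum_univ_two]
  fin_cases p <;> fin_cases q <;> simp [Rcheckent, Rent, chiC_self]
  · linear_combination (hS + hD) / 2
  · linear_combination (hS - hD) / 2

lemma th4_mul_chiC (hτ : 0 < τ.im) (lam x y : ℂ) :
    th4 (y - x) (2 * τ) * th1 (-y - x + 2 * ηc) (2 * τ)
        * (chiC τ lam y 0 1 * chiC τ lam x 1 0 - chiC τ lam x 0 1 * chiC τ lam y 1 0)
      = th1 (y - x) (2 * τ) * th4 (-y - x + 2 * ηc) (2 * τ)
        * (chiC τ lam x 0 1 * chiC τ lam y 0 1 - chiC τ lam x 1 0 * chiC τ lam y 1 0) := by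
  have a1 := chiC_add hτ lam x
  have a2 := chiC_add hτ lam y
  have s1 := chiC_sub hτ lam x
  have s2 := chiC_sub hτ lam y
  have e1 := th1_mul_th4_eq hτ (x + y - 2 * ηc) (x - y)
  have e2 := th1_mul_th4_eq hτ (x - y) (x + y - 2 * ηc)
  rw [show (x + y - 2 * ηc + (x - y)) / 2 = x - ηc by ring,
    show (x + y - 2 * ηc - (x - y)) / 2 = y - ηc by ring] at e1
  rw [show (x - y + (x + y - 2 * ηc)) / 2 = x - ηc by ring,
    show (x - y - (x + y - 2 * ηc)) / 2 = -(y - ηc) by ring, th1_neg, th2_neg] at e2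
  have hX : chiC τ lam y 0 1 * chiC τ lam x 1 0 - chiC τ lam x 0 1 * chiC τ lam y 1 0
      = th1 (lam + ηc) τ * th2 (lam + ηc) τ
        * (th1 (x - y) (2 * τ) * th4 (x + y - 2 * ηc) (2 * τ)) := by
    linear_combination (chiC τ lam y 0 1 - chiC τ lam y 1 0) / 2 * a1
      + (th1 (x - ηc) τ * th2 (lam + ηc) τ) / 2 * s2
      - (chiC τ lam x 0 1 - chiC τ lam x 1 0) / 2 * a2
      - (th1 (y - ηc) τ * th2 (lam + ηc) τ) / 2 * s1
      - th1 (lam + ηc) τ * th2 (lam + ηc) τ / 2 * e2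
  have hY : chiC τ lam x 0 1 * chiC τ lam y 0 1 - chiC τ lam x 1 0 * chiC τ lam y 1 0
      = th1 (lam + ηc) τ * th2 (lam + ηc) τ
        * (th1 (x + y - 2 * ηc) (2 * τ) * th4 (x - y) (2 * τ)) := by
    linear_combination (chiC τ lam y 0 1 - chiC τ lam y 1 0) / 2 * a1
      + (th1 (x - ηc) τ * th2 (lam + ηc) τ) / 2 * s2
      + (chiC τ lam x 0 1 - chiC τ lam x 1 0) / 2 * a2
      + (th1 (y - ηc) τ * th2 (lam + ηc) τ) / 2 * s1
      - th1 (lam + ηc) τ * th2 (lam + ηc) τ / 2 * e1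
  rw [hX, hY, show y - x = -(x - y) by ring,
    show -y - x + 2 * ηc = -(x + y - 2 * ηc) by ring]
  simp only [th1_neg, th4_neg]
  ring

lemma Rcheckent_exchange (hτ : 0 < τ.im) (lam x y : ℂ) (p q r s : Fin 2) :
    ∑ e : Fin 2, ∑ f : Fin 2, Rcheckent τ (y - x) (r, s) (e, f)
      * ∑ g : Fin 2, ∑ k : Fin 2, Rcheckent τ (-y - x) (q, e) (g, k)
        * (chiC τ lam x p g * chiC τ lam y k f)
    = ∑ e : Fin 2, ∑ f : Fin 2, Rcheckent τ (y - x) (p, q) (e, f)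
      * ∑ g : Fin 2, ∑ k : Fin 2, Rcheckent τ (-y - x) (f, r) (g, k)
        * (chiC τ lam y e g * chiC τ lam x k s) := by
  have key := th4_mul_chiC hτ lam x y
  have k1 : av τ (y - x) * dv τ (-y - x)
        * (chiC τ lam y 0 1 * chiC τ lam x 1 0 - chiC τ lam x 0 1 * chiC τ lam y 1 0)
      = dv τ (y - x) * bv τ (-y - x)
        * (chiC τ lam x 0 1 * chiC τ lam y 0 1 - chiC τ lam x 1 0 * chiC τ lam y 1 0) := by
    rw [av, bv, dv, dv]
    linear_combination (th4 (2 * ηc) (2 * τ) * th1 (y - x + 2 * ηc) (2 * τ)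
      * th1 (2 * ηc) (2 * τ) * th1 (-y - x) (2 * τ)) * key
  have k2 : cv τ (y - x) * av τ (-y - x)
        * (chiC τ lam y 0 1 * chiC τ lam x 1 0 - chiC τ lam x 0 1 * chiC τ lam y 1 0)
      = bv τ (y - x) * cv τ (-y - x)
        * (chiC τ lam x 0 1 * chiC τ lam y 0 1 - chiC τ lam x 1 0 * chiC τ lam y 1 0) := by
    rw [av, bv, cv, cv]
    linear_combination (th4 (2 * ηc) (2 * τ) * th4 (y - x + 2 * ηc) (2 * τ)
      * th1 (2 * ηc) (2 * τ) * th4 (-y - x) (2 * τ)) * key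
  simp only [Fin.sum_univ_two]
  fin_cases p <;> fin_cases q <;> fin_cases r <;> fin_cases s <;>
    simp [Rcheckent, Rent, chiC_self] <;>
    first
      | ring1
      | linear_combination k1
      | linear_combination -k1
      | linear_combination k2
      | linear_combination -k2

end Theta

end

section

/-! ### Parity and symmetry of the scalar product -/

lemma applyRc_mul (τ u : ℂ) {L : ℕ} (i j : Fin L) (H ρ : (Fin L → Fin 2) → ℂ)
    (hρ : ∀ α s t, ρ (Function.update (Function.update α i s) j t) = ρ α) (α : Fin L → Fin 2) :
    applyRc τ u i j (fun α => H α * ρ α) α = applyRc τ u i j H α * ρ α := by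
  simp only [applyRc, hρ, Finset.sum_mul, mul_assoc]

section

variable {τ : ℂ} {Ψ : PsiFam} {n : ℕ}

lemma interleave_comp_swap_pair (x : Fin n → ℂ) (m : Fin n) :
    (fun l => interleave x (Equiv.swap (siteA m) (siteB m) l))
      = interleave (Function.update x m (-x m)) := by
  rw [interleave_update]
  funext l
  by_cases h : l = siteB m
  · subst h; simp [interleave_siteA]
  · by_cases h' : l = siteA m
    · subst h'; simp [interleave_siteB, h]
    · rw [Equiv.swap_apply_of_ne_of_ne h' h]; simp [h, h']

lemma rv_mul_Zfun_neg (hτ : 0 < τ.im) (h1 : PsiP1 τ Ψ) (lam : ℂ) (x : Fin n → ℂ) (m : Fin n) :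
    rv τ (-x m - x m) * Zfun τ lam Ψ n (Function.update x m (-x m))
      = th4 (2 * ηc - 2 * x m) (2 * τ) * th1 (ηc + x m) τ * th2 (ηc + x m) τ
        * Zfun τ lam Ψ n x := by
  have key := rv_mul_sum h1 (interleave x) (i := siteA m) (j := siteB m) rfl
    (pairWeight (fun m' => chiC τ lam (Function.update x m (-x m) m')))
  rw [interleave_comp_swap_pair, interleave_siteA, interleave_siteB] at key
  rw [Zfun_eq_sum, key, Zfun_eq_sum, Finset.mul_sum]
  refine Finset.sum_congr rfl fun α _ => ?_
  have e : pairWeight (fun m' => chiC τ lam (Function.update x m (-x m) m'))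
      = fun α => chiC τ lam (-x m) (α (siteA m)) (α (siteB m))
        * restWeight {m} (fun m' => chiC τ lam (x m')) α := by
    funext α
    rw [pairWeight_single m, restWeight_single_congr
      (h' := fun m' => chiC τ lam (x m')) (β := α) (fun m' hm' => by simp [hm']) (fun _ _ _ => rfl)]
    simp
  rw [e, applyRc_mul, pairWeight_single m]
  · have := Rcheckent_chiC hτ lam (x m) (α (siteA m)) (α (siteB m))
    simp only [applyRc, Function.update_self, Function.update_of_ne (siteA_ne_siteB m m)]
    rw [this]
    ring
  · intro α s t
    exact restWeight_single_congr (fun _ _ => rfl) (fun l hl hl' => by simp [hl, hl'])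

theorem Zfun_neg (hτ : 0 < τ.im) (hent : PsiEntire Ψ) (h1 : PsiP1 τ Ψ) (h3 : PsiP3 τ Ψ)
    (lam : ℂ) (x : Fin n → ℂ) (m : Fin n) (z : ℂ) :
    th4 (2 * ηc + 2 * z) (2 * τ) * Zfun τ lam Ψ n (Function.update x m (-z))
      = th4 (2 * ηc - 2 * z) (2 * τ) * Zfun τ lam Ψ n (Function.update x m z) := by
  have dZ := differentiable_Zfun hτ hent h3 lam x m
  have d4 := differentiable_th4 (two_mul_im_pos hτ)
  have d1 := differentiable_th1 hτ
  refine entire_eq_of_mul_eq (k := fun z => th1 (ηc - 2 * z) τ) (d1.comp (by fun_prop))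
    ⟨0, by simpa using th1_eta_ne_zero hτ⟩
    (f := fun z => th4 (2 * ηc + 2 * z) (2 * τ) * Zfun τ lam Ψ n (Function.update x m (-z)))
    (g := fun z => th4 (2 * ηc - 2 * z) (2 * τ) * Zfun τ lam Ψ n (Function.update x m z))
    ((d4.comp (by fun_prop)).fun_mul (dZ.comp differentiable_neg))
    ((d4.comp (by fun_prop)).fun_mul dZ) (fun z => ?_) z
  have key := rv_mul_Zfun_neg hτ h1 lam (Function.update x m z) m
  simp only [Function.update_self, Function.update_idem] at key
  rw [rv_eq hτ, show -z - z + ηc = ηc - 2 * z by ring] at key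
  have e1 := th1_mul_th4_self hτ (2 * (ηc + z))
  have e2 := th1_two_mul hτ (ηc + z)
  have e3 := th4_two_eta_mul hτ
  have e4 : th1 (2 * (ηc + z)) τ = th1 (ηc - 2 * z) τ := by
    rw [← th1_pi_sub]; congr 1; rw [ηc]; ring
  rw [e4] at e1
  rw [show 2 * (ηc + z) = 2 * ηc + 2 * z by ring] at e1 e2
  have h0 := th4_zero_ne_zero hτ
  have h2 := th2_zero_ne_zero hτ
  refine mul_left_cancel₀ (mul_ne_zero h0 h2) ?_
  linear_combination (2 * th4 (2 * ηc + 2 * z) (2 * τ)) * key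
    - (th4 (2 * ηc + 2 * z) (2 * τ) * th1 (ηc - 2 * z) τ
      * Zfun τ lam Ψ n (Function.update x m (-z))) * e3
    - (2 * th4 (2 * ηc + 2 * z) (2 * τ) * th4 (2 * ηc - 2 * z) (2 * τ)
      * Zfun τ lam Ψ n (Function.update x m z)) * e2
    + th4 (2 * ηc - 2 * z) (2 * τ) * Zfun τ lam Ψ n (Function.update x m z)
      * th4 0 (2 * τ) * e1

section

variable {m m' : Fin n}

lemma pairWeight_two (hm : (m' : ℕ) = m + 1) (h : Fin n → Fin 2 → Fin 2 → ℂ) :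
    pairWeight h = fun α => (h m (α (siteA m)) (α (siteB m)) * h m' (α (siteA m')) (α (siteB m')))
      * restWeight {m, m'} h α := by
  funext α
  rw [pairWeight_eq {m, m'}, Finset.prod_pair]
  rintro rfl; omega

lemma rv_mul_Zfun_left (hm : (m' : ℕ) = m + 1) (h1 : PsiP1 τ Ψ) (lam : ℂ) (x : Fin n → ℂ) :
    rv τ (x m' - x m) * (rv τ (-x m - x m') * Zfun τ lam Ψ n x)
      = ∑ α, applyRc τ (x m' - x m) (siteA m') (siteB m')
          (applyRc τ (-x m - x m') (siteB m) (siteA m')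
            (pairWeight (fun i => chiC τ lam (x i)))) α
        * Ψ n (fun l => interleave x (Equiv.swap (siteB m) (siteA m')
          (Equiv.swap (siteA m') (siteB m') l))) α := by
  have hne : m ≠ m' := by rintro rfl; omega
  have b1 : siteB m' ≠ siteB m := fun e => hne (siteB_injective e).symm
  have k1 := rv_mul_sum h1 (fun l => interleave x (Equiv.swap (siteB m) (siteA m') l))
    (i := siteB m) (j := siteA m') (by simp only [siteA, siteB]; omega)
    (pairWeight (fun i => chiC τ lam (x i)))
  simp only [Equiv.swap_apply_left, Equiv.swap_apply_right, Equiv.swap_apply_self,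
    interleave_siteA, interleave_siteB] at k1
  have k2 := rv_mul_sum h1 (fun l => interleave x (Equiv.swap (siteB m) (siteA m')
      (Equiv.swap (siteA m') (siteB m') l))) (i := siteA m') (j := siteB m') rfl
    (applyRc τ (-x m - x m') (siteB m) (siteA m') (pairWeight (fun i => chiC τ lam (x i))))
  simp only [Equiv.swap_apply_left, Equiv.swap_apply_right, Equiv.swap_apply_self,
    Equiv.swap_apply_of_ne_of_ne b1 (siteA_ne_siteB m' m').symm, interleave_siteB] at k2
  rw [show -x m - -x m' = x m' - x m by ring] at k2
  rw [← k2, ← k1]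
  rfl

lemma rv_mul_Zfun_right (hm : (m' : ℕ) = m + 1) (h1 : PsiP1 τ Ψ) (lam : ℂ) (x : Fin n → ℂ) :
    rv τ (x m - x m') * (rv τ (-x m - x m') * Zfun τ lam Ψ n x)
      = ∑ α, applyRc τ (x m - x m') (siteA m) (siteB m)
          (applyRc τ (-x m - x m') (siteB m) (siteA m')
            (pairWeight (fun i => chiC τ lam (x i)))) α
        * Ψ n (fun l => interleave x (Equiv.swap (siteB m) (siteA m')
          (Equiv.swap (siteA m) (siteB m) l))) α := by
  have hne : m ≠ m' := by rintro rfl; omega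
  have b1 : siteA m ≠ siteA m' := fun e => hne (siteA_injective e)
  have k1 := rv_mul_sum h1 (fun l => interleave x (Equiv.swap (siteB m) (siteA m') l))
    (i := siteB m) (j := siteA m') (by simp only [siteA, siteB]; omega)
    (pairWeight (fun i => chiC τ lam (x i)))
  simp only [Equiv.swap_apply_left, Equiv.swap_apply_right, Equiv.swap_apply_self,
    interleave_siteA, interleave_siteB] at k1
  have k2 := rv_mul_sum h1 (fun l => interleave x (Equiv.swap (siteB m) (siteA m')
      (Equiv.swap (siteA m) (siteB m) l))) (i := siteA m) (j := siteB m) rfl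
    (applyRc τ (-x m - x m') (siteB m) (siteA m') (pairWeight (fun i => chiC τ lam (x i))))
  simp only [Equiv.swap_apply_left, Equiv.swap_apply_right, Equiv.swap_apply_self,
    Equiv.swap_apply_of_ne_of_ne (siteA_ne_siteB m m) b1, interleave_siteA] at k2
  rw [← k2, ← k1]
  rfl

lemma interleave_nested (hm : (m' : ℕ) = m + 1) (x : Fin n → ℂ) (l : Fin (2 * n + 1)) :
    interleave x (Equiv.swap (siteB m) (siteA m') (Equiv.swap (siteA m') (siteB m') l))
      = interleave (x ∘ Equiv.swap m m') (Equiv.swap (siteB m) (siteA m')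
          (Equiv.swap (siteA m) (siteB m) l)) := by
  have hne : m ≠ m' := by rintro rfl; omega
  have bb : siteB m ≠ siteB m' := fun e => hne (siteB_injective e)
  have aa : siteA m ≠ siteA m' := fun e => hne (siteA_injective e)
  have ab := fun i j : Fin n => siteA_ne_siteB i j
  have ba := fun i j : Fin n => (siteA_ne_siteB i j).symm
  rcases site_cases l with ⟨i, rfl⟩ | ⟨i, rfl⟩ | rfl
  · by_cases h : i = m
    · subst h
      simp [Equiv.swap_apply_of_ne_of_ne, aa, ab, interleave_siteA]
    · by_cases h' : i = m'
      · subst h'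
        simp [Equiv.swap_apply_of_ne_of_ne, aa.symm, ab, ba, bb.symm, interleave_siteB]
      · have a1 : siteA i ≠ siteA m := fun e => h (siteA_injective e)
        have a2 : siteA i ≠ siteA m' := fun e => h' (siteA_injective e)
        simp [Equiv.swap_apply_of_ne_of_ne, a1, a2, ab, h, h', interleave_siteA]
  · by_cases h : i = m
    · subst h
      simp [Equiv.swap_apply_of_ne_of_ne, aa, bb, ab, ba, interleave_siteA]
    · by_cases h' : i = m'
      · subst h'
        simp [Equiv.swap_apply_of_ne_of_ne, ba, bb.symm, interleave_siteB]
      · have a1 : siteB i ≠ siteB m := fun e => h (siteB_injective e)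
        have a2 : siteB i ≠ siteB m' := fun e => h' (siteB_injective e)
        simp [Equiv.swap_apply_of_ne_of_ne, a1, a2, ba, h, h', interleave_siteB]
  · simp [Equiv.swap_apply_of_ne_of_ne, siteL_ne_siteA, siteL_ne_siteB, interleave_siteL]

lemma restWeight_pair_congr (hm : (m' : ℕ) = m + 1) {h h' : Fin n → Fin 2 → Fin 2 → ℂ}
    {α β : Fin (2 * n + 1) → Fin 2} (hh : ∀ i, i ≠ m → i ≠ m' → h i = h' i)
    (hab : ∀ l, l ≠ siteA m → l ≠ siteB m → l ≠ siteA m' → l ≠ siteB m' → α l = β l) :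
    restWeight {m, m'} h α = restWeight {m, m'} h' β := by
  refine restWeight_congr (fun i hi => hh i (by rintro rfl; simp at hi) (by rintro rfl; simp at hi))
    (fun i hi => ?_) (fun i hi => ?_) ?_
  · exact hab _ (fun e => hi (by simp [siteA_injective e])) (siteA_ne_siteB _ _)
      (fun e => hi (by simp [siteA_injective e])) (siteA_ne_siteB _ _)
  · exact hab _ (siteA_ne_siteB _ _).symm (fun e => hi (by simp [siteB_injective e]))
      (siteA_ne_siteB _ _).symm (fun e => hi (by simp [siteB_injective e]))
  · exact hab _ (siteL_ne_siteA _) (siteL_ne_siteB _) (siteL_ne_siteA _) (siteL_ne_siteB _)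

lemma applyRc_exchange (hm : (m' : ℕ) = m + 1)
    (hτ : 0 < τ.im) (lam : ℂ) (x : Fin n → ℂ) (α : Fin (2 * n + 1) → Fin 2) :
    applyRc τ (x m' - x m) (siteA m') (siteB m')
        (applyRc τ (-x m' - x m) (siteB m) (siteA m') (pairWeight (fun i => chiC τ lam (x i)))) α
      = applyRc τ (x m' - x m) (siteA m) (siteB m)
        (applyRc τ (-x m' - x m) (siteB m) (siteA m')
          (pairWeight (fun i => chiC τ lam ((x ∘ Equiv.swap m m') i)))) α := by
  have hne : m ≠ m' := by rintro rfl; omega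
  have bb : siteB m ≠ siteB m' := fun e => hne (siteB_injective e)
  have aa : siteA m ≠ siteA m' := fun e => hne (siteA_injective e)
  have ab := fun i j : Fin n => siteA_ne_siteB i j
  have ba := fun i j : Fin n => (siteA_ne_siteB i j).symm
  have hrest : restWeight {m, m'} (fun i => chiC τ lam ((x ∘ Equiv.swap m m') i))
      = restWeight {m, m'} (fun i => chiC τ lam (x i)) := by
    funext β
    refine restWeight_pair_congr hm (fun i hi hi' => ?_) (fun _ _ _ _ _ => rfl)
    simp [Equiv.swap_apply_of_ne_of_ne hi hi']
  have e1 : ∀ (w : ℂ) (h : Fin n → Fin 2 → Fin 2 → ℂ),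
      applyRc τ w (siteB m) (siteA m') (pairWeight h)
      = fun α => (applyRc τ w (siteB m) (siteA m') (fun α => h m (α (siteA m)) (α (siteB m))
          * h m' (α (siteA m')) (α (siteB m'))) α) * restWeight {m, m'} h α := by
    intro w h
    funext β
    rw [pairWeight_two hm h, applyRc_mul]
    intro α s t
    exact restWeight_pair_congr hm (fun _ _ _ => rfl) (fun l h1 h2 h3 h4 => by simp [h2, h3])
  rw [e1, e1, applyRc_mul, applyRc_mul, hrest]
  · congr 1
    have := Rcheckent_exchange hτ lam (x m) (x m') (α (siteA m)) (α (siteB m)) (α (siteA m'))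
      (α (siteB m'))
    simp only [applyRc, Function.comp_apply, Equiv.swap_apply_left, Equiv.swap_apply_right,
      Function.update_self, ne_eq, aa, bb, ab, ba, aa.symm, bb.symm, not_false_eq_true,
      Function.update_of_ne]
    exact this
  · intro α s t
    exact restWeight_pair_congr hm (fun _ _ _ => rfl) (fun l h1 h2 h3 h4 => by simp [h1, h2])
  · intro α s t
    exact restWeight_pair_congr hm (fun _ _ _ => rfl) (fun l h1 h2 h3 h4 => by simp [h3, h4])

lemma rv_mul_Zfun_swap (hm : (m' : ℕ) = m + 1)
    (hτ : 0 < τ.im) (h1 : PsiP1 τ Ψ) (lam : ℂ) (x : Fin n → ℂ) :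
    rv τ (x m' - x m) * rv τ (-x m' - x m) * Zfun τ lam Ψ n x
      = rv τ (x m' - x m) * rv τ (-x m' - x m) * Zfun τ lam Ψ n (x ∘ Equiv.swap m m') := by
  have k1 := rv_mul_Zfun_left hm h1 lam x
  have k2 := rv_mul_Zfun_right hm h1 lam (x ∘ Equiv.swap m m')
  simp only [← interleave_nested hm x] at k2
  simp only [Function.comp_apply, Equiv.swap_apply_left, Equiv.swap_apply_right] at k2
  rw [show -x m - x m' = -x m' - x m by ring] at k1
  rw [mul_assoc, mul_assoc, k1, k2]
  refine Finset.sum_congr rfl fun α _ => ?_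
  rw [applyRc_exchange hm hτ lam x α]
  rfl

theorem Zfun_swap_adjacent (hm : (m' : ℕ) = m + 1)
    (hτ : 0 < τ.im) (hent : PsiEntire Ψ) (h1 : PsiP1 τ Ψ)
    (h3 : PsiP3 τ Ψ) (lam : ℂ) (x : Fin n → ℂ) :
    Zfun τ lam Ψ n (x ∘ Equiv.swap m m') = Zfun τ lam Ψ n x := by
  have hne : m ≠ m' := by rintro rfl; omega
  have d1 := differentiable_th1 hτ
  have hc : ∀ z, Function.update x m z ∘ Equiv.swap m m'
      = Function.update (x ∘ Equiv.swap m m') m' z := by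
    intro z
    funext i
    by_cases h : i = m'
    · subst h; simp
    · have : Equiv.swap m m' i ≠ m := by
        intro e; apply h; rw [Equiv.swap_apply_eq_iff] at e; simpa using e
      simp [h, this]
  have c0 : th4 (2 * ηc) (2 * τ) * th2 ηc τ ≠ 0 :=
    mul_ne_zero (th4_two_eta_ne_zero hτ) (th2_eta_ne_zero hτ)
  have drv : Differentiable ℂ (rv τ) := by
    rw [show rv τ = fun u => th4 (2 * ηc) (2 * τ) * th2 ηc τ * th1 (u + ηc) τ from
      funext (rv_eq hτ)]
    exact (d1.comp (by fun_prop : Differentiable ℂ fun u : ℂ => u + ηc)).const_mul _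
  have e0 : rv τ 0 ≠ 0 := by
    rw [rv_eq hτ, zero_add]; exact mul_ne_zero c0 (th1_eta_ne_zero hτ)
  have dk1 : Differentiable ℂ (fun z => rv τ (x m' - z)) := drv.comp (by fun_prop)
  have dk2 : Differentiable ℂ (fun z => rv τ (-x m' - z)) := drv.comp (by fun_prop)
  have := entire_eq_of_mul_eq (k := fun z => rv τ (x m' - z) * rv τ (-x m' - z))
    (dk1.fun_mul dk2)
    (exists_mul_ne_zero dk1 dk2 ⟨x m', by simpa using e0⟩ ⟨-x m', by simpa using e0⟩)
    (differentiable_Zfun hτ hent h3 lam x m)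
    (differentiable_Zfun hτ hent h3 lam (x ∘ Equiv.swap m m') m')
    (fun z => by
      have := rv_mul_Zfun_swap hm hτ h1 lam (Function.update x m z)
      rw [hc] at this
      simpa [hne.symm] using this) (x m)
  rw [← hc] at this
  simpa using this.symm

end

theorem Zfun_comp_perm (hτ : 0 < τ.im) (hent : PsiEntire Ψ) (h1 : PsiP1 τ Ψ)
    (h3 : PsiP3 τ Ψ) (lam : ℂ) (x : Fin n → ℂ) (σ : Equiv.Perm (Fin n)) :
    Zfun τ lam Ψ n (x ∘ σ) = Zfun τ lam Ψ n x := by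
  cases n with
  | zero => rw [Subsingleton.elim (x ∘ σ) x]
  | succ n =>
    have hσ : σ ∈ Submonoid.closure
        (Set.range fun i : Fin n => Equiv.swap i.castSucc i.succ) := by
      rw [Equiv.Perm.mclosure_swap_castSucc_succ]; trivial
    induction hσ using Submonoid.closure_induction generalizing x with
    | mem σ hσ =>
      obtain ⟨i, rfl⟩ := hσ
      exact Zfun_swap_adjacent (by simp) hτ hent h1 h3 lam x
    | one => rfl
    | mul σ ρ _ _ hσ hρ =>
      rw [Equiv.Perm.coe_mul, ← Function.comp_assoc, hρ, hσ]

end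

end

section

/-! ### Trivial zeros of the scalar product -/

section

variable {τ : ℂ} {Ψ : PsiFam} {n : ℕ}

lemma Psi_eq_zero_of_eq (h5 : PsiP5 τ Ψ) (u : Fin (2 * n + 1) → ℂ) (m : Fin n)
    (hu : u (siteB m) = u (siteA m) + 2 * ηc) (α : Fin (2 * n + 1) → Fin 2)
    (hα : α (siteA m) = α (siteB m)) : Ψ n u α = 0 := by
  cases n with
  | zero => exact m.elim0
  | succ n =>
    have hm := m.2
    rw [h5 n u (2 * m) (by omega) hu]
    have h : singletC (α (siteA m)) (α (siteB m)) = 0 := by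
      rw [hα]; generalize α (siteB m) = s; fin_cases s <;> simp [singletC]
    rw [siteA, siteB] at h
    simp [h]

lemma Zfun_eq_zero_of_Psi (lam : ℂ) (x : Fin n → ℂ) (m : Fin n)
    (h : ∀ α, α (siteA m) ≠ α (siteB m) → Ψ n (interleave x) α = 0) : Zfun τ lam Ψ n x = 0 := by
  rw [Zfun_eq_sum]
  refine Finset.sum_eq_zero fun α _ => ?_
  by_cases hα : α (siteA m) = α (siteB m)
  · rw [pairWeight_single m, hα, chiC_self]; simp
  · rw [h α hα, mul_zero]

lemma flipS_ne {s t : Fin 2} (h : s ≠ t) : s = flipS t := by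
  fin_cases s <;> fin_cases t <;> simp_all [flipS]

lemma Psi_eq_zero_of_sub_pi_tau (h2 : PsiP2 τ Ψ) (h5 : PsiP5 τ Ψ) (u : Fin (2 * n + 1) → ℂ)
    (m : Fin n) (hu : u (siteB m) + Real.pi * τ = u (siteA m) + 2 * ηc)
    (α : Fin (2 * n + 1) → Fin 2) (hα : α (siteA m) ≠ α (siteB m)) : Ψ n u α = 0 := by
  have key := Psi_flip_sub h2 (Function.update u (siteB m) (u (siteB m) + Real.pi * τ)) (siteB m) α
  simp only [Function.update_self, add_sub_cancel_right, Function.update_idem,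
    Function.update_eq_self] at key
  rw [key, Psi_eq_zero_of_eq h5 _ m, mul_zero]
  · simpa [siteA_ne_siteB] using hu
  · simpa [siteA_ne_siteB] using flipS_ne hα

/-- The value of the scalar product vanishes at `x_m = -η + πτ/2`. -/
lemma Zfun_zero_half_tau (h2 : PsiP2 τ Ψ) (h5 : PsiP5 τ Ψ) (lam : ℂ) (x : Fin n → ℂ)
    (m : Fin n) (hx : x m = -ηc + Real.pi * τ / 2) : Zfun τ lam Ψ n x = 0 := by
  refine Zfun_eq_zero_of_Psi lam x m fun α hα => ?_
  refine Psi_eq_zero_of_sub_pi_tau h2 h5 _ m ?_ α hα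
  rw [interleave_siteA, interleave_siteB, hx]
  ring

/-- The value of the scalar product vanishes at `x_m = -η + πτ/2 + π/2`. -/
lemma Zfun_zero_half_tau_add (h2 : PsiP2 τ Ψ) (h3 : PsiP3 τ Ψ) (h5 : PsiP5 τ Ψ) (lam : ℂ)
    (x : Fin n → ℂ) (m : Fin n) (hx : x m = -ηc + Real.pi * τ / 2 + Real.pi / 2) :
    Zfun τ lam Ψ n x = 0 := by
  refine Zfun_eq_zero_of_Psi lam x m fun α hα => ?_
  have key := Psi_sub_pi h3 (Function.update (interleave x) (siteB m)
    (interleave x (siteB m) + Real.pi)) (siteB m) α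
  simp only [Function.update_self, add_sub_cancel_right, Function.update_idem,
    Function.update_eq_self] at key
  rw [key, Psi_eq_zero_of_sub_pi_tau h2 h5 _ m ?_ α hα, mul_zero]
  simp only [Function.update_self, Function.update_of_ne (siteA_ne_siteB m m)]
  rw [interleave_siteA, interleave_siteB, hx]
  ring

lemma th1_three_eta (τ : ℂ) : th1 (3 * ηc) τ = 0 := by
  rw [← th1_pi_sub, show (Real.pi : ℂ) - 3 * ηc = 0 by rw [ηc]; ring, th1_zero]

lemma Zfun_zero_neg_eta (h5 : PsiP5 τ Ψ) (lam : ℂ) (x : Fin n → ℂ) (m : Fin n)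
    (hx : x m = -ηc) : Zfun τ lam Ψ n x = 0 := by
  refine Zfun_eq_zero_of_Psi lam x m fun α _ => ?_
  cases n with
  | zero => exact m.elim0
  | succ n =>
    have hm := m.2
    rw [h5 n (interleave x) (2 * m) (by omega)
      (by have a := interleave_siteA x m; have b := interleave_siteB x m
          rw [siteA] at a; rw [siteB] at b; rw [a, b, hx]; ring)]
    dsimp only
    rw [Finset.prod_eq_zero (i := siteL), zero_mul, zero_mul]
    · rw [Finset.mem_erase, Finset.mem_erase]
      exact ⟨siteL_ne_siteB m, siteL_ne_siteA m, Finset.mem_univ _⟩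
    · rw [interleave_siteL, ← siteA, interleave_siteA, hx,
        show -ηc - 0 - 2 * ηc = -(3 * ηc) by ring, th1_neg, th1_three_eta, neg_zero]

lemma Zfun_zero_eta (hτ : 0 < τ.im) (hent : PsiEntire Ψ) (h1 : PsiP1 τ Ψ) (h3 : PsiP3 τ Ψ)
    (h5 : PsiP5 τ Ψ) (lam : ℂ) (x : Fin n → ℂ) (m : Fin n) (hx : x m = ηc) :
    Zfun τ lam Ψ n x = 0 := by
  have key := Zfun_neg hτ hent h1 h3 lam x m (-ηc)
  rw [Zfun_zero_neg_eta h5 lam (Function.update x m (-ηc)) m (by simp), neg_neg, ← hx,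
    Function.update_eq_self, mul_zero, hx, show 2 * ηc + 2 * -ηc = 0 by ring] at key
  exact (mul_eq_zero.mp key).resolve_left (th4_zero_ne_zero hτ)

end

end

section

/-! ### Reduction of the scalar product -/

section ConsTwo

variable {n : ℕ} {γ : Type*}

/-- Prepend two entries to a tuple. -/
def consTwo (s t : γ) (β : Fin (2 * n + 1) → γ) : Fin (2 * (n + 1) + 1) → γ := fun j =>
  if _ : (j : ℕ) = 0 then s else if _ : (j : ℕ) = 1 then t
    else β ⟨(j : ℕ) - 2, by have := j.2; omega⟩

lemma consTwo_zero (s t : γ) (β : Fin (2 * n + 1) → γ) (h : 0 < 2 * (n + 1) + 1) :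
    consTwo s t β ⟨0, h⟩ = s := by simp [consTwo]

lemma consTwo_one (s t : γ) (β : Fin (2 * n + 1) → γ) (h : 1 < 2 * (n + 1) + 1) :
    consTwo s t β ⟨1, h⟩ = t := by simp [consTwo]

lemma consTwo_add_two (s t : γ) (β : Fin (2 * n + 1) → γ) (j : Fin (2 * n + 1))
    (h : (j : ℕ) + 2 < 2 * (n + 1) + 1) : consTwo s t β ⟨(j : ℕ) + 2, h⟩ = β j := by
  simp [consTwo]

lemma exists_consTwo_index (l : Fin (2 * (n + 1) + 1)) :
    l = ⟨0, by omega⟩ ∨ l = ⟨1, by omega⟩ ∨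
      ∃ j : Fin (2 * n + 1), l = ⟨(j : ℕ) + 2, by have := j.2; omega⟩ := by
  obtain ⟨l, hl⟩ := l
  match l, hl with
  | 0, _ => exact Or.inl rfl
  | 1, _ => exact Or.inr (Or.inl rfl)
  | l + 2, hl => exact Or.inr (Or.inr ⟨⟨l, by omega⟩, rfl⟩)

lemma consTwo_siteA_zero (s t : γ) (β : Fin (2 * n + 1) → γ) :
    consTwo s t β (siteA 0) = s := consTwo_zero _ _ _ _

lemma consTwo_siteB_zero (s t : γ) (β : Fin (2 * n + 1) → γ) :
    consTwo s t β (siteB 0) = t := consTwo_one _ _ _ _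

lemma consTwo_siteA_succ (s t : γ) (β : Fin (2 * n + 1) → γ) (m : Fin n) :
    consTwo s t β (siteA m.succ) = β (siteA m) := consTwo_add_two _ _ _ (siteA m) _

lemma consTwo_siteB_succ (s t : γ) (β : Fin (2 * n + 1) → γ) (m : Fin n) :
    consTwo s t β (siteB m.succ) = β (siteB m) := consTwo_add_two _ _ _ (siteB m) _

lemma consTwo_siteL (s t : γ) (β : Fin (2 * n + 1) → γ) :
    consTwo s t β siteL = β siteL := consTwo_add_two _ _ _ siteL _

lemma delTwo_zero_consTwo (s t : γ) (β : Fin (2 * n + 1) → γ) :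
    delTwo 0 (consTwo s t β) = β := by
  funext j
  simp [delTwo, consTwo_add_two]

lemma delTwo_one_consTwo (s t s' t' : γ) (β : Fin (2 * n + 1) → γ) :
    delTwo 1 (consTwo s t (consTwo s' t' β)) = consTwo s t' β := by
  funext j
  rcases exists_consTwo_index j with rfl | rfl | ⟨j, rfl⟩
  · simp [delTwo, consTwo]
  · simp [delTwo, consTwo]
  · simp [delTwo, consTwo]

/-- Tuples of length `2(n+1)+1` as two entries followed by a tuple of length `2n+1`. -/
def consTwoEquiv (n : ℕ) (γ : Type*) :
    γ × γ × (Fin (2 * n + 1) → γ) ≃ (Fin (2 * (n + 1) + 1) → γ) where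
  toFun p := consTwo p.1 p.2.1 p.2.2
  invFun α := (α ⟨0, by omega⟩, α ⟨1, by omega⟩, delTwo 0 α)
  left_inv p := by
    dsimp only
    rw [delTwo_zero_consTwo, consTwo_zero, consTwo_one]
  right_inv α := by
    funext j
    dsimp only
    rcases exists_consTwo_index j with rfl | rfl | ⟨j, rfl⟩
    · rw [consTwo_zero]
    · rw [consTwo_one]
    · rw [consTwo_add_two]; simp [delTwo]

lemma sum_consTwo (F : (Fin (2 * (n + 1) + 1) → Fin 2) → ℂ) :
    ∑ α, F α = ∑ s, ∑ t, ∑ β, F (consTwo s t β) := by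
  rw [← (consTwoEquiv n (Fin 2)).sum_comp, Fintype.sum_prod_type]
  exact Finset.sum_congr rfl fun s _ => Fintype.sum_prod_type _

lemma interleave_cons (a : ℂ) (w : Fin n → ℂ) :
    interleave (Fin.cons a w : Fin (n + 1) → ℂ) = consTwo a (-a) (interleave w) := by
  funext l
  rcases site_cases l with ⟨m, rfl⟩ | ⟨m, rfl⟩ | rfl
  · rw [interleave_siteA]
    refine Fin.cases ?_ (fun m => ?_) m
    · rw [consTwo_siteA_zero, Fin.cons_zero]
    · rw [consTwo_siteA_succ, Fin.cons_succ, interleave_siteA]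
  · rw [interleave_siteB]
    refine Fin.cases ?_ (fun m => ?_) m
    · rw [consTwo_siteB_zero, Fin.cons_zero]
    · rw [consTwo_siteB_succ, Fin.cons_succ, interleave_siteB]
  · rw [consTwo_siteL, interleave_siteL, interleave_siteL]

lemma pairWeight_consTwo (h : Fin (n + 1) → Fin 2 → Fin 2 → ℂ) (s t : Fin 2)
    (β : Fin (2 * n + 1) → Fin 2) :
    pairWeight h (consTwo s t β) = h 0 s t * pairWeight (fun m => h m.succ) β := by
  simp only [pairWeight, Fin.prod_univ_succ, consTwo_siteA_zero, consTwo_siteB_zero,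
    consTwo_siteA_succ, consTwo_siteB_succ, consTwo_siteL, mul_assoc]

lemma prod_consTwo (F : Fin (2 * (n + 1) + 1) → ℂ) :
    ∏ l, F l = F ⟨0, by omega⟩ * F ⟨1, by omega⟩
      * ∏ j : Fin (2 * n + 1), F ⟨(j : ℕ) + 2, by have := j.2; omega⟩ := by
  have : ∀ (L : ℕ) (F : Fin (L + 2) → ℂ), ∏ l, F l = F ⟨0, by omega⟩ * F ⟨1, by omega⟩
      * ∏ j : Fin L, F ⟨(j : ℕ) + 2, by have := j.2; omega⟩ := by
    intro L F
    rw [Fin.prod_univ_succ, Fin.prod_univ_succ, mul_assoc]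
    rfl
  exact this (2 * n + 1) F

end ConsTwo

section

variable {τ : ℂ} {Ψ : PsiFam} {n : ℕ}

lemma prod_erase_erase {ι : Type*} [Fintype ι] [DecidableEq ι] (a b : ι) (F : ι → ℂ) :
    ∏ j ∈ (Finset.univ.erase a).erase b, F j = ∏ j, if j = a ∨ j = b then 1 else F j := by
  rw [← Finset.prod_subset (Finset.subset_univ ((Finset.univ.erase a).erase b))]
  · refine Finset.prod_congr rfl fun j hj => ?_
    simp only [Finset.mem_erase, Finset.mem_univ, and_true] at hj
    rw [if_neg (by tauto)]
  · intro j _ hj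
    simp only [Finset.mem_erase, Finset.mem_univ, and_true] at hj
    rw [if_pos (by tauto)]

lemma th1_sub_three_eta (τ z : ℂ) : th1 (z - 3 * ηc) τ = -th1 z τ := by
  rw [← th1_sub_pi]; congr 1; rw [ηc]; ring

lemma Psi_consTwo_reduce (h5 : PsiP5 τ Ψ) (a : ℂ) (u : Fin (2 * n + 1) → ℂ) (s t : Fin 2)
    (β : Fin (2 * n + 1) → Fin 2) :
    Ψ (n + 1) (consTwo (a - 2 * ηc) a u) (consTwo s t β)
      = -(∏ l, th1 (a - ηc - u l) τ) * singletC s t * Ψ n u β := by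
  have key := h5 n (consTwo (a - 2 * ηc) a u) 0 (by omega)
    (by rw [consTwo_one, consTwo_zero]; ring)
  rw [key]
  simp only [consTwo_zero, zero_add, consTwo_one, delTwo_zero_consTwo]
  congr 2
  have : ∀ z, th1 (a - 2 * ηc - z - 2 * ηc) τ = -th1 (a - ηc - z) τ := by
    intro z; rw [← th1_sub_three_eta]; congr 1; ring
  simp only [this]
  rw [prod_erase_erase, prod_consTwo]
  simp only [Fin.mk.injEq, Nat.add_eq_zero_iff, OfNat.ofNat_ne_zero, and_false, false_or,
    true_or, or_true, if_true, one_mul, consTwo_add_two,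
    show ∀ j, ¬ j + 2 = 1 by omega, if_false]
  rw [Finset.prod_neg, Finset.card_univ, Fintype.card_fin, pow_succ, pow_mul]
  simp

/-- Contraction of two neighbouring sites with the singlet. -/
lemma Psi_consTwo_singlet (hτ : 0 < τ.im) (h1 : PsiP1 τ Ψ) (h5 : PsiP5 τ Ψ) (a : ℂ)
    (u : Fin (2 * n + 1) → ℂ) (β : Fin (2 * n + 1) → Fin 2) :
    Ψ (n + 1) (consTwo a (a - 2 * ηc) u) (consTwo 0 1 β)
      - Ψ (n + 1) (consTwo a (a - 2 * ηc) u) (consTwo 1 0 β)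
      = (∏ l, th1 (a - ηc - u l) τ) * Ψ n u β := by
  have key := congrFun (h1 (n + 1) (consTwo a (a - 2 * ηc) u) ⟨0, by omega⟩ ⟨1, by omega⟩ rfl)
    (consTwo 0 1 β)
  have e : (fun l => consTwo a (a - 2 * ηc) u (Equiv.swap ⟨0, by omega⟩ ⟨1, by omega⟩ l))
      = consTwo (a - 2 * ηc) a u := by
    funext l
    rcases exists_consTwo_index l with rfl | rfl | ⟨j, rfl⟩
    · rw [Equiv.swap_apply_left, consTwo_one, consTwo_zero]
    · rw [Equiv.swap_apply_right, consTwo_one, consTwo_zero]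
    · rw [Equiv.swap_apply_of_ne_of_ne (by simp)
        (by simp only [ne_eq, Fin.mk.injEq]; omega), consTwo_add_two,
        consTwo_add_two]
  have eu : ∀ s t, Function.update (Function.update (consTwo (0 : Fin 2) 1 β) ⟨0, by omega⟩ s)
      ⟨1, by omega⟩ t = consTwo s t β := by
    intro s t
    funext l
    rcases exists_consTwo_index l with rfl | rfl | ⟨j, rfl⟩
    · rw [Function.update_of_ne (by simp), Function.update_self, consTwo_zero]
    · rw [Function.update_self, consTwo_one]
    · rw [Function.update_of_ne (by simp only [ne_eq, Fin.mk.injEq]; omega),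
        Function.update_of_ne (by simp),
        consTwo_add_two, consTwo_add_two]
  rw [e, Psi_consTwo_reduce h5] at key
  simp only [applyRc, eu, consTwo_zero, consTwo_one, Fin.sum_univ_two] at key
  rw [show a - 2 * ηc - a = -(2 * ηc) by ring] at key
  have b : bv τ (-(2 * ηc)) = -(th4 (2 * ηc) (2 * τ) * th4 0 (2 * τ) * th1 (2 * ηc) (2 * τ)) := by
    rw [bv, neg_add_cancel, th1_neg]; ring
  have c : cv τ (-(2 * ηc)) = th4 (2 * ηc) (2 * τ) * th4 0 (2 * τ) * th1 (2 * ηc) (2 * τ) := by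
    rw [cv, neg_add_cancel, th4_neg]; ring
  have a0 : av τ (-(2 * ηc)) = 0 := by rw [av, neg_add_cancel, th1_zero]; ring
  simp only [Rcheckent, Rent, rv, a0, b, c] at key
  have nz : th4 (2 * ηc) (2 * τ) * th4 0 (2 * τ) * th1 (2 * ηc) (2 * τ) ≠ 0 := by
    refine mul_ne_zero (mul_ne_zero (th4_two_eta_ne_zero hτ) (th4_zero_ne_zero hτ)) ?_
    rw [th1_two_eta]
    exact th1_eta_ne_zero (two_mul_im_pos hτ)
  refine mul_left_cancel₀ nz ?_
  simp [singletC] at key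
  linear_combination key

/-- The coefficient of the recursion relation of the scalar product. -/
def recCoef (τ lam a : ℂ) : ℂ :=
  (th2 0 τ / 2) ^ 2 * th1 (a + lam) τ * th1 (a - lam - 2 * ηc) τ * th1 (2 * a + 2 * ηc) τ
    * th1 (2 * a) τ * th1 (a - ηc) τ ^ 2

lemma chiC_contract (hτ : 0 < τ.im) (lam a : ℂ) :
    chiC τ lam a 0 1 * chiC τ lam (2 * ηc - a) 0 1
      = -((th2 0 τ / 2) ^ 2 * th1 (a + lam) τ * th1 (a - lam - 2 * ηc) τ) ∧
    chiC τ lam a 1 0 * chiC τ lam (2 * ηc - a) 1 0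
      = -((th2 0 τ / 2) ^ 2 * th1 (a + lam) τ * th1 (a - lam - 2 * ηc) τ) := by
  have e1 := th1_mul_th4_self hτ (a + lam)
  have e2 := th1_mul_th4_self hτ (a - lam - 2 * ηc)
  have h1 : 2 * ηc - a + lam = -(a - lam - 2 * ηc) := by ring
  have h2 : 2 * ηc - a - lam - 2 * ηc = -(a + lam) := by ring
  simp only [chiC, h1, h2, th1_neg, th4_neg]
  constructor
  · simp only [and_self, if_true]
    linear_combination (-1 / 2 * th1 (a - lam - 2 * ηc) (2 * τ) * th4 (a - lam - 2 * ηc) (2 * τ)) * e1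
      - (1 / 4 * th1 (a + lam) τ * th2 0 τ) * e2
  · simp only [one_ne_zero, zero_ne_one, and_self, if_true, if_false]
    linear_combination (-1 / 2 * th1 (a - lam - 2 * ηc) (2 * τ) * th4 (a - lam - 2 * ηc) (2 * τ)) * e1
      - (1 / 4 * th1 (a + lam) τ * th2 0 τ) * e2

lemma Psi_consTwo_consTwo (h5 : PsiP5 τ Ψ) (a : ℂ) (u : Fin (2 * n + 1) → ℂ)
    (s t s' t' : Fin 2) (β : Fin (2 * n + 1) → Fin 2) :
    Ψ (n + 2) (consTwo a (-a) (consTwo (2 * ηc - a) (a - 2 * ηc) u)) (consTwo s t (consTwo s' t' β))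
      = (th1 (2 * a + 2 * ηc) τ * th1 (2 * a) τ * ∏ l, th1 (a - ηc + u l) τ) * singletC t s'
        * Ψ (n + 1) (consTwo a (a - 2 * ηc) u) (consTwo s t' β) := by
  have key := h5 (n + 1) (consTwo a (-a) (consTwo (2 * ηc - a) (a - 2 * ηc) u)) 1 (by omega)
    (by rw [consTwo_one]; simp [consTwo]; ring)
  rw [key]
  have v2 : ∀ {γ : Type} (s t s' t' : γ) (β : Fin (2 * n + 1) → γ) (h),
      consTwo s t (consTwo s' t' β) ⟨1 + 1, h⟩ = s' := by intros; simp [consTwo]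
  simp only [consTwo_one, v2, delTwo_one_consTwo]
  congr 2
  have hz : ∀ z, th1 (-a - z - 2 * ηc) τ = th1 (a - ηc + z) τ := by
    intro z
    rw [show -a - z - 2 * ηc = -(a - ηc + z) - 3 * ηc by ring, th1_sub_three_eta, th1_neg, neg_neg]
  simp only [hz]
  rw [prod_erase_erase, prod_consTwo, prod_consTwo]
  have e0 : th1 (a - ηc + a) τ = -th1 (2 * a + 2 * ηc) τ := by
    rw [← th1_sub_three_eta]; congr 1; ring
  have e3 : th1 (a - ηc + (a - 2 * ηc)) τ = -th1 (2 * a) τ := by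
    rw [← th1_sub_three_eta]; congr 1; ring
  have v3 : ∀ h, consTwo a (-a) (consTwo (2 * ηc - a) (a - 2 * ηc) u) ⟨1 + 2, h⟩ = a - 2 * ηc := by
    intros; simp [consTwo]
  have v4 : ∀ (j : Fin (2 * n + 1)) (h),
      consTwo a (-a) (consTwo (2 * ηc - a) (a - 2 * ηc) u) ⟨(j : ℕ) + 2 + 2, h⟩ = u j := by
    intros; simp [consTwo]
  simp only [Fin.mk.injEq, consTwo_zero, v3, v4, e0, e3]
  simp [mul_assoc]

/-- The recursion relation of the scalar product, for the first two pairs. -/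
theorem Zfun_cons_cons (hτ : 0 < τ.im) (h1 : PsiP1 τ Ψ) (h5 : PsiP5 τ Ψ) (lam a : ℂ)
    (w : Fin n → ℂ) :
    Zfun τ lam Ψ (n + 2) (Fin.cons a (Fin.cons (2 * ηc - a) w : Fin (n + 1) → ℂ))
      = recCoef τ lam a * (∏ l, th1 (a - ηc - w l) τ * th1 (a - ηc + w l) τ) ^ 2
        * Zfun τ lam Ψ n w := by
  have e1 : ∏ l, th1 (a - ηc - interleave w l) τ
      = (∏ l, th1 (a - ηc - w l) τ * th1 (a - ηc + w l) τ) * th1 (a - ηc) τ := by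
    rw [prod_sites]
    simp only [interleave_siteA, interleave_siteB, interleave_siteL, sub_neg_eq_add, sub_zero]
  have e2 : ∏ l, th1 (a - ηc + interleave w l) τ
      = (∏ l, th1 (a - ηc - w l) τ * th1 (a - ηc + w l) τ) * th1 (a - ηc) τ := by
    rw [prod_sites]
    simp only [interleave_siteA, interleave_siteB, interleave_siteL, add_zero, ← sub_eq_add_neg]
    simp only [mul_comm]
  obtain ⟨c1, c2⟩ := chiC_contract hτ lam a
  have eβ : ∀ β, (∑ s, ∑ t, ∑ s', ∑ t', pairWeight (fun m => chiC τ lam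
        ((Fin.cons a (Fin.cons (2 * ηc - a) w : Fin (n + 1) → ℂ) : Fin (n + 2) → ℂ) m))
        (consTwo s t (consTwo s' t' β))
      * Ψ (n + 2) (consTwo a (-a) (consTwo (2 * ηc - a) (-(2 * ηc - a)) (interleave w)))
        (consTwo s t (consTwo s' t' β)))
      = recCoef τ lam a * (∏ l, th1 (a - ηc - w l) τ * th1 (a - ηc + w l) τ) ^ 2
        * (pairWeight (fun m => chiC τ lam (w m)) β * Ψ n (interleave w) β) := by
    intro β
    have hs := Psi_consTwo_singlet hτ h1 h5 a (interleave w) β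
    simp only [pairWeight_consTwo, neg_sub, Psi_consTwo_consTwo h5, Fin.cons_zero, Fin.cons_succ,
      Fin.sum_univ_two, chiC_self, e2]
    rw [e1] at hs
    have s1 : singletC 1 0 = -1 := by simp [singletC]
    have s2 : singletC 0 1 = 1 := by simp [singletC]
    have s3 : ∀ s, singletC s s = 0 := by intro s; fin_cases s <;> simp [singletC]
    simp only [s1, s2, s3, recCoef]
    set p := ∏ l, th1 (a - ηc - w l) τ * th1 (a - ηc + w l) τ
    set W := pairWeight (fun m => chiC τ lam (w m)) β
    set A := Ψ (n + 1) (consTwo a (a - 2 * ηc) (interleave w)) (consTwo 0 1 β)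
    set B := Ψ (n + 1) (consTwo a (a - 2 * ηc) (interleave w)) (consTwo 1 0 β)
    linear_combination
      (-(W * th1 (2 * a + 2 * ηc) τ * th1 (2 * a) τ * p * th1 (a - ηc) τ * A)) * c1
      + (W * th1 (2 * a + 2 * ηc) τ * th1 (2 * a) τ * p * th1 (a - ηc) τ * B) * c2
      + ((th2 0 τ / 2) ^ 2 * th1 (a + lam) τ * th1 (a - lam - 2 * ηc) τ
        * (W * th1 (2 * a + 2 * ηc) τ * th1 (2 * a) τ * p * th1 (a - ηc) τ)) * hs
  rw [Zfun_eq_sum, interleave_cons, interleave_cons, sum_consTwo, Zfun_eq_sum, Finset.mul_sum]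
  simp_rw [sum_consTwo]
  rw [← Finset.sum_congr rfl (fun β _ => eβ β)]
  simp only [Fin.sum_univ_two, Finset.sum_add_distrib]

/-- The recursion relation of the scalar product, for the last and any other pair. -/
theorem Zfun_recursion (hτ : 0 < τ.im) (hent : PsiEntire Ψ) (h1 : PsiP1 τ Ψ) (h3 : PsiP3 τ Ψ)
    (h5 : PsiP5 τ Ψ) (lam : ℂ) (x : Fin (n + 2) → ℂ) (j : Fin (n + 1))
    (hx : x (Fin.last _) = 2 * ηc - x j.castSucc) :
    Zfun τ lam Ψ (n + 2) x
      = recCoef τ lam (x j.castSucc)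
        * (∏ l : Fin n, th1 (x j.castSucc - ηc - x (j.succAbove l).castSucc) τ
          * th1 (x j.castSucc - ηc + x (j.succAbove l).castSucc) τ) ^ 2
        * Zfun τ lam Ψ n (fun l => x (j.succAbove l).castSucc) := by
  have hbij : Function.Bijective (Fin.cons j.castSucc (Fin.cons (Fin.last (n + 1))
      (fun l : Fin n => (j.succAbove l).castSucc) : Fin (n + 1) → Fin (n + 2)) :
        Fin (n + 2) → Fin (n + 2)) := by
    refine (Fintype.bijective_iff_injective_and_card _).mpr ⟨?_, rfl⟩
    rw [Fin.cons_injective_iff, Fin.cons_injective_iff]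
    refine ⟨?_, ?_, ?_⟩
    · rintro ⟨i, hi⟩
      revert hi
      refine Fin.cases ?_ (fun l => ?_) i
      · rw [Fin.cons_zero]; exact fun h => (Fin.castSucc_lt_last j).ne h.symm
      · rw [Fin.cons_succ]; intro h
        exact Fin.succAbove_ne j l (Fin.castSucc_injective _ h)
    · rintro ⟨l, hl⟩
      exact (Fin.castSucc_lt_last _).ne hl
    · exact (Fin.castSucc_injective _).comp Fin.succAbove_right_injective
  rw [← Zfun_comp_perm hτ hent h1 h3 lam x (Equiv.ofBijective _ hbij), ← Zfun_cons_cons hτ h1 h5]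
  congr 1
  funext i
  refine Fin.cases ?_ (fun i => Fin.cases ?_ (fun l => ?_) i) i <;>
    simp [Equiv.ofBijective, hx]

end

end

section

/-! ### The prefactor and the scalar product for one pair -/

lemma QP.eq_zero_of_card_lt {τ : ℂ} (hτ : 0 < τ.im) {N : ℕ} {ε C : ℂ} {f : ℂ → ℂ}
    (hf : QP τ N ε C f) (hε : ‖ε‖ = 1) (hC : C ≠ 0) {ι : Type*} [Fintype ι] (pt : ι → ℂ)
    (hN : N < Fintype.card ι) (hp : ∀ i j, i ≠ j → th1 (pt j - pt i) τ ≠ 0)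
    (h0 : ∀ i, f (pt i) = 0) (z : ℂ) : f z = 0 := by
  refine hf.eq_zero_of_zeros hτ hε hC (Finset.univ.toList.map pt) (by simpa using hN) ?_ ?_ z
  · rw [List.pairwise_map]
    exact (Finset.nodup_toList _).imp (fun h => hp _ _ h)
  · simpa using h0

lemma th1_add_half_tau_ne_zero {τ : ℂ} (hτ : 0 < τ.im) (r : ℝ) :
    th1 (r + Real.pi * τ / 2) τ ≠ 0 := by
  rw [Ne, th1_eq_zero_iff hτ]
  rintro ⟨m, n, h⟩
  have him := congrArg Complex.im h
  simp at him
  have h2 : (Real.pi * τ.im) * (1 - 2 * n) = 0 := by linear_combination 2 * him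
  have h3 : (1 : ℝ) - 2 * n = 0 := by
    rcases mul_eq_zero.mp h2 with h | h
    · exact absurd h (mul_pos Real.pi_pos hτ).ne'
    · exact h
  have : (1 : ℤ) - 2 * n = 0 := by exact_mod_cast h3
  omega

/-- The prefactor of the scalar product for a single pair. -/
def prefac (τ x : ℂ) : ℂ := th4 (2 * (ηc + x)) (2 * τ) * th1 (ηc + x) τ * th1 (ηc - x) τ

/-- The zeros of the prefactor. -/
def prefPt (τ : ℂ) : Fin 4 → ℂ :=
  ![ηc, -ηc, -ηc + Real.pi * τ / 2, -ηc + Real.pi * τ / 2 + Real.pi / 2]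

lemma th4_two_mul_half_tau (τ : ℂ) : th4 (Real.pi * τ) (2 * τ) = 0 := by
  have := th4_add_pi_tau' 0 τ
  rw [zero_add, th1_zero, mul_zero] at this
  exact this

lemma prefac_prefPt (τ : ℂ) (i : Fin 4) : prefac τ (prefPt τ i) = 0 := by
  fin_cases i
  · simp [prefac, prefPt, th1_zero]
  · simp [prefac, prefPt, th1_zero]
  · simp only [prefac, prefPt, Fin.reduceFinMk, Matrix.cons_val]
    rw [show 2 * (ηc + (-ηc + Real.pi * τ / 2)) = Real.pi * τ by ring, th4_two_mul_half_tau]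
    ring
  · simp only [prefac, prefPt, Fin.reduceFinMk, Matrix.cons_val]
    rw [show 2 * (ηc + (-ηc + Real.pi * τ / 2 + Real.pi / 2)) = Real.pi * τ + Real.pi by ring,
      th4_add_pi, th4_two_mul_half_tau]
    ring

lemma th1_sub_ne_zero_comm {τ a b : ℂ} (h : th1 (a - b) τ ≠ 0) : th1 (b - a) τ ≠ 0 := by
  rw [← neg_sub, th1_neg]; exact neg_ne_zero.mpr h

lemma prefPt_sub_ne_zero {τ : ℂ} (hτ : 0 < τ.im) (i j : Fin 4) (hij : i ≠ j) :
    th1 (prefPt τ j - prefPt τ i) τ ≠ 0 := by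
  wlog h : i < j generalizing i j with H
  · exact th1_sub_ne_zero_comm (H j i hij.symm (lt_of_le_of_ne (not_lt.mp h) hij.symm))
  have hr : ∀ (r : ℝ) (z : ℂ), z = r + Real.pi * τ / 2 → th1 z τ ≠ 0 := by
    rintro r _ rfl; exact th1_add_half_tau_ne_zero hτ r
  fin_cases i <;> fin_cases j <;> first | (exact absurd h (by decide)) | skip
  · refine th1_rat_ne_zero hτ (-2) 3 ?_ (by norm_num)
    simp [prefPt, ηc]; ring
  · refine hr (-2 * (Real.pi / 3)) _ ?_
    simp [prefPt, ηc]; ring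
  · refine hr (-2 * (Real.pi / 3) + Real.pi / 2) _ ?_
    simp [prefPt, ηc]; ring
  · refine hr 0 _ ?_
    simp [prefPt, ηc]
  · refine hr (Real.pi / 2) _ ?_
    simp [prefPt, ηc]; ring
  · refine th1_rat_ne_zero hτ 1 2 ?_ (by norm_num)
    simp [prefPt, ηc]; ring

lemma QP_prefac {τ : ℂ} (hτ : 0 < τ.im) :
    QP τ 4 1 (-((pnome τ) ^ 4)⁻¹ * cexp (2 * I * ηc)) (prefac τ) where
  diff := by
    have h1 := differentiable_th1 hτ
    have h4 := differentiable_th4 (two_mul_im_pos hτ)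
    unfold prefac
    exact ((h4.comp (by fun_prop)).fun_mul (h1.comp (by fun_prop))).fun_mul
      (h1.comp (by fun_prop))
  per z := by
    simp only [prefac]
    rw [show 2 * (ηc + (z + Real.pi)) = 2 * (ηc + z) + Real.pi + Real.pi by ring, th4_add_pi,
      th4_add_pi, show ηc + (z + Real.pi) = ηc + z + Real.pi by ring, th1_add_pi,
      show ηc - (z + Real.pi) = ηc - z - Real.pi by ring, th1_sub_pi]
    ring
  qper z := by
    simp only [prefac]
    rw [show 2 * (ηc + (z + Real.pi * τ)) = 2 * (ηc + z) + 2 * (Real.pi * τ) by ring,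
      th4_add_two_pi_tau, show ηc + (z + Real.pi * τ) = ηc + z + Real.pi * τ by ring,
      th1_add_pi_tau, show ηc - (z + Real.pi * τ) = -(z - ηc + Real.pi * τ) by ring, th1_neg,
      th1_add_pi_tau, show ηc - z = -(z - ηc) by ring, th1_neg]
    have e : cexp (-2 * I * (2 * (ηc + z))) * cexp (-2 * I * (ηc + z)) * cexp (-2 * I * (z - ηc))
        = cexp (2 * I * ηc) * cexp (-2 * I * (((4 : ℕ) : ℂ) * z)) := by
      rw [← Complex.exp_add, ← Complex.exp_add, ← Complex.exp_add, Complex.exp_eq_exp_iff_exists_int]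
      exact ⟨-1, by rw [ηc]; push_cast; ring⟩
    linear_combination (-((pnome τ) ^ 4)⁻¹ * th4 (2 * (ηc + z)) (2 * τ) * th1 (ηc + z) τ
      * -th1 (z - ηc) τ) * e

lemma sum_fin_one_fin_two (F : (Fin 1 → Fin 2) → ℂ) :
    ∑ β, F β = F (fun _ => 0) + F (fun _ => 1) := by
  rw [← (Equiv.funUnique (Fin 1) (Fin 2)).symm.sum_comp, Fin.sum_univ_two]
  rfl

section

variable {τ : ℂ} {Ψ : PsiFam} {n : ℕ}

lemma Zfun_prefPt (hτ : 0 < τ.im) (hent : PsiEntire Ψ) (h1 : PsiP1 τ Ψ) (h2 : PsiP2 τ Ψ)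
    (h3 : PsiP3 τ Ψ) (h5 : PsiP5 τ Ψ) (lam : ℂ) (x : Fin n → ℂ) (m : Fin n) (i : Fin 4)
    (hx : x m = prefPt τ i) : Zfun τ lam Ψ n x = 0 := by
  fin_cases i
  · exact Zfun_zero_eta hτ hent h1 h3 h5 lam x m hx
  · exact Zfun_zero_neg_eta h5 lam x m hx
  · exact Zfun_zero_half_tau h2 h5 lam x m hx
  · exact Zfun_zero_half_tau_add h2 h3 h5 lam x m hx

lemma Zfun_zero_pairs (h6 : PsiP6 Ψ) (lam : ℂ) (x : Fin 0 → ℂ) : Zfun τ lam Ψ 0 x = 1 := by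
  rw [Zfun_eq_sum]
  simp only [h6 _ _, pairWeight, Finset.univ_eq_empty, Finset.prod_empty, one_mul, mul_one]
  refine (sum_fin_one_fin_two _).trans ?_
  simp

lemma Zfun_one_special (hτ : 0 < τ.im) (h3 : PsiP3 τ Ψ) (h5 : PsiP5 τ Ψ) (h6 : PsiP6 Ψ)
    (lam : ℂ) (x : Fin 1 → ℂ) (hx : x 0 = Real.pi / 2 - ηc) :
    Zfun τ lam Ψ 1 x = th1 (ηc + x 0) τ * th1 (ηc - x 0) τ * th2 (ηc + lam) τ := by
  have e0 : x = Fin.cons (x 0) (fun i : Fin 0 => i.elim0) := by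
    funext i; fin_cases i; rfl
  have eL : ∀ l : Fin (2 * 0 + 1), interleave (fun i : Fin 0 => i.elim0) l = 0 := by
    intro l; simp [interleave]
  have hPsi : ∀ s t β, s ≠ t → Ψ 1 (interleave x) (consTwo s t β)
      = -th1 (x 0 + ηc) τ * (if β siteL = 0 then 1 else -1) := by
    intro s t β hst
    have key := Psi_sub_pi h3 (Function.update (interleave x) (siteB 0)
      (interleave x (siteB 0) + Real.pi)) (siteB 0) (consTwo s t β)
    simp only [Function.update_self, add_sub_cancel_right, Function.update_idem,
      Function.update_eq_self] at key
    have eu : Function.update (interleave x) (siteB 0) (interleave x (siteB 0) + Real.pi)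
        = consTwo (x 0 + 2 * ηc - 2 * ηc) (x 0 + 2 * ηc)
          (interleave (fun i : Fin 0 => i.elim0)) := by
      rw [interleave_siteB]
      funext l
      rcases site_cases l with ⟨m, rfl⟩ | ⟨m, rfl⟩ | rfl
      · rw [Function.update_of_ne (siteA_ne_siteB _ _), interleave_siteA, Subsingleton.elim m 0,
          consTwo_siteA_zero]; ring
      · rw [Subsingleton.elim m 0, Function.update_self, consTwo_siteB_zero, hx]; ring
      · rw [Function.update_of_ne (siteL_ne_siteB _), consTwo_siteL, interleave_siteL,
          interleave_siteL]
    rw [key, eu, Psi_consTwo_reduce h5, h6]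
    have ep : ∀ F : Fin (2 * (0 + 1) + 1) → ℂ, ∏ j ∈ Finset.univ.erase (siteB 0), F j
        = F (siteA 0) * F siteL := by
      intro F
      rw [show (Finset.univ.erase (siteB 0) : Finset (Fin (2 * (0 + 1) + 1)))
        = {siteA 0, siteL} by decide, Finset.prod_pair (by decide)]
    rw [ep, consTwo_siteA_zero, consTwo_siteL]
    simp only [eL, sub_zero, Finset.prod_const, Finset.card_univ, Fintype.card_fin]
    rw [show x 0 + 2 * ηc - ηc = x 0 + ηc by ring]
    clear key eu ep eL e0
    fin_cases s <;> fin_cases t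
    · exact absurd rfl hst
    · simp [singletC]
      split_ifs <;> ring
    · simp [singletC]
    · exact absurd rfl hst
  have hc := chiC_add hτ lam (x 0)
  have hβ : ∀ F : (Fin (2 * 0 + 1) → Fin 2) → ℂ, ∑ β, F β = F (fun _ => 0) + F (fun _ => 1) := by
    exact sum_fin_one_fin_two
  rw [Zfun_eq_sum, sum_consTwo]
  simp only [Fin.sum_univ_two, pairWeight_consTwo, chiC_self, zero_mul,
    zero_add, add_zero, hβ, hPsi 0 1 _ (by decide), hPsi 1 0 _ (by decide)]
  simp only [pairWeight, Finset.univ_eq_empty, Finset.prod_empty, if_true, one_ne_zero, if_false]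
  rw [add_comm ηc (x 0), show ηc - x 0 = -(x 0 - ηc) by ring, th1_neg, add_comm ηc lam]
  linear_combination (-th1 (x 0 + ηc) τ) * hc

theorem Zfun_one_pair (hτ : 0 < τ.im) (hent : PsiEntire Ψ) (h1 : PsiP1 τ Ψ) (h2 : PsiP2 τ Ψ)
    (h3 : PsiP3 τ Ψ) (h5 : PsiP5 τ Ψ) (h6 : PsiP6 Ψ) (lam : ℂ) (x : Fin 1 → ℂ) :
    th4 0 (2 * τ) * Zfun τ lam Ψ 1 x = prefac τ (x 0) * th2 (ηc + lam) τ := by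
  have hQ := ((QP_Zfun hτ hent h2 h3 lam x 0).const_mul (th4 0 (2 * τ))).sub
    ((QP_prefac hτ).const_mul (th2 (ηc + lam) τ))
  have key := hQ.eq_zero_of_card_lt hτ (by simp)
    (by have := pnome_ne_zero τ; simp [this]) (ι := Option (Fin 4))
    (fun o => o.elim (Real.pi / 2 - ηc) (prefPt τ)) (by simp) ?_ ?_ (x 0)
  · rw [Function.update_eq_self] at key
    linear_combination key
  · have hs : ∀ i, th1 (prefPt τ i - (Real.pi / 2 - ηc)) τ ≠ 0 := by
      intro i
      have hr : ∀ (r : ℝ) (z : ℂ), z = r + Real.pi * τ / 2 → th1 z τ ≠ 0 := by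
        rintro r _ rfl; exact th1_add_half_tau_ne_zero hτ r
      fin_cases i
      · refine th1_rat_ne_zero hτ 1 6 ?_ (by norm_num)
        simp [prefPt, ηc]; ring
      · refine th1_rat_ne_zero hτ (-1) 2 ?_ (by norm_num)
        simp [prefPt, ηc]; ring
      · refine hr (-Real.pi / 2) _ ?_
        simp [prefPt, ηc]; ring
      · refine hr 0 _ ?_
        simp [prefPt, ηc]; ring
    rintro (_ | i) (_ | j) hij
    · exact absurd rfl hij
    · exact hs j
    · exact th1_sub_ne_zero_comm (hs i)
    · exact prefPt_sub_ne_zero hτ i j (fun h => hij (by rw [h]))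
  · rintro (_ | i)
    · simp only [Option.elim_none]
      rw [Zfun_one_special hτ h3 h5 h6 lam _ (by simp), prefac, Function.update_self,
        show 2 * (ηc + (Real.pi / 2 - ηc)) = 0 + Real.pi by ring, th4_add_pi]
      ring
    · simp only [Option.elim_some]
      rw [Zfun_prefPt hτ hent h1 h2 h3 h5 lam _ 0 i (by simp), prefac_prefPt]
      ring

end

end

section

/-- The polynomial form `∏ hᵢⱼ · det (1 / hᵢⱼ)` of the numerator of the Tsuchiya determinant. -/
def tsuNum (τ : ℂ) {m : ℕ} (a b : Fin m → ℂ) : ℂ :=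
  Matrix.det (Matrix.of fun i j : Fin m => ∏ c ∈ Finset.univ.erase i, hh τ (a c) (b j))

lemma tsuNum_eq {τ : ℂ} {m : ℕ} (a b : Fin m → ℂ) (h : ∀ i j, hh τ (a i) (b j) ≠ 0) :
    tsuNum τ a b = (∏ i, ∏ j, hh τ (a i) (b j))
      * Matrix.det (Matrix.of fun i j : Fin m => (hh τ (a i) (b j))⁻¹) := by
  rw [Finset.prod_comm, ← Matrix.det_mul_row, tsuNum]
  congr 1
  ext i j
  simp only [Matrix.of_apply]
  rw [← Finset.mul_prod_erase Finset.univ _ (Finset.mem_univ i)]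
  field_simp [h i j]

lemma prod_erase_succAbove {m : ℕ} (i : Fin (m + 1)) (f : Fin (m + 1) → ℂ) :
    ∏ c ∈ Finset.univ.erase i, f c = ∏ c, f (i.succAbove c) := by
  rw [← Finset.compl_singleton, ← Fin.image_succAbove_univ, Finset.prod_image]
  exact fun _ _ _ _ h => Fin.succAbove_right_injective h

lemma prod_erase_erase_succAbove {m : ℕ} (i : Fin (m + 1)) (c : Fin m) (f : Fin (m + 1) → ℂ) :
    ∏ d ∈ Finset.univ.erase (i.succAbove c), f d
      = f i * ∏ d ∈ Finset.univ.erase c, f (i.succAbove d) := by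
  rw [← Finset.mul_prod_erase (Finset.univ.erase (i.succAbove c)) f
    (Finset.mem_erase.mpr ⟨(Fin.succAbove_ne i c).symm, Finset.mem_univ i⟩)]
  congr 1
  have : (Finset.univ.erase (i.succAbove c)).erase i
      = (Finset.univ.erase c).image i.succAbove := by
    ext d
    rcases Fin.eq_self_or_eq_succAbove i d with rfl | ⟨e, rfl⟩
    · simp [Fin.succAbove_ne]
    · simp [Fin.succAbove_ne]
  rw [this, Finset.prod_image (fun _ _ _ _ h => Fin.succAbove_right_injective h)]

lemma tsuNum_expand {τ : ℂ} {m : ℕ} (a b : Fin (m + 1) → ℂ) (i j : Fin (m + 1))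
    (h : hh τ (a i) (b j) = 0) :
    tsuNum τ a b = (-1) ^ (i + j : ℕ) * (∏ c, hh τ (a (i.succAbove c)) (b j))
      * (∏ l, hh τ (a i) (b (j.succAbove l)))
      * tsuNum τ (fun c => a (i.succAbove c)) (fun l => b (j.succAbove l)) := by
  rw [tsuNum, Matrix.det_succ_column _ j, Finset.sum_eq_single i]
  · rw [mul_assoc _ (∏ l, _), tsuNum, ← Matrix.det_mul_row]
    simp only [Matrix.of_apply, prod_erase_succAbove]
    congr 2
    ext c l
    simp only [Matrix.submatrix_apply, Matrix.of_apply]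
    rw [← prod_erase_succAbove (i.succAbove c) fun d => hh τ (a d) (b (j.succAbove l)),
      prod_erase_erase_succAbove]
  · intro c _ hc
    rw [Matrix.of_apply, Finset.prod_eq_zero (Finset.mem_erase.mpr ⟨hc.symm, Finset.mem_univ i⟩) h]
    ring
  · simp

lemma vdTheta_expand (τ : ℂ) {m : ℕ} (y : Fin (m + 1) → ℂ) (i : Fin (m + 1)) :
    vdTheta τ y = (-1) ^ (i : ℕ)
      * (∏ l, th1 (y (i.succAbove l) - y i) τ * th1 (y (i.succAbove l) + y i) τ)
      * vdTheta τ (fun l => y (i.succAbove l)) := by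
  have hlt : ∀ c d : Fin m, i.succAbove c < i.succAbove d ↔ c < d := fun c d =>
    Fin.succAbove_lt_succAbove_iff
  rw [vdTheta, Fin.prod_univ_succAbove _ i]
  simp only [Fin.prod_univ_succAbove _ i, lt_irrefl, if_false, one_mul, Finset.prod_mul_distrib,
    hlt]
  rw [← mul_assoc, vdTheta, ← Finset.prod_mul_distrib]
  congr 1
  have hs : ∏ l : Fin m, (if i.succAbove l < i then (-1 : ℂ) else 1) = (-1) ^ (i : ℕ) := by
    rw [Finset.prod_ite, Finset.prod_const, Finset.prod_const_one, mul_one]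
    congr 1
    have h1 : (Finset.univ.filter fun l : Fin m => i.succAbove l < i).image i.succAbove
        = Finset.Iio i := by
      ext d
      rcases Fin.eq_self_or_eq_succAbove i d with rfl | ⟨e, rfl⟩
      · simp [Fin.succAbove_ne]
      · simp
    rw [← Fin.card_Iio i, ← h1, Finset.card_image_of_injective _ Fin.succAbove_right_injective]
  rw [← hs, ← Finset.prod_mul_distrib, ← Finset.prod_mul_distrib]
  refine Finset.prod_congr rfl fun l _ => ?_
  rcases lt_or_gt_of_ne (Fin.succAbove_ne i l) with h | h
  · rw [if_neg (not_lt.mpr h.le), if_pos h, if_pos h,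
      show y i - y (i.succAbove l) = -(y (i.succAbove l) - y i) by ring, th1_neg,
      add_comm (y i)]
    ring
  · rw [if_pos h, if_neg (not_lt.mpr h.le), if_neg (not_lt.mpr h.le)]
    ring

/-- The factor which a spectator variable `c` contributes to the Tsuchiya determinant when two
other variables are specialised to `x` and `2η - x`. -/
def specFac (τ x c : ℂ) : ℂ := th1 (x - ηc - c) τ * th1 (x - ηc + c) τ

lemma hh_special_right (τ x c : ℂ) :
    hh τ c (2 * ηc - x) = -specFac τ x c * (th1 (c - x) τ * th1 (c + x) τ) := by
  rw [hh, specFac, show c - (2 * ηc - x) - ηc = (c + x) - 3 * ηc by ring, th1_sub_three_eta,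
    show c + (2 * ηc - x) + ηc = -((x - c) - 3 * ηc) by ring, th1_neg, th1_sub_three_eta,
    show c - (2 * ηc - x) + ηc = x - ηc + c by ring,
    show c + (2 * ηc - x) - ηc = -(x - ηc - c) by ring, th1_neg,
    show c - x = -(x - c) by ring, th1_neg]
  ring

lemma hh_special_left (τ x b : ℂ) :
    hh τ x b = -specFac τ x b * (th1 (b - (2 * ηc - x)) τ * th1 (b + (2 * ηc - x)) τ) := by
  rw [hh, specFac, show b - (2 * ηc - x) = (x + b + ηc) - 3 * ηc by ring, th1_sub_three_eta,
    show b + (2 * ηc - x) = -((x - b + ηc) - 3 * ηc) by ring, th1_neg, th1_sub_three_eta,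
    show x - b - ηc = x - ηc - b by ring, show x + b - ηc = x - ηc + b by ring]
  ring

lemma hh_special (τ x : ℂ) : hh τ x (2 * ηc - x) = 0 := by
  rw [hh, show x + (2 * ηc - x) + ηc = 0 - -(3 * ηc) by ring, sub_neg_eq_add, zero_add,
    th1_three_eta]
  ring

lemma tsuNum_recursion (τ : ℂ) {m : ℕ} (a b : Fin (m + 1) → ℂ) (i j : Fin (m + 1))
    (h : b j = 2 * ηc - a i) :
    tsuNum τ a b * (vdTheta τ (fun c => a (i.succAbove c)) * vdTheta τ (fun l => b (j.succAbove l)))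
      = (∏ c, specFac τ (a i) (a (i.succAbove c))) * (∏ l, specFac τ (a i) (b (j.succAbove l)))
        * tsuNum τ (fun c => a (i.succAbove c)) (fun l => b (j.succAbove l))
        * (vdTheta τ a * vdTheta τ b) := by
  rw [tsuNum_expand a b i j (by rw [h, hh_special]), vdTheta_expand τ a i, vdTheta_expand τ b j]
  simp only [h, hh_special_right]
  simp only [hh_special_left τ (a i) (b _), Finset.prod_mul_distrib, neg_mul, Finset.prod_neg]
  have e : ((-1 : ℂ) ^ m) * (-1) ^ m = 1 := by rw [← mul_pow]; norm_num
  simp only [Finset.card_univ, Fintype.card_fin, pow_add]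
  have e' : ∀ y : ℂ, ((-1 : ℂ) ^ m * (-1) ^ m) * y = y := fun y => by rw [e, one_mul]
  refine Eq.trans ?_ (e' _)
  ring

end

section

lemma hh_neg_left (τ x y : ℂ) : hh τ (-x) y = hh τ x y := by
  rw [hh, hh, show -x - y + ηc = -(x + y - ηc) by ring, show -x - y - ηc = -(x + y + ηc) by ring,
    show -x + y + ηc = -(x - y - ηc) by ring, show -x + y - ηc = -(x - y + ηc) by ring]
  simp only [th1_neg]
  ring

lemma hh_neg_right (τ x y : ℂ) : hh τ x (-y) = hh τ x y := by
  rw [hh, hh, sub_neg_eq_add, ← sub_eq_add_neg]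
  ring

lemma tsuNum_congr_sign {τ : ℂ} {m : ℕ} {a a' b b' : Fin m → ℂ}
    (ha : ∀ i, a' i = a i ∨ a' i = -a i) (hb : ∀ i, b' i = b i ∨ b' i = -b i) :
    tsuNum τ a' b' = tsuNum τ a b := by
  have h : ∀ i j, hh τ (a' i) (b' j) = hh τ (a i) (b j) := by
    intro i j
    rcases ha i with h1 | h1 <;> rcases hb j with h2 | h2 <;>
      simp only [h1, h2, hh_neg_left, hh_neg_right]
  simp only [tsuNum, h]

lemma vdTheta_congr_sign {τ : ℂ} {m : ℕ} {y y' : Fin m → ℂ}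
    (hy : ∀ i, y' i = y i ∨ y' i = -y i) : vdTheta τ y' = vdTheta τ y := by
  have h : ∀ u v : ℂ, th1 (-u - v) τ * th1 (-u + v) τ = th1 (u - v) τ * th1 (u + v) τ := by
    intro u v
    rw [show -u - v = -(u + v) by ring, show -u + v = -(u - v) by ring, th1_neg, th1_neg]
    ring
  have h' : ∀ u v : ℂ, th1 (u - -v) τ * th1 (u + -v) τ = th1 (u - v) τ * th1 (u + v) τ := by
    intro u v
    rw [sub_neg_eq_add, ← sub_eq_add_neg]
    ring
  unfold vdTheta
  refine Finset.prod_congr rfl fun i _ => Finset.prod_congr rfl fun j _ => ?_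
  rcases hy i with h1 | h1 <;> rcases hy j with h2 | h2 <;> simp only [h1, h2, h, h']

lemma tsuNum_eq_zero {τ : ℂ} {m : ℕ} (a b : Fin m → ℂ) {j l : Fin m} (hjl : j ≠ l)
    (h : b j = b l ∨ b j = -b l) : tsuNum τ a b = 0 := by
  refine Matrix.det_zero_of_column_eq hjl fun i => ?_
  simp only [Matrix.of_apply]
  refine Finset.prod_congr rfl fun c _ => ?_
  rcases h with h | h <;> simp only [h, hh_neg_right]

lemma QP_hh {τ : ℂ} (hτ : 0 < τ.im) (x : ℂ) : QP τ 4 1 ((pnome τ ^ 4)⁻¹) (fun z => hh τ x z) := by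
  have h := (((QP_th1_sub hτ (x + ηc)).mul (QP_th1_sub hτ (x - ηc))).mul
    (QP_th1_sub hτ (-x - ηc))).mul (QP_th1_sub hτ (-x + ηc))
  have e : cexp (2 * I * (x + ηc)) * cexp (2 * I * (x - ηc)) * cexp (2 * I * (-x - ηc))
      * cexp (2 * I * (-x + ηc)) = 1 := by
    rw [← Complex.exp_add, ← Complex.exp_add, ← Complex.exp_add, ← Complex.exp_zero]
    congr 1
    ring
  have hf : (fun z => hh τ x z) = fun z => th1 (z - (x + ηc)) τ * th1 (z - (x - ηc)) τ
      * th1 (z - (-x - ηc)) τ * th1 (z - (-x + ηc)) τ := by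
    funext z
    rw [hh, show x - z + ηc = -(z - (x + ηc)) by ring, show x - z - ηc = -(z - (x - ηc)) by ring,
      show x + z + ηc = z - (-x - ηc) by ring, show x + z - ηc = z - (-x + ηc) by ring, th1_neg,
      th1_neg]
    ring
  rw [hf]
  refine h.congr' rfl (by norm_num) ?_
  linear_combination ((pnome τ)⁻¹ ^ 4) * e

lemma QP_prod {τ : ℂ} {N : ℕ} {C : ℂ} {ι : Type*} (s : Finset ι) {F : ι → ℂ → ℂ}
    (h : ∀ i ∈ s, QP τ N 1 C (F i)) :
    QP τ (s.card * N) 1 (C ^ s.card) (fun z => ∏ i ∈ s, F i z) := by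
  classical
  induction s using Finset.induction_on with
  | empty => simpa using QP.one
  | insert i s hi ih =>
    simp only [Finset.prod_insert hi, Finset.card_insert_of_notMem hi]
    exact ((h i (Finset.mem_insert_self i s)).mul
      (ih fun j hj => h j (Finset.mem_insert_of_mem hj))).congr' (by ring) (by ring) (by ring)

lemma QP_tsuNum {τ : ℂ} (hτ : 0 < τ.im) {m : ℕ} (a b : Fin (m + 1) → ℂ) (j : Fin (m + 1)) :
    QP τ (4 * m) 1 ((pnome τ ^ (4 * m))⁻¹) (fun z => tsuNum τ a (Function.update b j z)) := by
  simp only [tsuNum, Matrix.det_succ_column _ j]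
  refine QP.sum _ fun i _ => ?_
  have h := ((QP_prod (Finset.univ.erase i) fun c _ => QP_hh hτ (a c)).const_mul
    ((-1 : ℂ) ^ (i + j : ℕ) * ((Matrix.of fun i' j' : Fin (m + 1) =>
      ∏ c ∈ Finset.univ.erase i', hh τ (a c) (b j')).submatrix i.succAbove j.succAbove).det))
  have hc : (Finset.univ.erase i).card = m := by simp
  convert h.congr' (M := 4 * m) (ε' := 1) (C' := (pnome τ ^ (4 * m))⁻¹) (by rw [hc]; ring) rfl
    (by rw [hc, pow_mul, inv_pow]) using 2 with z
  rw [show ((Matrix.of fun i' j' : Fin (m + 1) => ∏ c ∈ Finset.univ.erase i',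
      hh τ (a c) (Function.update b j z j')).submatrix i.succAbove j.succAbove)
      = ((Matrix.of fun i' j' : Fin (m + 1) =>
      ∏ c ∈ Finset.univ.erase i', hh τ (a c) (b j')).submatrix i.succAbove j.succAbove) from ?_]
  · simp only [Matrix.of_apply, Function.update_self]
    ring
  · ext c l
    simp

/-- The product by which a further variable `z` enters `vdTheta`. -/
def pairProd (τ : ℂ) {d : ℕ} (B : Fin d → ℂ) (z : ℂ) : ℂ :=
  ∏ l, th1 (B l - z) τ * th1 (B l + z) τ

/-- The points `± B l` are pairwise inequivalent modulo the period lattice. -/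
structure SignSeparated (τ : ℂ) {d : ℕ} (B : Fin d → ℂ) : Prop where
  sub : ∀ i j, i ≠ j → th1 (B i - B j) τ ≠ 0
  add : ∀ i j, i ≠ j → th1 (B i + B j) τ ≠ 0
  dbl : ∀ i, th1 (2 * B i) τ ≠ 0

lemma QP.exists_factor_pairs {τ : ℂ} (hτ : 0 < τ.im) {N d : ℕ} {P : ℂ → ℂ}
    (hP : QP τ (N + 2 * d) 1 ((pnome τ ^ (N + 2 * d))⁻¹) P) (B : Fin d → ℂ)
    (hB : SignSeparated τ B) (h0 : ∀ l, P (B l) = 0 ∧ P (-B l) = 0) :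
    ∃ g, QP τ N 1 ((pnome τ ^ N)⁻¹) g ∧ ∀ z, P z = pairProd τ B z * g z := by
  have hp := pnome_ne_zero τ
  let pt : Fin d × Bool → ℂ := fun q => if q.2 then B q.1 else -B q.1
  let L : List ℂ := (Finset.univ : Finset (Fin d × Bool)).toList.map pt
  have hL : L.length = 2 * d := by simp [L, mul_comm]
  have hprod : ∀ F : ℂ → ℂ, (L.map F).prod = ∏ l, F (B l) * F (-B l) := by
    intro F
    simp only [L, List.map_map, Finset.prod_map_toList, Fintype.prod_prod_type,
      Fintype.prod_bool, Function.comp, pt]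
    simp
  have hpw : L.Pairwise fun a b => th1 (b - a) τ ≠ 0 := by
    simp only [L, List.pairwise_map]
    refine (Finset.nodup_toList _).imp ?_
    rintro ⟨i, s⟩ ⟨j, t⟩ hne
    by_cases hij : i = j
    · subst hij
      cases s <;> cases t <;> simp [pt] at hne ⊢
      · rw [← two_mul]; exact hB.dbl i
      · rw [show -B i - B i = -(2 * B i) by ring, th1_neg, neg_eq_zero]; exact hB.dbl i
    · have h1 := hB.sub i j hij
      have h2 := hB.add i j hij
      have h3 := hB.sub j i (Ne.symm hij)
      cases s <;> cases t <;> simp only [pt, if_true, if_false, Bool.false_eq_true]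
      · rwa [show -B j - -B i = B i - B j by ring]
      · rwa [show B j - -B i = B i + B j by ring]
      · rw [show -B j - B i = -(B i + B j) by ring, th1_neg, neg_ne_zero]; exact h2
      · exact h3
  have hz : ∀ a ∈ L, P a = 0 := by
    intro a ha
    simp only [L, List.mem_map, Finset.mem_toList, Finset.mem_univ, true_and] at ha
    obtain ⟨⟨l, s⟩, rfl⟩ := ha
    cases s
    · simpa [pt] using (h0 l).2
    · simpa [pt] using (h0 l).1
  obtain ⟨g, hg, hPg⟩ := QP.exists_factor_list hτ L (N := N) (by rw [hL]; exact hP) (by simp)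
    (by simp [hp]) hpw hz
  refine ⟨fun z => (-1) ^ d * g z, (hg.const_mul _).congr' rfl ?_ ?_, fun z => ?_⟩
  · rw [hL, pow_mul]; simp
  · rw [hprod]
    have : ∀ l, (-(pnome τ) * cexp (-(2 * I * B l))) * (-(pnome τ) * cexp (-(2 * I * -B l)))
        = pnome τ ^ 2 := by
      intro l
      have e : cexp (-(2 * I * B l)) * cexp (-(2 * I * -B l)) = 1 := by
        rw [← Complex.exp_add, ← Complex.exp_zero]; congr 1; ring
      linear_combination (pnome τ ^ 2) * e
    simp only [this, Finset.prod_const, Finset.card_univ, Fintype.card_fin]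
    field_simp
    ring
  · rw [hPg, hprod, pairProd]
    have e : ∀ l, th1 (B l - z) τ * th1 (B l + z) τ
        = -1 * (th1 (z - B l) τ * th1 (z - -B l) τ) := by
      intro l
      rw [← neg_sub z, th1_neg, sub_neg_eq_add, add_comm z]; ring
    simp only [e]
    rw [Finset.prod_mul_distrib (f := fun _ => (-1 : ℂ)), Finset.prod_const, Finset.card_univ,
      Fintype.card_fin]
    have e2 : ((-1 : ℂ) ^ d) * (-1) ^ d = 1 := by rw [← mul_pow]; norm_num
    linear_combination (-(∏ l, th1 (z - B l) τ * th1 (z - -B l) τ) * g z) * e2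

/-- Uniqueness in one variable: an identity between theta functions with a common factor
follows from its validity at sufficiently many points. -/
theorem eq_of_points {τ : ℂ} (hτ : 0 < τ.im) {d₁ d₂ : ℕ} {f q P₁ P₂ : ℂ → ℂ} {κ : ℂ}
    (hκ : κ ≠ 0)
    (hf : QP τ (4 + 2 * d₁ + 2 * d₂) 1 (κ * (pnome τ ^ (2 * d₁ + 2 * d₂))⁻¹) f)
    (hq : QP τ 4 1 κ q) (hP₁ : QP τ (4 * d₁) 1 ((pnome τ ^ (4 * d₁))⁻¹) P₁)
    (hP₂ : QP τ (4 * d₂) 1 ((pnome τ ^ (4 * d₂))⁻¹) P₂) (B₁ : Fin d₁ → ℂ) (B₂ : Fin d₂ → ℂ)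
    (hB₁ : SignSeparated τ B₁) (hB₂ : SignSeparated τ B₂)
    (h₁ : ∀ l, P₁ (B₁ l) = 0 ∧ P₁ (-B₁ l) = 0) (h₂ : ∀ l, P₂ (B₂ l) = 0 ∧ P₂ (-B₂ l) = 0)
    {ι : Type*} [Fintype ι] (pt : ι → ℂ) (hcard : 4 + 2 * d₁ + 2 * d₂ < Fintype.card ι)
    (hpt : ∀ i j, i ≠ j → th1 (pt j - pt i) τ ≠ 0)
    (hval : ∀ i, (f (pt i) = 0 ∧ q (pt i) = 0) ∨
      (pairProd τ B₁ (pt i) ≠ 0 ∧ pairProd τ B₂ (pt i) ≠ 0 ∧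
        f (pt i) * pairProd τ B₁ (pt i) * pairProd τ B₂ (pt i)
          = q (pt i) * P₁ (pt i) * P₂ (pt i))) (z : ℂ) :
    f z * pairProd τ B₁ z * pairProd τ B₂ z = q z * P₁ z * P₂ z := by
  have hp := pnome_ne_zero τ
  obtain ⟨g₁, hg₁, e₁⟩ := QP.exists_factor_pairs hτ (N := 2 * d₁)
    (hP₁.congr' (by ring) rfl (by ring_nf)) B₁ hB₁ h₁
  obtain ⟨g₂, hg₂, e₂⟩ := QP.exists_factor_pairs hτ (N := 2 * d₂)
    (hP₂.congr' (by ring) rfl (by ring_nf)) B₂ hB₂ h₂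
  have hW := hf.sub (((hq.mul hg₁).mul hg₂).congr' rfl (by norm_num)
    (by rw [pow_add, mul_inv, ← mul_assoc]))
  have key := hW.eq_zero_of_card_lt hτ (by simp) (by simp [hκ, hp]) pt hcard hpt (fun i => ?_) z
  · rw [e₁, e₂]
    linear_combination pairProd τ B₁ z * pairProd τ B₂ z * key
  · rcases hval i with ⟨h, h'⟩ | ⟨h, h', hv⟩
    · simp [h, h']
    · rw [e₁, e₂] at hv
      have : pairProd τ B₁ (pt i) * pairProd τ B₂ (pt i)
          * (f (pt i) - q (pt i) * g₁ (pt i) * g₂ (pt i)) = 0 := by linear_combination hv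
      exact (mul_eq_zero.mp this).resolve_left (mul_ne_zero h h')

end

section

/-- `f` is entire in each variable separately. -/
def SepEntire {ι : Type*} [DecidableEq ι] (f : (ι → ℂ) → ℂ) : Prop :=
  ∀ x i, Differentiable ℂ fun z => f (Function.update x i z)

namespace SepEntire

variable {ι κ : Type*} [DecidableEq ι] {f g : (ι → ℂ) → ℂ}

lemma const (c : ℂ) : SepEntire (fun _ : ι → ℂ => c) := fun _ _ => differentiable_const c

lemma coord (i : ι) : SepEntire (fun x : ι → ℂ => x i) := by
  intro x j
  by_cases h : i = j
  · subst h; simp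
  · simp [Function.update_of_ne h]

lemma mul (hf : SepEntire f) (hg : SepEntire g) : SepEntire (fun x => f x * g x) :=
  fun x i => (hf x i).fun_mul (hg x i)

lemma add (hf : SepEntire f) (hg : SepEntire g) : SepEntire (fun x => f x + g x) :=
  fun x i => (hf x i).fun_add (hg x i)

lemma sub (hf : SepEntire f) (hg : SepEntire g) : SepEntire (fun x => f x - g x) :=
  fun x i => (hf x i).fun_sub (hg x i)

lemma sum (s : Finset κ) {F : κ → (ι → ℂ) → ℂ} (h : ∀ i ∈ s, SepEntire (F i)) :
    SepEntire (fun x => ∑ i ∈ s, F i x) :=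
  fun x i => Differentiable.fun_sum fun j hj => h j hj x i

lemma prod (s : Finset κ) {F : κ → (ι → ℂ) → ℂ} (h : ∀ i ∈ s, SepEntire (F i)) :
    SepEntire (fun x => ∏ i ∈ s, F i x) :=
  fun x i => Differentiable.fun_finsetProd fun j hj => h j hj x i

lemma comp_entire {φ : ℂ → ℂ} (hφ : Differentiable ℂ φ) (hf : SepEntire f) :
    SepEntire (fun x => φ (f x)) :=
  fun x i => hφ.comp (hf x i)

lemma exists_mul_ne_zero [Fintype ι] (hf : SepEntire f) (hg : SepEntire g) (hf0 : ∃ x, f x ≠ 0)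
    (hg0 : ∃ x, g x ≠ 0) : ∃ x, f x * g x ≠ 0 := by
  have key : ∀ s : Finset ι, ∃ x y, f x ≠ 0 ∧ g y ≠ 0 ∧ ∀ i ∈ s, x i = y i := by
    intro s
    induction s using Finset.induction_on with
    | empty =>
      obtain ⟨x, hx⟩ := hf0
      obtain ⟨y, hy⟩ := hg0
      exact ⟨x, y, hx, hy, by simp⟩
    | insert i s hi ih =>
      obtain ⟨x, y, hx, hy, hxy⟩ := ih
      obtain ⟨z, hz⟩ := _root_.exists_mul_ne_zero (hf x i) (hg y i)
        ⟨x i, by simpa using hx⟩ ⟨y i, by simpa using hy⟩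
      refine ⟨Function.update x i z, Function.update y i z, left_ne_zero_of_mul hz,
        right_ne_zero_of_mul hz, fun j hj => ?_⟩
      by_cases hji : j = i
      · subst hji; simp
      · rw [Function.update_of_ne hji, Function.update_of_ne hji]
        exact hxy j ((Finset.mem_insert.mp hj).resolve_left hji)
  obtain ⟨x, y, hx, hy, hxy⟩ := key Finset.univ
  obtain rfl : x = y := funext fun i => hxy i (Finset.mem_univ i)
  exact ⟨x, mul_ne_zero hx hy⟩

end SepEntire

/-- `P` holds off the zero set of a nonzero separately entire function. -/
def Generic {ι : Type*} [DecidableEq ι] (P : (ι → ℂ) → Prop) : Prop :=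
  ∃ g, SepEntire g ∧ (∃ x, g x ≠ 0) ∧ ∀ x, g x ≠ 0 → P x

namespace Generic

variable {ι κ : Type*} [DecidableEq ι] {P Q : (ι → ℂ) → Prop}

lemma mono (hP : Generic P) (h : ∀ x, P x → Q x) : Generic Q := by
  obtain ⟨g, hg, hne, hgP⟩ := hP
  exact ⟨g, hg, hne, fun x hx => h x (hgP x hx)⟩

lemma of_forall (h : ∀ x, P x) : Generic P :=
  ⟨fun _ => 1, SepEntire.const 1, ⟨0, one_ne_zero⟩, fun x _ => h x⟩

lemma and [Fintype ι] (hP : Generic P) (hQ : Generic Q) : Generic (fun x => P x ∧ Q x) := by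
  obtain ⟨f, hf, hf0, hfP⟩ := hP
  obtain ⟨g, hg, hg0, hgQ⟩ := hQ
  exact ⟨_, hf.mul hg, hf.exists_mul_ne_zero hg hf0 hg0, fun x hx =>
    ⟨hfP x (left_ne_zero_of_mul hx), hgQ x (right_ne_zero_of_mul hx)⟩⟩

lemma forall_fintype [Fintype ι] [Finite κ] {P : κ → (ι → ℂ) → Prop} (h : ∀ k, Generic (P k)) :
    Generic (fun x => ∀ k, P k x) := by
  classical
  have := Fintype.ofFinite κ
  have key : ∀ s : Finset κ, Generic (fun x => ∀ k ∈ s, P k x) := by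
    intro s
    induction s using Finset.induction_on with
    | empty => exact of_forall (by simp)
    | insert i s hi ih => exact ((h i).and ih).mono (by simp)
  exact (key Finset.univ).mono fun x hx k => hx k (Finset.mem_univ k)

lemma imp_const {c : Prop} (h : c → Generic P) : Generic (fun x => c → P x) := by
  by_cases hc : c
  · exact (h hc).mono fun x hx _ => hx
  · exact of_forall fun x hx => absurd hx hc

lemma comp_ne_zero {φ : ℂ → ℂ} (hφ : Differentiable ℂ φ) (h0 : ∃ z, φ z ≠ 0)
    {L : (ι → ℂ) → ℂ} (hL : SepEntire L) (hs : Function.Surjective L) :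
    Generic (fun x => φ (L x) ≠ 0) := by
  obtain ⟨w, hw⟩ := h0
  obtain ⟨x, rfl⟩ := hs w
  exact ⟨_, hL.comp_entire hφ, ⟨x, hw⟩, fun x hx => hx⟩

lemma eq_zero [Fintype ι] (hP : Generic P) {f : (ι → ℂ) → ℂ} (hf : SepEntire f)
    (h : ∀ x, P x → f x = 0) (x : ι → ℂ) : f x = 0 := by
  obtain ⟨g, hg, hg0, hgP⟩ := hP
  by_contra hx
  obtain ⟨y, hy⟩ := hf.exists_mul_ne_zero hg ⟨x, hx⟩ hg0
  exact left_ne_zero_of_mul hy (h y (hgP y (right_ne_zero_of_mul hy)))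

end Generic

variable {ι : Type*} [DecidableEq ι] {τ : ℂ}

lemma SepEntire.th1 (hτ : 0 < τ.im) {f : (ι → ℂ) → ℂ} (hf : SepEntire f) :
    SepEntire fun x => th1 (f x) τ :=
  hf.comp_entire (φ := fun z => _root_.th1 z τ) (differentiable_th1 hτ)

lemma SepEntire.vdTheta (hτ : 0 < τ.im) {m : ℕ} {y : (ι → ℂ) → Fin m → ℂ}
    (hy : ∀ i, SepEntire fun x => y x i) : SepEntire fun x => vdTheta τ (y x) := by
  refine SepEntire.prod _ fun i _ => SepEntire.prod _ fun j _ => ?_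
  by_cases hij : i < j
  · simp only [if_pos hij]
    exact (((hy j).sub (hy i)).th1 hτ).mul (((hy j).add (hy i)).th1 hτ)
  · simp only [if_neg hij]
    exact SepEntire.const 1

lemma SepEntire.hh (hτ : 0 < τ.im) {f g : (ι → ℂ) → ℂ} (hf : SepEntire f) (hg : SepEntire g) :
    SepEntire fun x => hh τ (f x) (g x) := by
  have hη := SepEntire.const (ι := ι) ηc
  exact (((((hf.sub hg).add hη).th1 hτ).mul (((hf.sub hg).sub hη).th1 hτ)).mul
    (((hf.add hg).add hη).th1 hτ)).mul (((hf.add hg).sub hη).th1 hτ)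

lemma SepEntire.tsuNum (hτ : 0 < τ.im) {m : ℕ} {a b : (ι → ℂ) → Fin m → ℂ}
    (ha : ∀ i, SepEntire fun x => a x i) (hb : ∀ i, SepEntire fun x => b x i) :
    SepEntire fun x => tsuNum τ (a x) (b x) := by
  simp only [_root_.tsuNum, Matrix.det_apply, Matrix.of_apply, Units.smul_def, zsmul_eq_mul]
  refine SepEntire.sum _ fun σ _ => (SepEntire.const _).mul (SepEntire.prod _ fun i _ =>
    SepEntire.prod _ fun c _ => SepEntire.hh hτ (ha c) (hb i))

end

section

/-- First half of the extended tuple `(x, l)` of length `2m`. -/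
def headHalf (m : ℕ) (l : List ℂ) {n : ℕ} (x : Fin n → ℂ) : Fin m → ℂ :=
  firstHalf (extL x l : Fin (2 * m) → ℂ)

/-- Second half of the extended tuple `(x, l)` of length `2m`. -/
def tailHalf (m : ℕ) (l : List ℂ) {n : ℕ} (x : Fin n → ℂ) : Fin m → ℂ :=
  secondHalf (extL x l : Fin (2 * m) → ℂ)

section

variable {m n : ℕ} (l : List ℂ)

lemma headHalf_apply (x : Fin n → ℂ) (i : Fin m) (h : (i : ℕ) < n) :
    headHalf m l x i = x ⟨i, h⟩ := by
  simp [headHalf, firstHalf, extL, h]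

lemma tailHalf_apply_lt (x : Fin n → ℂ) (i : Fin m) (h : m + (i : ℕ) < n) :
    tailHalf m l x i = x ⟨m + i, h⟩ := by
  simp [tailHalf, secondHalf, extL, h]

lemma tailHalf_apply_ge (x : Fin n → ℂ) (i : Fin m) (h : n ≤ m + (i : ℕ)) :
    tailHalf m l x i = l.getD (m + i - n) 0 := by
  simp [tailHalf, secondHalf, extL, not_lt.mpr h]

lemma sepEntire_extL {k : ℕ} (q : Fin k) :
    SepEntire fun x : Fin n → ℂ => (extL x l : Fin k → ℂ) q := by
  unfold extL
  by_cases h : (q : ℕ) < n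
  · simpa [h] using SepEntire.coord _
  · simpa [h] using SepEntire.const _

lemma sepEntire_headHalf (i : Fin m) : SepEntire fun x : Fin n → ℂ => headHalf m l x i :=
  sepEntire_extL l _

lemma sepEntire_tailHalf (i : Fin m) : SepEntire fun x : Fin n → ℂ => tailHalf m l x i :=
  sepEntire_extL l _

/-- The position of the last coordinate in the second half of the extended tuple. -/
def lastPos (h : n ≤ 2 * m) : Fin (m + 1) := ⟨n - m, by omega⟩

lemma tailHalf_lastPos (hmn : m ≤ n) (h : n ≤ 2 * m) (x : Fin (n + 2) → ℂ) :
    tailHalf (m + 1) l x (lastPos h) = x (Fin.last (n + 1)) := by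
  have hv : ((lastPos h : Fin (m + 1)) : ℕ) = n - m := rfl
  rw [tailHalf_apply_lt l x _ (by omega)]
  congr 1
  ext
  simp only [Fin.val_last]
  omega

lemma headHalf_update (hmn : m ≤ n) (x : Fin (n + 2) → ℂ) (z : ℂ) :
    headHalf (m + 1) l (Function.update x (Fin.last (n + 1)) z) = headHalf (m + 1) l x := by
  funext i
  rw [headHalf_apply l _ i (by omega), headHalf_apply l _ i (by omega), Function.update_of_ne]
  rw [Ne, Fin.ext_iff, Fin.val_last]
  simp only
  omega

lemma tailHalf_update (hmn : m ≤ n) (h : n ≤ 2 * m) (x : Fin (n + 2) → ℂ) (z : ℂ) :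
    tailHalf (m + 1) l (Function.update x (Fin.last (n + 1)) z)
      = Function.update (tailHalf (m + 1) l x) (lastPos h) z := by
  funext i
  by_cases hi : i = lastPos h
  · subst hi
    rw [tailHalf_lastPos l hmn, Function.update_self, Function.update_self]
  · rw [Function.update_of_ne hi]
    have hv : (i : ℕ) ≠ n - m := fun e => hi (Fin.ext e)
    rcases lt_or_ge (m + 1 + (i : ℕ)) (n + 2) with hlt | hge
    · rw [tailHalf_apply_lt l _ i hlt, tailHalf_apply_lt l _ i hlt, Function.update_of_ne]
      rw [Ne, Fin.ext_iff, Fin.val_last]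
      simp only
      omega
    · rw [tailHalf_apply_ge l _ i hge, tailHalf_apply_ge l _ i hge]

lemma val_succAbove {k : ℕ} (p : Fin (k + 1)) (i : Fin k) :
    (p.succAbove i : ℕ) = if (i : ℕ) < p then (i : ℕ) else i + 1 := by
  rcases lt_or_ge (i : ℕ) p with h | h
  · rw [if_pos h, Fin.succAbove_of_castSucc_lt _ _ (by simpa [Fin.lt_def] using h),
      Fin.val_castSucc]
  · rw [if_neg (not_lt.mpr h), Fin.succAbove_of_le_castSucc _ _ (by simpa [Fin.le_def] using h),
      Fin.val_succ]

lemma headHalf_succAbove (hmn : m ≤ n) (x : Fin (n + 2) → ℂ) (j : Fin (n + 1)) (j' : Fin (m + 1))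
    (hj : (j' : ℕ) = j) (c : Fin m) :
    headHalf (m + 1) l x (j'.succAbove c)
      = headHalf m l (fun q => x (j.succAbove q).castSucc) c := by
  have hv := val_succAbove j' c
  rw [headHalf_apply l x _ (by omega), headHalf_apply l _ c (by omega)]
  congr 1
  ext
  simp only [Fin.val_castSucc, val_succAbove, hj]

lemma tailHalf_succAbove (hmn : m ≤ n) (h : n ≤ 2 * m) (x : Fin (n + 2) → ℂ) (j : Fin (n + 1))
    (hj : (j : ℕ) ≤ m) (c : Fin m) :
    tailHalf (m + 1) l x ((lastPos h).succAbove c)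
      = tailHalf m l (fun q => x (j.succAbove q).castSucc) c := by
  have hv : ((lastPos h : Fin (m + 1)) : ℕ) = n - m := rfl
  have hs := val_succAbove (lastPos h) c
  rw [hv] at hs
  rcases lt_or_ge (c : ℕ) (n - m) with hc | hc
  · rw [if_pos hc] at hs
    rw [tailHalf_apply_lt l x _ (by omega), tailHalf_apply_lt l _ c (by omega)]
    congr 1
    ext
    have hq := val_succAbove j ⟨m + c, by omega⟩
    rw [if_neg (by simp only; omega)] at hq
    simp only [Fin.val_castSucc, hs, hq]
    omega
  · rw [if_neg (by omega)] at hs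
    rw [tailHalf_apply_ge l x _ (by omega), tailHalf_apply_ge l _ c (by omega), hs]
    congr 1
    omega

end

lemma prod_halves {m n : ℕ} (l : List ℂ) (h : 2 * m = n + l.length) (x : Fin n → ℂ) (F : ℂ → ℂ) :
    (∏ i, F (headHalf m l x i)) * (∏ i, F (tailHalf m l x i))
      = (∏ i, F (x i)) * (l.map F).prod := by
  have h1 : (∏ i, F (headHalf m l x i)) * (∏ i, F (tailHalf m l x i))
      = ∏ q : Fin (2 * m), F (extL x l q) := by
    rw [← (finCongr (two_mul m).symm).prod_comp, Fin.prod_univ_add]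
    rfl
  rw [h1, ← (finCongr h.symm).prod_comp, Fin.prod_univ_add]
  congr 1
  · refine Finset.prod_congr rfl fun i _ => ?_
    simp [extL]
  · rw [← Fin.prod_univ_fun_getElem]
    refine Finset.prod_congr rfl fun i _ => ?_
    simp [extL]

end

section

/-- The properties of the family `Ψ` that determine the scalar products. -/
structure PsiHyp (τ : ℂ) (Ψ : PsiFam) : Prop where
  im_pos : 0 < τ.im
  entire : PsiEntire Ψ
  p1 : PsiP1 τ Ψ
  p2 : PsiP2 τ Ψ
  p3 : PsiP3 τ Ψ
  p5 : PsiP5 τ Ψ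
  p6 : PsiP6 Ψ

/-- The Vandermonde-type denominator of the Tsuchiya determinant of the extended tuple. -/
def vdPair (τ : ℂ) (m : ℕ) (l : List ℂ) {n : ℕ} (x : Fin n → ℂ) : ℂ :=
  vdTheta τ (headHalf m l x) * vdTheta τ (tailHalf m l x)

/-- The numerator of the Tsuchiya determinant of the extended tuple. -/
def numPair (τ : ℂ) (m : ℕ) (l : List ℂ) {n : ℕ} (x : Fin n → ℂ) : ℂ :=
  tsuNum τ (headHalf m l x) (tailHalf m l x)

/-- The difference of the two sides of the formula for the scalar product, with denominators
cleared. -/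
def defect (τ lam : ℂ) (Ψ : PsiFam) (m₁ m₂ : ℕ) (l₁ l₂ : List ℂ) (c : ℂ) {n : ℕ}
    (x : Fin n → ℂ) : ℂ :=
  Zfun τ lam Ψ n x * th4 0 (2 * τ) ^ n * (vdPair τ m₁ l₁ x * vdPair τ m₂ l₂ x)
    - (∏ i, prefac τ (x i)) * c * (numPair τ m₁ l₁ x * numPair τ m₂ l₂ x)

variable {τ lam c : ℂ} {Ψ : PsiFam} {m₁ m₂ n : ℕ} {l₁ l₂ : List ℂ}

lemma sepEntire_vdPair (hτ : 0 < τ.im) (m : ℕ) (l : List ℂ) :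
    SepEntire fun x : Fin n → ℂ => vdPair τ m l x :=
  (SepEntire.vdTheta hτ fun i => sepEntire_headHalf l i).mul
    (SepEntire.vdTheta hτ fun i => sepEntire_tailHalf l i)

lemma sepEntire_numPair (hτ : 0 < τ.im) (m : ℕ) (l : List ℂ) :
    SepEntire fun x : Fin n → ℂ => numPair τ m l x :=
  SepEntire.tsuNum hτ (fun i => sepEntire_headHalf l i) (fun i => sepEntire_tailHalf l i)

lemma differentiable_prefac (hτ : 0 < τ.im) : Differentiable ℂ (prefac τ) :=
  (QP_prefac hτ).diff

lemma sepEntire_defect (H : PsiHyp τ Ψ) :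
    SepEntire fun x : Fin n → ℂ => defect τ lam Ψ m₁ m₂ l₁ l₂ c x := by
  have hτ := H.im_pos
  refine SepEntire.sub (SepEntire.mul (SepEntire.mul ?_ (SepEntire.const _))
    ((sepEntire_vdPair hτ _ _).mul (sepEntire_vdPair hτ _ _)))
    (SepEntire.mul (SepEntire.mul (SepEntire.prod _ fun i _ =>
      (SepEntire.coord i).comp_entire (differentiable_prefac hτ)) (SepEntire.const _))
      ((sepEntire_numPair hτ _ _).mul (sepEntire_numPair hτ _ _)))
  exact fun x m => differentiable_Zfun hτ H.entire H.p3 lam x m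

lemma prefac_neg (z : ℂ) :
    th4 (2 * ηc + 2 * z) (2 * τ) * prefac τ (-z) = th4 (2 * ηc - 2 * z) (2 * τ) * prefac τ z := by
  unfold prefac
  rw [show 2 * (ηc + -z) = 2 * ηc - 2 * z by ring, show 2 * (ηc + z) = 2 * ηc + 2 * z by ring,
    show ηc - -z = ηc + z by ring, show ηc + -z = ηc - z by ring]
  ring

lemma extL_update_neg {k : ℕ} (l : List ℂ) (x : Fin n → ℂ) (i : Fin n) (q : Fin k) :
    (extL (Function.update x i (-x i)) l : Fin k → ℂ) q = (extL x l : Fin k → ℂ) q ∨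
      (extL (Function.update x i (-x i)) l : Fin k → ℂ) q = -(extL x l : Fin k → ℂ) q := by
  unfold extL
  by_cases h : (q : ℕ) < n
  · simp only [h, dif_pos]
    by_cases hq : (⟨q, h⟩ : Fin n) = i
    · subst hq; simp
    · simp [Function.update_of_ne hq]
  · simp [h]

lemma vdPair_neg (m : ℕ) (l : List ℂ) (x : Fin n → ℂ) (i : Fin n) :
    vdPair τ m l (Function.update x i (-x i)) = vdPair τ m l x := by
  exact congrArg₂ (· * ·) (vdTheta_congr_sign fun q => extL_update_neg l x i _)
    (vdTheta_congr_sign fun q => extL_update_neg l x i _)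

lemma numPair_neg (m : ℕ) (l : List ℂ) (x : Fin n → ℂ) (i : Fin n) :
    numPair τ m l (Function.update x i (-x i)) = numPair τ m l x := by
  exact tsuNum_congr_sign (fun q => extL_update_neg l x i _) fun q => extL_update_neg l x i _

lemma prod_update_eq {M : Type*} [CommMonoid M] (F : ℂ → M) (x : Fin n → ℂ) (i : Fin n) (z : ℂ) :
    ∏ q, F (Function.update x i z q) = F z * ∏ q ∈ Finset.univ.erase i, F (x q) := by
  rw [← Finset.mul_prod_erase _ _ (Finset.mem_univ i), Function.update_self]
  congr 1
  exact Finset.prod_congr rfl fun q hq => by rw [Function.update_of_ne (Finset.ne_of_mem_erase hq)]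

lemma defect_neg (H : PsiHyp τ Ψ) (x : Fin n → ℂ) (i : Fin n) :
    th4 (2 * ηc + 2 * x i) (2 * τ)
        * defect τ lam Ψ m₁ m₂ l₁ l₂ c (Function.update x i (-x i))
      = th4 (2 * ηc - 2 * x i) (2 * τ) * defect τ lam Ψ m₁ m₂ l₁ l₂ c x := by
  unfold defect
  rw [vdPair_neg, vdPair_neg, numPair_neg, numPair_neg, prod_update_eq,
    ← Finset.mul_prod_erase Finset.univ (fun q => prefac τ (x q)) (Finset.mem_univ i)]
  have hZ := Zfun_neg H.im_pos H.entire H.p1 H.p3 lam x i (x i)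
  rw [Function.update_eq_self] at hZ
  have hp := prefac_neg (τ := τ) (x i)
  linear_combination th4 0 (2 * τ) ^ n * (vdPair τ m₁ l₁ x * vdPair τ m₂ l₂ x) * hZ
    - (∏ q ∈ Finset.univ.erase i, prefac τ (x q)) * c
      * (numPair τ m₁ l₁ x * numPair τ m₂ l₂ x) * hp

lemma defect_eq_zero_of_neg (H : PsiHyp τ Ψ) (x : Fin n → ℂ) (i : Fin n)
    (hne : th4 (2 * ηc - 2 * x i) (2 * τ) ≠ 0)
    (h : defect τ lam Ψ m₁ m₂ l₁ l₂ c (Function.update x i (-x i)) = 0) :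
    defect τ lam Ψ m₁ m₂ l₁ l₂ c x = 0 := by
  have := defect_neg (lam := lam) (m₁ := m₁) (m₂ := m₂) (l₁ := l₁) (l₂ := l₂) (c := c) H x i
  rw [h, mul_zero] at this
  exact (mul_eq_zero.mp this.symm).resolve_left hne


lemma recCoef_eq (hτ : 0 < τ.im) (lam x : ℂ) :
    recCoef τ lam x * th4 0 (2 * τ) ^ 2
      = -(prefac τ x * prefac τ (2 * ηc - x) * (specFac τ x β2c * specFac τ x (ηc + lam))) := by
  have h1 := th1_two_mul hτ (x + ηc)
  have h2 := th1_two_mul hτ x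
  have h3 := th1_mul_th4_self hτ (2 * (x + ηc))
  have h4 := th1_mul_th4_self hτ (2 * x)
  have hb : specFac τ x β2c = th2 (x + ηc) τ * th2 x τ := by
    rw [specFac, th2_eq_th1, th2_eq_th1]
    congr 1
    · rw [show x - ηc - β2c = x + ηc + Real.pi / 2 - Real.pi - Real.pi by
        rw [β2c, ηc]; ring, th1_sub_pi, th1_sub_pi, neg_neg]
    · congr 1; rw [β2c]; ring
  have hl : specFac τ x (ηc + lam) = th1 (x - lam - 2 * ηc) τ * th1 (x + lam) τ := by
    rw [specFac]
    congr 2 <;> ring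
  have hq : prefac τ (2 * ηc - x) = th4 (2 * x) (2 * τ) * th1 x τ * th1 (x - ηc) τ := by
    rw [prefac]
    congr 1
    · congr 1
      · rw [← th4_neg, ← th4_add_pi, ← th4_add_pi]
        congr 1; rw [ηc]; ring
      · rw [← th1_pi_sub]; congr 1; rw [ηc]; ring
    · congr 1; ring
  have hp : prefac τ x = -(th4 (2 * (x + ηc)) (2 * τ) * th1 (x + ηc) τ * th1 (x - ηc) τ) := by
    rw [prefac, show ηc - x = -(x - ηc) by ring, th1_neg, add_comm ηc x]
    ring
  rw [hb, hl, hq, hp, recCoef, show 2 * x + 2 * ηc = 2 * (x + ηc) by ring]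
  set K := th1 (x + lam) τ * th1 (x - lam - 2 * ηc) τ * th1 (x - ηc) τ ^ 2
  linear_combination
    K * th4 0 (2 * τ) ^ 2 / 4 * (-(th1 (2 * x) τ * th2 0 τ) * h3
      - 2 * th1 (2 * (x + ηc)) (2 * τ) * th4 (2 * (x + ηc)) (2 * τ) * h4)
    + K * th4 (2 * (x + ηc)) (2 * τ) * th4 (2 * x) (2 * τ) * (th1 x τ * th2 x τ * h1
      + th1 (2 * (x + ηc)) (2 * τ) * th4 0 (2 * τ) * h2)

lemma numPair_recursion {m : ℕ} (l : List ℂ) (hmn : m ≤ n) (h : n ≤ 2 * m)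
    (hl : 2 * m = n + l.length) (x : Fin (n + 2) → ℂ) (j : Fin (n + 1)) (hj : (j : ℕ) ≤ m)
    (hx : x (Fin.last _) = 2 * ηc - x j.castSucc) :
    numPair τ (m + 1) l x * vdPair τ m l (fun q => x (j.succAbove q).castSucc)
      = (∏ q, specFac τ (x j.castSucc) (x (j.succAbove q).castSucc))
        * (l.map (specFac τ (x j.castSucc))).prod
        * numPair τ m l (fun q => x (j.succAbove q).castSucc) * vdPair τ (m + 1) l x := by
  set j' : Fin (m + 1) := ⟨j, by omega⟩ with hj'
  have ha : headHalf (m + 1) l x j' = x j.castSucc := by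
    rw [headHalf_apply l x j' (by simp only [hj']; omega)]
    rfl
  have hb := tailHalf_lastPos l hmn h x
  have key := tsuNum_recursion τ (headHalf (m + 1) l x) (tailHalf (m + 1) l x) j' (lastPos h)
    (by rw [hb, ha, hx])
  simp only [headHalf_succAbove l hmn x j j' rfl, tailHalf_succAbove l hmn h x j hj, ha] at key
  rw [prod_halves l hl] at key
  exact key

lemma defect_special (H : PsiHyp τ Ψ) (hm₁ : m₁ ≤ n) (hm₂ : m₂ ≤ n)
    (hl₁ : 2 * m₁ = n + l₁.length) (hl₂ : 2 * m₂ = n + l₂.length)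
    (hl : ∀ F : ℂ → ℂ, (l₁.map F).prod * (l₂.map F).prod = F β2c * F (ηc + lam))
    (x : Fin (n + 2) → ℂ) (j : Fin (n + 1)) (hj₁ : (j : ℕ) ≤ m₁) (hj₂ : (j : ℕ) ≤ m₂)
    (hx : x (Fin.last _) = 2 * ηc - x j.castSucc)
    (hV₁ : vdPair τ m₁ l₁ (fun q => x (j.succAbove q).castSucc) ≠ 0)
    (hV₂ : vdPair τ m₂ l₂ (fun q => x (j.succAbove q).castSucc) ≠ 0)
    (ih : defect τ lam Ψ m₁ m₂ l₁ l₂ c (fun q => x (j.succAbove q).castSucc) = 0) :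
    defect τ lam Ψ (m₁ + 1) (m₂ + 1) l₁ l₂ (-c) x = 0 := by
  have hZ := Zfun_recursion H.im_pos H.entire H.p1 H.p3 H.p5 lam x j hx
  have hN₁ := numPair_recursion (τ := τ) l₁ hm₁ (by omega) hl₁ x j hj₁ hx
  have hN₂ := numPair_recursion (τ := τ) l₂ hm₂ (by omega) hl₂ x j hj₂ hx
  have hrec := recCoef_eq H.im_pos lam (x j.castSucc)
  rw [← hl (specFac τ (x j.castSucc))] at hrec
  have hP : ∏ i, prefac τ (x i) = prefac τ (x j.castSucc) * prefac τ (2 * ηc - x j.castSucc)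
      * ∏ q, prefac τ (x (j.succAbove q).castSucc) := by
    rw [Fin.prod_univ_castSucc, Fin.prod_univ_succAbove _ j, hx]
    ring
  unfold defect at ih ⊢
  rw [hP, hZ]
  change recCoef τ lam (x j.castSucc)
    * (∏ q, specFac τ (x j.castSucc) (x (j.succAbove q).castSucc)) ^ 2 * _ * _ * _ - _ = 0
  set S := ∏ q, specFac τ (x j.castSucc) (x (j.succAbove q).castSucc)
  set L₁ := (l₁.map (specFac τ (x j.castSucc))).prod
  set L₂ := (l₂.map (specFac τ (x j.castSucc))).prod
  set x' : Fin n → ℂ := fun q => x (j.succAbove q).castSucc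
  set V₁ := vdPair τ (m₁ + 1) l₁ x
  set V₂ := vdPair τ (m₂ + 1) l₂ x
  set P' := ∏ q, prefac τ (x' q)
  refine (mul_eq_zero.mp (?_ : vdPair τ m₁ l₁ x' * vdPair τ m₂ l₂ x' * _ = 0)).resolve_left
    (mul_ne_zero hV₁ hV₂)
  set pp := prefac τ (x j.castSucc) * prefac τ (2 * ηc - x j.castSucc)
  rw [pow_add]
  linear_combination recCoef τ lam (x j.castSucc) * S ^ 2 * th4 0 (2 * τ) ^ 2 * V₁ * V₂ * ih
    + P' * c * S ^ 2 * numPair τ m₁ l₁ x' * numPair τ m₂ l₂ x' * V₁ * V₂ * hrec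
    + pp * P' * c * (numPair τ (m₂ + 1) l₂ x * vdPair τ m₂ l₂ x' * hN₁
      + S * L₁ * numPair τ m₁ l₁ x' * V₁ * hN₂)

end

section

/-- The sign attached to a truth value. -/
def sg (s : Bool) : ℂ := if s then 1 else -1

/-- No theta factor built from a constant in `S` and the coordinates of `x` vanishes. -/
structure ThetaGeneric (τ : ℂ) (S : List ℂ) {ι : Type*} (x : ι → ℂ) : Prop where
  one : ∀ A ∈ S, ∀ i s, th1 (A + sg s * x i) τ ≠ 0
  two : ∀ A ∈ S, ∀ i s, th1 (A + sg s * (2 * x i)) τ ≠ 0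
  pair : ∀ A ∈ S, ∀ i j, i ≠ j → ∀ s t, th1 (A + (sg s * x i + sg t * x j)) τ ≠ 0

variable {τ : ℂ} {S : List ℂ} {ι κ : Type*}

lemma sg_ne_zero (s : Bool) : sg s ≠ 0 := by cases s <;> simp [sg]

lemma ThetaGeneric.comp {x : ι → ℂ} (hx : ThetaGeneric τ S x) {f : κ → ι}
    (hf : Function.Injective f) : ThetaGeneric τ S (fun k => x (f k)) where
  one A hA i s := hx.one A hA (f i) s
  two A hA i s := hx.two A hA (f i) s
  pair A hA i j hij s t := hx.pair A hA (f i) (f j) (hf.ne hij) s t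

lemma generic_th1 [DecidableEq ι] (hτ : 0 < τ.im) {L : (ι → ℂ) → ℂ} (hL : SepEntire L) (i : ι)
    (a k : ℂ) (hk : k ≠ 0) (h : ∀ z, L (Function.update 0 i z) = a + k * z) :
    Generic fun x => th1 (L x) τ ≠ 0 := by
  refine Generic.comp_ne_zero (differentiable_th1 hτ) ⟨ηc, th1_eta_ne_zero hτ⟩ hL fun w =>
    ⟨Function.update 0 i ((w - a) / k), ?_⟩
  rw [h]
  field_simp
  ring

lemma generic_thetaGeneric [Fintype ι] [DecidableEq ι] (hτ : 0 < τ.im) (S : List ℂ) :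
    Generic fun x : ι → ℂ => ThetaGeneric τ S x := by
  have h1 : Generic fun x : ι → ℂ => ∀ A : {A // A ∈ S}, ∀ i s, th1 (A + sg s * x i) τ ≠ 0 :=
    Generic.forall_fintype fun A => Generic.forall_fintype fun i => Generic.forall_fintype fun s =>
      generic_th1 hτ ((SepEntire.const _).add ((SepEntire.const _).mul (SepEntire.coord i)))
        i A (sg s) (sg_ne_zero s) (by simp)
  have h2 : Generic fun x : ι → ℂ =>
      ∀ A : {A // A ∈ S}, ∀ i s, th1 (A + sg s * (2 * x i)) τ ≠ 0 :=
    Generic.forall_fintype fun A => Generic.forall_fintype fun i => Generic.forall_fintype fun s =>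
      generic_th1 hτ ((SepEntire.const _).add ((SepEntire.const _).mul
        ((SepEntire.const _).mul (SepEntire.coord i))))
        i A (sg s * 2) (mul_ne_zero (sg_ne_zero s) two_ne_zero)
        (by intro z; simp [mul_assoc])
  have h3 : Generic fun x : ι → ℂ => ∀ A : {A // A ∈ S}, ∀ i j, i ≠ j → ∀ s t,
      th1 (A + (sg s * x i + sg t * x j)) τ ≠ 0 :=
    Generic.forall_fintype fun A => Generic.forall_fintype fun i => Generic.forall_fintype fun j =>
      Generic.imp_const fun hij => Generic.forall_fintype fun s => Generic.forall_fintype fun t =>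
      generic_th1 hτ ((SepEntire.const _).add (((SepEntire.const _).mul (SepEntire.coord i)).add
        ((SepEntire.const _).mul (SepEntire.coord j))))
        i A (sg s) (sg_ne_zero s)
        (by intro z; simp [Function.update_of_ne hij.symm])
  exact ((h1.and h2).and h3).mono fun x hx =>
    ⟨fun A hA => hx.1.1 ⟨A, hA⟩, fun A hA => hx.1.2 ⟨A, hA⟩, fun A hA => hx.2 ⟨A, hA⟩⟩

lemma th4_ne_zero_of_th1 (hτ : 0 < τ.im) {z : ℂ} (h : th1 z τ ≠ 0) : th4 z (2 * τ) ≠ 0 := by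
  intro h0
  have := th1_mul_th4_self hτ z
  rw [h0, mul_zero, mul_zero] at this
  exact mul_ne_zero h (th2_zero_ne_zero hτ) this.symm

/-- The entries of the list are pairwise inequivalent up to sign. -/
def ListSeparated (τ : ℂ) (l : List ℂ) : Prop :=
  SignSeparated τ fun i : Fin l.length => l.getD i 0

lemma SignSeparated.comp {d e : ℕ} {B : Fin d → ℂ} (hB : SignSeparated τ B) {f : Fin e → Fin d}
    (hf : Function.Injective f) : SignSeparated τ (fun k => B (f k)) where
  sub _ _ hij := hB.sub _ _ (hf.ne hij)
  add _ _ hij := hB.add _ _ (hf.ne hij)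
  dbl _ := hB.dbl _

lemma SignSeparated.vdTheta_ne_zero {m : ℕ} {B : Fin m → ℂ} (hB : SignSeparated τ B) :
    vdTheta τ B ≠ 0 := by
  refine Finset.prod_ne_zero_iff.mpr fun i _ => Finset.prod_ne_zero_iff.mpr fun j _ => ?_
  split_ifs with h
  · exact mul_ne_zero (hB.sub _ _ h.ne') (hB.add _ _ h.ne')
  · exact one_ne_zero

lemma extL_cases {n k : ℕ} (x : Fin n → ℂ) (l : List ℂ) (hk : k = n + l.length) (q : Fin k) :
    (∃ i : Fin n, (extL x l : Fin k → ℂ) q = x i ∧ (i : ℕ) = q) ∨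
      ∃ i : Fin l.length, (extL x l : Fin k → ℂ) q = l.getD i 0 ∧ (q : ℕ) = n + i := by
  unfold extL
  by_cases h : (q : ℕ) < n
  · exact Or.inl ⟨⟨q, h⟩, by simp [h], rfl⟩
  · refine Or.inr ⟨⟨q - n, by omega⟩, by simp [h], ?_⟩
    simp only
    omega

lemma getD_mem (l : List ℂ) (i : Fin l.length) : l.getD i 0 ∈ l := by
  rw [List.getD_eq_getElem _ _ i.2]
  exact List.getElem_mem _

lemma signSeparated_extL {n k : ℕ} {x : Fin n → ℂ} {l : List ℂ} (hk : k = n + l.length)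
    (hx : ThetaGeneric τ S x) (hl : ListSeparated τ l) (h0 : (0 : ℂ) ∈ S)
    (hS : ∀ b ∈ l, b ∈ S ∧ -b ∈ S) : SignSeparated τ (extL x l : Fin k → ℂ) where
  sub i j hij := by
    rcases extL_cases x l hk i with ⟨a, ha, hi⟩ | ⟨a, ha, hi⟩ <;>
      rcases extL_cases x l hk j with ⟨b, hb, hj⟩ | ⟨b, hb, hj⟩ <;> rw [ha, hb]
    · have hab : a ≠ b := fun e => hij (Fin.ext (by rw [← hi, ← hj, e]))
      simpa [sg, sub_eq_add_neg] using hx.pair 0 h0 a b hab true false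
    · simpa [sg, sub_eq_add_neg, add_comm] using hx.one _ (hS _ (getD_mem l b)).2 a true
    · simpa [sg, sub_eq_add_neg, add_comm] using hx.one _ (hS _ (getD_mem l a)).1 b false
    · exact hl.sub a b fun e => hij (Fin.ext (by rw [hi, hj, e]))
  add i j hij := by
    rcases extL_cases x l hk i with ⟨a, ha, hi⟩ | ⟨a, ha, hi⟩ <;>
      rcases extL_cases x l hk j with ⟨b, hb, hj⟩ | ⟨b, hb, hj⟩ <;> rw [ha, hb]
    · have hab : a ≠ b := fun e => hij (Fin.ext (by rw [← hi, ← hj, e]))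
      simpa [sg] using hx.pair 0 h0 a b hab true true
    · simpa [sg, add_comm] using hx.one _ (hS _ (getD_mem l b)).1 a true
    · simpa [sg] using hx.one _ (hS _ (getD_mem l a)).1 b true
    · exact hl.add a b fun e => hij (Fin.ext (by rw [hi, hj, e]))
  dbl i := by
    rcases extL_cases x l hk i with ⟨a, ha, hi⟩ | ⟨a, ha, hi⟩ <;> rw [ha]
    · simpa [sg] using hx.two 0 h0 a true
    · exact hl.dbl a

lemma signSeparated_headHalf {n m : ℕ} {x : Fin n → ℂ} {l : List ℂ}
    (h : SignSeparated τ (extL x l : Fin (2 * m) → ℂ)) : SignSeparated τ (headHalf m l x) :=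
  h.comp (f := fun i : Fin m => (⟨i, by omega⟩ : Fin (2 * m))) fun i j hij => by
    simpa [Fin.ext_iff] using hij

lemma signSeparated_tailHalf {n m : ℕ} {x : Fin n → ℂ} {l : List ℂ}
    (h : SignSeparated τ (extL x l : Fin (2 * m) → ℂ)) : SignSeparated τ (tailHalf m l x) :=
  h.comp (f := fun i : Fin m => (⟨m + i, by omega⟩ : Fin (2 * m))) fun i j hij => by
    simpa [Fin.ext_iff] using hij

lemma vdPair_ne_zero {n m : ℕ} {x : Fin n → ℂ} {l : List ℂ} (hm : 2 * m = n + l.length)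
    (hx : ThetaGeneric τ S x) (hl : ListSeparated τ l) (h0 : (0 : ℂ) ∈ S)
    (hS : ∀ b ∈ l, b ∈ S ∧ -b ∈ S) : vdPair τ m l x ≠ 0 := by
  have h := signSeparated_extL hm hx hl h0 hS
  exact mul_ne_zero (signSeparated_headHalf h).vdTheta_ne_zero
    (signSeparated_tailHalf h).vdTheta_ne_zero

end

section

/-- The constants entering the genericity assumptions. -/
def stepConsts (τ lam : ℂ) : List ℂ :=
  [0, 2 * ηc, -(2 * ηc), 4 * ηc, -(4 * ηc), 6 * ηc]
    ++ [β2c, ηc + lam].flatMap (fun b => [b, -b, b + 2 * ηc, b - 2 * ηc])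
    ++ (List.ofFn (prefPt τ)).flatMap fun w => [w + 2 * ηc, w - 2 * ηc]

variable {τ lam c : ℂ} {Ψ : PsiFam} {k n : ℕ}

lemma mem_stepConsts_of_mem {b : ℂ} (hb : b ∈ [β2c, ηc + lam]) :
    b ∈ stepConsts τ lam ∧ -b ∈ stepConsts τ lam ∧ b + 2 * ηc ∈ stepConsts τ lam ∧
      b - 2 * ηc ∈ stepConsts τ lam := by
  refine ⟨?_, ?_, ?_, ?_⟩ <;>
  exact List.mem_append_left _ (List.mem_append_right _ (List.mem_flatMap.mpr ⟨b, hb, by simp⟩))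

lemma prefPt_mem_stepConsts (i : Fin 4) :
    prefPt τ i + 2 * ηc ∈ stepConsts τ lam ∧ prefPt τ i - 2 * ηc ∈ stepConsts τ lam := by
  refine ⟨?_, ?_⟩ <;>
  exact List.mem_append_right _ (List.mem_flatMap.mpr
    ⟨prefPt τ i, List.mem_ofFn.mpr ⟨i, rfl⟩, by simp⟩)

lemma eta_mem_stepConsts : ∀ A ∈ [0, 2 * ηc, -(2 * ηc), 4 * ηc, -(4 * ηc), 6 * ηc],
    A ∈ stepConsts τ lam :=
  fun _ hA => List.mem_append_left _ (List.mem_append_left _ hA)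

/-- The evaluation points: the special points of the recursion and the zeros of the prefactor. -/
def evalPt (τ : ℂ) (ξ : Fin k → ℂ) : (Fin k × Bool × Bool) ⊕ Fin 4 → ℂ
  | Sum.inl (j, s, t) => sg t * (2 * ηc - sg s * ξ j)
  | Sum.inr i => prefPt τ i

lemma sg_true : sg true = 1 := by simp [sg]

lemma sg_false : sg false = -1 := by simp [sg]

lemma evalPt_inl_inr {ξ : Fin k → ℂ} (hξ : ThetaGeneric τ (stepConsts τ lam) ξ)
    (a : Fin k × Bool × Bool) (i : Fin 4) :
    th1 (evalPt τ ξ (Sum.inr i) - evalPt τ ξ (Sum.inl a)) τ ≠ 0 := by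
  obtain ⟨j, s, t⟩ := a
  have h1 := hξ.one _ (prefPt_mem_stepConsts i).1 j
  have h2 := hξ.one _ (prefPt_mem_stepConsts i).2 j
  cases t
  · have := h1 !s
    convert this using 2
    cases s <;> simp only [evalPt, sg_true, sg_false, Bool.not_true, Bool.not_false] <;> ring
  · have := h2 s
    convert this using 2
    cases s <;> simp only [evalPt, sg_true, sg_false] <;> ring

lemma evalPt_inl_same (hτ : 0 < τ.im) {ξ : Fin k → ℂ}
    (hξ : ThetaGeneric τ (stepConsts τ lam) ξ) (j : Fin k) {s t s' t' : Bool}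
    (h : (s, t) ≠ (s', t')) :
    th1 (evalPt τ ξ (Sum.inl (j, s', t')) - evalPt τ ξ (Sum.inl (j, s, t))) τ ≠ 0 := by
  have hc : ∀ {w : ℂ}, w = 4 * ηc ∨ w = -(4 * ηc) → th1 w τ ≠ 0 := by
    have h4 : th1 (4 * ηc) τ ≠ 0 :=
      th1_rat_ne_zero hτ 4 3 (by rw [ηc]; push_cast; ring) (by norm_num)
    rintro w (rfl | rfl)
    · exact h4
    · rw [th1_neg]; exact neg_ne_zero.mpr h4
  have h2 : ∀ {w : ℂ}, ∀ A ∈ [0, 2 * ηc, -(2 * ηc), 4 * ηc, -(4 * ηc), 6 * ηc], ∀ u : Bool,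
      w = A + sg u * (2 * ξ j) → th1 w τ ≠ 0 := by
    rintro w A hA u rfl
    exact hξ.two A (eta_mem_stepConsts A hA) j u
  cases s <;> cases t <;> cases s' <;> cases t' <;>
    simp only [evalPt, sg_true, sg_false] <;>
    first
    | exact absurd rfl h
    | exact hc (Or.inl (by ring1))
    | exact hc (Or.inr (by ring1))
    | exact h2 0 (by simp) true (by rw [sg_true]; ring1)
    | exact h2 0 (by simp) false (by rw [sg_false]; ring1)
    | exact h2 (4 * ηc) (by simp) true (by rw [sg_true]; ring1)
    | exact h2 (4 * ηc) (by simp) false (by rw [sg_false]; ring1)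
    | exact h2 (-(4 * ηc)) (by simp) true (by rw [sg_true]; ring1)
    | exact h2 (-(4 * ηc)) (by simp) false (by rw [sg_false]; ring1)

lemma evalPt_inl_diff {ξ : Fin k → ℂ} (hξ : ThetaGeneric τ (stepConsts τ lam) ξ) {i j : Fin k}
    (hij : i ≠ j) (s t s' t' : Bool) :
    th1 (evalPt τ ξ (Sum.inl (j, s', t')) - evalPt τ ξ (Sum.inl (i, s, t))) τ ≠ 0 := by
  have hA : (sg t' - sg t) * (2 * ηc) ∈ stepConsts τ lam := by
    refine eta_mem_stepConsts _ ?_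
    cases t <;> cases t' <;> simp only [sg_true, sg_false] <;> norm_num <;> ring_nf <;> simp
  have := hξ.pair _ hA i j hij (s == t) (s' != t')
  convert this using 2
  cases s <;> cases t <;> cases s' <;> cases t' <;> simp [evalPt, sg] <;> ring

lemma evalPt_separated (hτ : 0 < τ.im) {ξ : Fin k → ℂ}
    (hξ : ThetaGeneric τ (stepConsts τ lam) ξ) (a b : (Fin k × Bool × Bool) ⊕ Fin 4)
    (hab : a ≠ b) : th1 (evalPt τ ξ b - evalPt τ ξ a) τ ≠ 0 := by
  rcases a with ⟨i, s, t⟩ | i <;> rcases b with ⟨j, s', t'⟩ | j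
  · by_cases hij : i = j
    · subst hij
      exact evalPt_inl_same hτ hξ i fun e => hab (by rw [e])
    · exact evalPt_inl_diff hξ hij s t s' t'
  · exact evalPt_inl_inr hξ _ _
  · exact th1_sub_ne_zero_comm (evalPt_inl_inr hξ _ _)
  · exact prefPt_sub_ne_zero hτ i j fun e => hab (by rw [e])

end

section

section

variable {τ lam c : ℂ} {Ψ : PsiFam} {m₁ m₂ n : ℕ} {l₁ l₂ : List ℂ}

lemma th1_sub_special_ne_zero {ι : Type*} {ξ : ι → ℂ}
    (hξ : ThetaGeneric τ (stepConsts τ lam) ξ) {j : ι} {B : ℂ}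
    (hB : (∃ i, i ≠ j ∧ B = ξ i) ∨ B ∈ [β2c, ηc + lam]) (s t : Bool) :
    th1 (B - sg t * (2 * ηc - sg s * ξ j)) τ ≠ 0 := by
  rcases hB with ⟨i, hij, rfl⟩ | hB
  · have hA : -(sg t * (2 * ηc)) ∈ stepConsts τ lam := by
      refine eta_mem_stepConsts _ ?_
      cases t <;> simp [sg]
    convert hξ.pair _ hA i j hij true (s == t) using 2
    cases s <;> cases t <;> simp [sg] <;> ring
  · have hA : B - sg t * (2 * ηc) ∈ stepConsts τ lam := by
      cases t
      · simpa [sg] using (mem_stepConsts_of_mem hB).2.2.1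
      · simpa [sg] using (mem_stepConsts_of_mem hB).2.2.2
    convert hξ.one _ hA j (s == t) using 2
    cases s <;> cases t <;> simp [sg] <;> ring

lemma pairProd_special_ne_zero {ι : Type*} {ξ : ι → ℂ}
    (hξ : ThetaGeneric τ (stepConsts τ lam) ξ) {j : ι} {d : ℕ} {B : Fin d → ℂ}
    (hB : ∀ l, (∃ i, i ≠ j ∧ B l = ξ i) ∨ B l ∈ [β2c, ηc + lam]) (s t : Bool) :
    pairProd τ B (sg t * (2 * ηc - sg s * ξ j)) ≠ 0 := by
  refine Finset.prod_ne_zero_iff.mpr fun l _ => mul_ne_zero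
    (th1_sub_special_ne_zero hξ (hB l) s t) ?_
  convert th1_sub_special_ne_zero hξ (hB l) s !t using 2
  cases t <;> simp [sg] <;> ring

lemma defect_eq_zero_of_special (H : PsiHyp τ Ψ) (x : Fin (n + 2) → ℂ) (j : Fin (n + 1))
    (s t : Bool) (hx : x (Fin.last _) = sg t * (2 * ηc - sg s * x j.castSucc))
    (hj4 : th4 (2 * ηc - 2 * x j.castSucc) (2 * τ) ≠ 0)
    (hlast : th4 (2 * ηc - 2 * x (Fin.last _)) (2 * τ) ≠ 0)
    (h : ∀ y : Fin (n + 2) → ℂ, y (Fin.last _) = 2 * ηc - y j.castSucc →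
      (fun q => y (j.succAbove q).castSucc) = (fun q => x (j.succAbove q).castSucc) →
      defect τ lam Ψ m₁ m₂ l₁ l₂ c y = 0) :
    defect τ lam Ψ m₁ m₂ l₁ l₂ c x = 0 := by
  have hpos : ∀ y : Fin (n + 2) → ℂ, y j.castSucc = x j.castSucc →
      (fun q => y (j.succAbove q).castSucc) = (fun q => x (j.succAbove q).castSucc) →
      y (Fin.last _) = 2 * ηc - sg s * y j.castSucc →
      defect τ lam Ψ m₁ m₂ l₁ l₂ c y = 0 := by
    intro y hy1 hy2 hy3
    cases s
    · refine defect_eq_zero_of_neg H y j.castSucc (by rwa [hy1]) (h _ ?_ ?_)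
      · rw [Function.update_self, Function.update_of_ne (Fin.castSucc_lt_last j).ne', hy3, sg_false]
        ring
      · rw [← hy2]
        funext q
        rw [Function.update_of_ne]
        exact fun h => Fin.succAbove_ne j q (Fin.castSucc_injective _ h)
    · rw [sg_true, one_mul] at hy3
      exact h y hy3 hy2
  cases t
  · refine defect_eq_zero_of_neg H x _ hlast (hpos _ ?_ (funext fun q => ?_) ?_)
    · rw [Function.update_of_ne (Fin.castSucc_lt_last j).ne]
    · rw [Function.update_of_ne (Fin.castSucc_lt_last _).ne]
    · rw [Function.update_self, Function.update_of_ne (Fin.castSucc_lt_last j).ne, hx, sg_false]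
      ring
  · exact hpos x rfl rfl (by rw [hx, sg_true, one_mul])

lemma th4_special_ne_zero (hτ : 0 < τ.im) {ι : Type*} {ξ : ι → ℂ}
    (hξ : ThetaGeneric τ (stepConsts τ lam) ξ) (j : ι) :
    th4 (2 * ηc - 2 * ξ j) (2 * τ) ≠ 0 ∧
    ∀ s t, th4 (2 * ηc - 2 * (sg t * (2 * ηc - sg s * ξ j))) (2 * τ) ≠ 0 := by
  refine ⟨th4_ne_zero_of_th1 hτ ?_, fun s t => th4_ne_zero_of_th1 hτ ?_⟩
  · convert hξ.two _ (eta_mem_stepConsts (2 * ηc) (by simp)) j false using 2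
    simp [sg]; ring
  · have hA : 2 * ηc - sg t * (4 * ηc) ∈ stepConsts τ lam := by
      refine eta_mem_stepConsts _ ?_
      cases t
      · simp only [sg_false, List.mem_cons]
        right; right; right; right; right; left; ring
      · simp only [sg_true, List.mem_cons]
        right; right; left; ring
    convert hξ.two _ hA j (s == t) using 2
    cases s <;> cases t <;> simp [sg] <;> ring

end

end

section

section

variable {τ lam c : ℂ} {Ψ : PsiFam} {m n : ℕ}

/-- The second half of the extended tuple, with the last coordinate of `x` removed. -/
def tailRest (l : List ℂ) (h : n ≤ 2 * m) (x : Fin (n + 2) → ℂ) : Fin m → ℂ :=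
  fun q => tailHalf (m + 1) l x ((lastPos h).succAbove q)

lemma vdPair_update (l : List ℂ) (hmn : m ≤ n) (h : n ≤ 2 * m) (x : Fin (n + 2) → ℂ) (z : ℂ) :
    vdPair τ (m + 1) l (Function.update x (Fin.last (n + 1)) z)
      = vdTheta τ (headHalf (m + 1) l x) * ((-1) ^ (lastPos h : ℕ) * vdTheta τ (tailRest l h x))
        * pairProd τ (tailRest l h x) z := by
  rw [vdPair, headHalf_update l hmn, tailHalf_update l hmn h, 
    vdTheta_expand τ (Function.update _ _ _) (lastPos h)]
  simp only [Function.update_self, Function.update_of_ne (Fin.succAbove_ne _ _)]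
  unfold pairProd tailRest
  ring

lemma numPair_update (l : List ℂ) (hmn : m ≤ n) (h : n ≤ 2 * m) (x : Fin (n + 2) → ℂ) (z : ℂ) :
    numPair τ (m + 1) l (Function.update x (Fin.last (n + 1)) z)
      = tsuNum τ (headHalf (m + 1) l x)
          (Function.update (tailHalf (m + 1) l x) (lastPos h) z) := by
  rw [numPair, headHalf_update l hmn, tailHalf_update l hmn h]

lemma tsuNum_tailRest (l : List ℂ) (h : n ≤ 2 * m) (x : Fin (n + 2) → ℂ) (a : Fin (m + 1) → ℂ)
    (q : Fin m) :
    tsuNum τ a (Function.update (tailHalf (m + 1) l x) (lastPos h) (tailRest l h x q)) = 0 ∧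
    tsuNum τ a (Function.update (tailHalf (m + 1) l x) (lastPos h) (-tailRest l h x q)) = 0 := by
  have hne := (Fin.succAbove_ne (lastPos h) q)
  constructor <;> refine tsuNum_eq_zero _ _ hne ?_ <;>
    rw [Function.update_self, Function.update_of_ne hne]
  · exact Or.inl rfl
  · exact Or.inr (neg_neg _).symm

lemma signSeparated_tailRest {l : List ℂ} (h : n ≤ 2 * m) {x : Fin (n + 2) → ℂ}
    (hx : SignSeparated τ (extL x l : Fin (2 * (m + 1)) → ℂ)) :
    SignSeparated τ (tailRest l h x) :=
  (signSeparated_tailHalf hx).comp (f := (lastPos h).succAbove) Fin.succAbove_right_injective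

lemma tailRest_cases {l : List ℂ} (hmn : m ≤ n) (h : n ≤ 2 * m) (hm : 2 * m = n + l.length)
    (x : Fin (n + 2) → ℂ) (j : Fin (n + 1)) (hj : (j : ℕ) ≤ m) (q : Fin m) :
    (∃ i, i ≠ j.castSucc ∧ tailRest l h x q = x i) ∨ tailRest l h x q ∈ l := by
  rw [tailRest, tailHalf_succAbove l hmn h x j hj, tailHalf, secondHalf]
  rcases extL_cases (fun q => x (j.succAbove q).castSucc) l hm _ with ⟨i, hi, -⟩ | ⟨i, hi, -⟩
  · exact Or.inl ⟨_, fun e => Fin.succAbove_ne j i (Fin.castSucc_injective _ e), hi⟩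
  · rw [hi]
    exact Or.inr (getD_mem l i)

end

section

variable {τ lam c : ℂ} {Ψ : PsiFam} {m₁ m₂ n : ℕ} {l₁ l₂ : List ℂ}

theorem defect_step (H : PsiHyp τ Ψ) (hm : m₁ + m₂ = n + 1) (hm₁ : m₁ ≤ m₂) (hm₂ : m₂ ≤ n)
    (hl₁ : 2 * m₁ = n + l₁.length) (hl₂ : 2 * m₂ = n + l₂.length)
    (hs₁ : l₁ ⊆ [β2c, ηc + lam]) (hs₂ : l₂ ⊆ [β2c, ηc + lam])
    (hl₁s : ListSeparated τ l₁) (hl₂s : ListSeparated τ l₂)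
    (hl : ∀ F : ℂ → ℂ, (l₁.map F).prod * (l₂.map F).prod = F β2c * F (ηc + lam))
    (ih : ∀ x : Fin n → ℂ, defect τ lam Ψ m₁ m₂ l₁ l₂ c x = 0) (x : Fin (n + 2) → ℂ) :
    defect τ lam Ψ (m₁ + 1) (m₂ + 1) l₁ l₂ (-c) x = 0 := by
  have hτ := H.im_pos
  refine Generic.eq_zero (generic_thetaGeneric hτ (stepConsts τ lam)) (sepEntire_defect H)
    (fun x hx => ?_) x
  have h0 : (0 : ℂ) ∈ stepConsts τ lam := eta_mem_stepConsts 0 (by simp)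
  have hS₁ : ∀ b ∈ l₁, b ∈ stepConsts τ lam ∧ -b ∈ stepConsts τ lam := fun b hb =>
    ⟨(mem_stepConsts_of_mem (hs₁ hb)).1, (mem_stepConsts_of_mem (hs₁ hb)).2.1⟩
  have hS₂ : ∀ b ∈ l₂, b ∈ stepConsts τ lam ∧ -b ∈ stepConsts τ lam := fun b hb =>
    ⟨(mem_stepConsts_of_mem (hs₂ hb)).1, (mem_stepConsts_of_mem (hs₂ hb)).2.1⟩
  have hn₁ : n ≤ 2 * m₁ := by omega
  have hn₂ : n ≤ 2 * m₂ := by omega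
  have hsep₁ : SignSeparated τ (extL x l₁ : Fin (2 * (m₁ + 1)) → ℂ) :=
    signSeparated_extL (by omega) hx hl₁s h0 hS₁
  have hsep₂ : SignSeparated τ (extL x l₂ : Fin (2 * (m₂ + 1)) → ℂ) :=
    signSeparated_extL (by omega) hx hl₂s h0 hS₂
  set K : ℂ := th4 0 (2 * τ) ^ (n + 2) *
    ((vdTheta τ (headHalf (m₁ + 1) l₁ x)
        * ((-1) ^ (lastPos hn₁ : ℕ) * vdTheta τ (tailRest l₁ hn₁ x)))
      * (vdTheta τ (headHalf (m₂ + 1) l₂ x)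
        * ((-1) ^ (lastPos hn₂ : ℕ) * vdTheta τ (tailRest l₂ hn₂ x)))) with hK
  set L : ℂ := (∏ q ∈ Finset.univ.erase (Fin.last (n + 1)), prefac τ (x q)) * (-c) with hL
  set κ : ℂ := -((pnome τ) ^ 4)⁻¹ * cexp (2 * I * ηc) with hκ
  have hdef : ∀ z, defect τ lam Ψ (m₁ + 1) (m₂ + 1) l₁ l₂ (-c)
      (Function.update x (Fin.last (n + 1)) z)
      = (K * Zfun τ lam Ψ (n + 2) (Function.update x (Fin.last (n + 1)) z))
          * pairProd τ (tailRest l₁ hn₁ x) z * pairProd τ (tailRest l₂ hn₂ x) z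
        - (L * prefac τ z)
          * tsuNum τ (headHalf (m₁ + 1) l₁ x)
            (Function.update (tailHalf (m₁ + 1) l₁ x) (lastPos hn₁) z)
          * tsuNum τ (headHalf (m₂ + 1) l₂ x)
            (Function.update (tailHalf (m₂ + 1) l₂ x) (lastPos hn₂) z) := by
    intro z
    rw [defect, vdPair_update l₁ (by omega) hn₁, vdPair_update l₂ (by omega) hn₂,
      numPair_update l₁ (by omega) hn₁, numPair_update l₂ (by omega) hn₂, prod_update_eq, hK, hL]
    ring
  have hQ := eq_of_points hτ (κ := κ) (by simp [hκ, pnome_ne_zero τ])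
    (f := fun z => K * Zfun τ lam Ψ (n + 2) (Function.update x (Fin.last (n + 1)) z))
    (q := fun z => L * prefac τ z)
    (((QP_Zfun hτ H.entire H.p2 H.p3 lam x (Fin.last (n + 1))).const_mul K).congr'
      (by omega) rfl ?_)
    ((QP_prefac hτ).const_mul L)
    (QP_tsuNum hτ (headHalf (m₁ + 1) l₁ x) (tailHalf (m₁ + 1) l₁ x) (lastPos hn₁))
    (QP_tsuNum hτ (headHalf (m₂ + 1) l₂ x) (tailHalf (m₂ + 1) l₂ x) (lastPos hn₂))
    (tailRest l₁ hn₁ x) (tailRest l₂ hn₂ x)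
    (signSeparated_tailRest hn₁ hsep₁) (signSeparated_tailRest hn₂ hsep₂)
    (tsuNum_tailRest l₁ hn₁ x _) (tsuNum_tailRest l₂ hn₂ x _)
    (evalPt τ fun j : Fin (m₁ + 1) => x ⟨j, by omega⟩)
    (by simp only [Fintype.card_sum, Fintype.card_prod, Fintype.card_fin, Fintype.card_bool]; omega)
    (evalPt_separated (lam := lam) hτ (hx.comp (f := fun j : Fin (m₁ + 1) =>
      (⟨j, by omega⟩ : Fin (n + 2))) fun i j hij => by simpa [Fin.ext_iff] using hij))
    ?_ (x (Fin.last _))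
  · have := hdef (x (Fin.last _))
    rw [Function.update_eq_self] at this
    rw [this, sub_eq_zero]
    simpa only [Function.update_eq_self] using hQ
  · rw [hκ, show 2 * (n + 2) + 2 = 4 + (2 * m₁ + 2 * m₂) by omega, pow_add, mul_inv]
    ring
  · rintro (⟨j, s, t⟩ | i)
    · right
      set J : Fin (n + 1) := ⟨j, by omega⟩ with hJ
      have hJ₁ : (J : ℕ) ≤ m₁ := by simp only [hJ]; omega
      have hpt : evalPt τ (fun j : Fin (m₁ + 1) => x ⟨j, by omega⟩) (Sum.inl (j, s, t))
          = sg t * (2 * ηc - sg s * x J.castSucc) := rfl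
      rw [hpt]
      refine ⟨pairProd_special_ne_zero hx (fun q => ?_) s t,
        pairProd_special_ne_zero hx (fun q => ?_) s t, ?_⟩
      · exact (tailRest_cases (by omega) hn₁ hl₁ x J hJ₁ q).imp_right fun h => hs₁ h
      · exact (tailRest_cases (by omega) hn₂ hl₂ x J (by omega) q).imp_right fun h => hs₂ h
      · rw [← sub_eq_zero, ← hdef]
        have hJl : ∀ z, Function.update x (Fin.last (n + 1)) z J.castSucc = x J.castSucc :=
          fun z => Function.update_of_ne (Fin.castSucc_lt_last J).ne _ _
        have e : ∀ z, (fun q => Function.update x (Fin.last (n + 1)) z (J.succAbove q).castSucc)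
            = fun q => x (J.succAbove q).castSucc := fun z => funext fun q =>
          Function.update_of_ne (Fin.castSucc_lt_last _).ne _ _
        have hx' : ThetaGeneric τ (stepConsts τ lam) fun q => x (J.succAbove q).castSucc :=
          hx.comp (f := fun q => (J.succAbove q).castSucc) fun i j hij =>
            Fin.succAbove_right_injective (Fin.castSucc_injective _ hij)
        obtain ⟨h4, h4'⟩ := th4_special_ne_zero hτ hx J.castSucc
        refine defect_eq_zero_of_special H _ J s t ?_ ?_ ?_ fun y hy1 hy2 =>
          defect_special H (by omega) (by omega) hl₁ hl₂ hl y J hJ₁ (by omega) hy1 ?_ ?_ (ih _)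
        · rw [Function.update_self, hJl]
        · rwa [hJl]
        · rw [Function.update_self]; exact h4' s t
        · rw [hy2, e]; exact vdPair_ne_zero hl₁ hx' hl₁s h0 hS₁
        · rw [hy2, e]; exact vdPair_ne_zero hl₂ hx' hl₂s h0 hS₂
    · left
      have hpt : evalPt τ (fun j : Fin (m₁ + 1) => x ⟨j, by omega⟩) (Sum.inr i) = prefPt τ i := rfl
      rw [hpt, prefac_prefPt, Zfun_prefPt hτ H.entire H.p1 H.p2 H.p3 H.p5 lam _ (Fin.last (n + 1)) i
        (Function.update_self ..)]
      simp

end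

end

section

section

variable {τ : ℂ}

/-- The product `ϑ₁(a - b) ϑ₁(a + b)`. -/
def thPair (τ a b : ℂ) : ℂ := th1 (a - b) τ * th1 (a + b) τ

lemma thPair_swap (a b : ℂ) : thPair τ a b = -thPair τ b a := by
  rw [thPair, thPair, show a - b = -(b - a) by ring, th1_neg, add_comm]
  ring

lemma thPair_neg_left (a b : ℂ) : thPair τ (-a) b = thPair τ a b := by
  rw [thPair, thPair, show -a - b = -(a + b) by ring, show -a + b = -(a - b) by ring, th1_neg,
    th1_neg]
  ring

lemma thPair_self (a : ℂ) : thPair τ a a = 0 := by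
  rw [thPair, sub_self, th1_zero, zero_mul]

lemma QP_thPair (hτ : 0 < τ.im) (b : ℂ) :
    QP τ 2 1 ((pnome τ ^ 2)⁻¹) (fun z => thPair τ z b) := by
  have h := (QP_th1_sub hτ b).mul (QP_th1_sub hτ (-b))
  simp only [sub_neg_eq_add] at h
  refine h.congr' rfl (by norm_num) ?_
  have e : cexp (2 * I * b) * cexp (2 * I * -b) = 1 := by
    rw [← Complex.exp_add, ← Complex.exp_zero]; congr 1; ring
  rw [sq, mul_inv]
  linear_combination (pnome τ)⁻¹ * (pnome τ)⁻¹ * e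

/-- Weierstrass' three-term identity. -/
theorem thPair_three_term (hτ : 0 < τ.im) (u v a b : ℂ) :
    thPair τ u a * thPair τ v b - thPair τ v a * thPair τ u b = thPair τ u v * thPair τ a b := by
  have hd : ∀ w, Differentiable ℂ fun z => thPair τ z w := fun w => (QP_thPair hτ w).diff
  have hd' : ∀ w, Differentiable ℂ fun z => thPair τ w z := fun w => by
    simp only [thPair_swap w]
    exact (hd w).neg
  have ht := differentiable_th1 hτ
  have ht2 : Differentiable ℂ fun z => th1 (2 * z) τ := ht.comp (differentiable_id.const_mul 2)
  refine entire_eq_of_mul_eq (k := fun z => th1 (2 * z) τ * thPair τ z b)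
    (f := fun z => thPair τ u z * thPair τ v b - thPair τ v z * thPair τ u b)
    (g := fun z => thPair τ u v * thPair τ z b) (ht2.mul (hd b)) ?_
    (((hd' u).mul_const _).sub ((hd' v).mul_const _)) ((hd b).const_mul _) (fun z => ?_) a
  · refine exists_mul_ne_zero ht2 (hd b) ⟨ηc / 2, ?_⟩ (exists_mul_ne_zero
      (ht.comp (differentiable_id.sub_const b)) (ht.comp (differentiable_id.add_const b))
      (exists_th1_sub_ne_zero hτ b) ?_)
    · rw [mul_div_cancel₀ _ two_ne_zero]; exact th1_eta_ne_zero hτ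
    · obtain ⟨w, hw⟩ := exists_th1_sub_ne_zero hτ (-b)
      exact ⟨w, by simpa using hw⟩
  · by_cases hk : th1 (2 * z) τ * thPair τ z b = 0
    · simp only [hk, zero_mul]
    congr 1
    obtain ⟨h2, h3⟩ := mul_ne_zero_iff.mp hk
    obtain ⟨h3, h4⟩ := mul_ne_zero_iff.mp h3
    have hQ := (((QP_thPair hτ z).const_mul (thPair τ v b)).sub
      ((QP_thPair hτ b).const_mul (thPair τ v z))).sub
      ((QP_thPair hτ v).const_mul (thPair τ z b))
    have := hQ.eq_zero_of_zeros hτ (by simp) (by simp [pnome_ne_zero]) [-z, z, b] (by simp)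
      ?_ ?_ u
    · linear_combination this
    · simp only [List.pairwise_cons, List.mem_cons, List.not_mem_nil, or_false, forall_eq_or_imp,
        forall_eq, IsEmpty.forall_iff, implies_true, List.Pairwise.nil, and_true, sub_neg_eq_add]
      refine ⟨⟨by rwa [← two_mul], by rwa [add_comm]⟩, th1_sub_ne_zero_comm h3⟩
    · simp only [List.mem_cons, List.not_mem_nil, or_false, forall_eq_or_imp, forall_eq,
        thPair_neg_left, thPair_self]
      refine ⟨?_, ?_, ?_⟩
      · rw [thPair_swap z v]; ring
      · rw [thPair_swap z v]; ring
      · rw [thPair_swap b z, thPair_swap b v]; ring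

lemma hh_swap (x y : ℂ) : hh τ x y = hh τ y x := by
  rw [hh, hh, show x - y + ηc = -(y - x - ηc) by ring, show x - y - ηc = -(y - x + ηc) by ring,
    th1_neg, th1_neg, add_comm x y]
  ring

lemma hh_special_left_eq (x b : ℂ) :
    hh τ x b = -specFac τ x b * thPair τ b (2 * ηc - x) := hh_special_left τ x b

lemma specFac_reflect (x b : ℂ) : specFac τ (2 * ηc - x) b = specFac τ x b := by
  rw [specFac, specFac, show 2 * ηc - x - ηc - b = -(x - ηc + b) by ring,
    show 2 * ηc - x - ηc + b = -(x - ηc - b) by ring, th1_neg, th1_neg]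
  ring

/-- The two-by-two Tsuchiya numerator at the special point. -/
lemma hh_det_special (hτ : 0 < τ.im) (x u v : ℂ) :
    hh τ (2 * ηc - x) u * hh τ x v - hh τ (2 * ηc - x) v * hh τ x u
      = specFac τ x u * specFac τ x v * (thPair τ u v * thPair τ x (2 * ηc - x)) := by
  rw [hh_special_left_eq, hh_special_left_eq x v, hh_special_left_eq (2 * ηc - x) v,
    hh_special_left_eq x u, specFac_reflect, specFac_reflect,
    show 2 * ηc - (2 * ηc - x) = x by ring, ← thPair_three_term hτ]
  ring

end

section

variable {τ lam : ℂ} {Ψ : PsiFam} {n : ℕ}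

lemma vdPair_zero (l : List ℂ) (x : Fin n → ℂ) : vdPair τ 0 l x = 1 := by
  simp [vdPair, vdTheta]

lemma numPair_zero (l : List ℂ) (x : Fin n → ℂ) : numPair τ 0 l x = 1 := by
  simp [numPair, tsuNum]

lemma vdPair_one (l : List ℂ) (x : Fin n → ℂ) : vdPair τ 1 l x = 1 := by
  simp [vdPair, vdTheta]

lemma numPair_one (l : List ℂ) (x : Fin n → ℂ) : numPair τ 1 l x = 1 := by
  simp [numPair, tsuNum]

lemma vdPair_two (u v : ℂ) (x : Fin 2 → ℂ) :
    vdPair τ 2 [u, v] x = thPair τ (x 1) (x 0) * thPair τ v u := by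
  simp [vdPair, vdTheta, headHalf, tailHalf, firstHalf, secondHalf, extL, Fin.prod_univ_two, thPair]

lemma numPair_two (u v : ℂ) (x : Fin 2 → ℂ) :
    numPair τ 2 [u, v] x = hh τ (x 1) u * hh τ (x 0) v - hh τ (x 1) v * hh τ (x 0) u := by
  have h0 : (Finset.univ.erase 0 : Finset (Fin 2)) = {1} := by decide
  have h1 : (Finset.univ.erase 1 : Finset (Fin 2)) = {0} := by decide
  simp [numPair, tsuNum, headHalf, tailHalf, firstHalf, secondHalf, extL, Matrix.det_fin_two, h0, h1]

theorem defect_zero_pairs (H : PsiHyp τ Ψ) (x : Fin 0 → ℂ) :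
    defect τ lam Ψ 0 1 [] [β2c, ηc + lam] 1 x = 0 := by
  rw [defect, Zfun_zero_pairs H.p6, vdPair_zero, vdPair_one, numPair_zero, numPair_one]
  simp

theorem defect_one_pair (H : PsiHyp τ Ψ) (x : Fin 1 → ℂ) :
    defect τ lam Ψ 1 1 [β2c] [ηc + lam] (th2 (ηc + lam) τ) x = 0 := by
  have h := Zfun_one_pair H.im_pos H.entire H.p1 H.p2 H.p3 H.p5 H.p6 lam x
  rw [defect, vdPair_one, vdPair_one, numPair_one, numPair_one, Fin.prod_univ_one]
  linear_combination h

lemma defect_two_special (H : PsiHyp τ Ψ) (x : Fin 2 → ℂ) (hx : x 1 = 2 * ηc - x 0) :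
    defect τ lam Ψ 1 2 [] [β2c, ηc + lam] (-1) x = 0 := by
  have hZ := Zfun_recursion (n := 0) H.im_pos H.entire H.p1 H.p3 H.p5 lam x 0 hx
  rw [Zfun_zero_pairs H.p6] at hZ
  simp only [Finset.univ_eq_empty, Finset.prod_empty, one_pow, mul_one] at hZ
  have h0 : x (Fin.castSucc 0) = x 0 := rfl
  rw [h0] at hZ
  have hr := recCoef_eq H.im_pos lam (x 0)
  rw [defect, vdPair_one, vdPair_two, numPair_one, numPair_two, Fin.prod_univ_two, hx,
    hh_det_special H.im_pos, thPair_swap (2 * ηc - x 0), thPair_swap (ηc + lam)]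
  rw [show Zfun τ lam Ψ 2 x = recCoef τ lam (x 0) from hZ]
  linear_combination thPair τ (x 0) (2 * ηc - x 0) * thPair τ β2c (ηc + lam) * hr

theorem defect_two_pairs (H : PsiHyp τ Ψ) (x : Fin 2 → ℂ) :
    defect τ lam Ψ 1 2 [] [β2c, ηc + lam] (-1) x = 0 := by
  have hτ := H.im_pos
  refine Generic.eq_zero (generic_thetaGeneric hτ (stepConsts τ lam)) (sepEntire_defect H)
    (fun x hx => ?_) x
  have h0 : (0 : ℂ) ∈ stepConsts τ lam := eta_mem_stepConsts 0 (by simp)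
  set K : ℂ := -(th4 0 (2 * τ) ^ 2 * thPair τ (ηc + lam) β2c) with hK
  set L : ℂ := -prefac τ (x 0) with hL
  set κ : ℂ := -((pnome τ) ^ 4)⁻¹ * cexp (2 * I * ηc) with hκ
  set P : ℂ → ℂ := fun z => hh τ z β2c * hh τ (x 0) (ηc + lam)
    - hh τ z (ηc + lam) * hh τ (x 0) β2c with hP
  have hPQ : QP τ 4 1 ((pnome τ ^ 4)⁻¹) P := by
    have := ((QP_hh hτ β2c).const_mul (hh τ (x 0) (ηc + lam))).sub
      ((QP_hh hτ (ηc + lam)).const_mul (hh τ (x 0) β2c))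
    convert this using 2 with z
    simp only [hP, hh_swap z]
    ring
  have hdef : ∀ z, defect τ lam Ψ 1 2 [] [β2c, ηc + lam] (-1) (Function.update x 1 z)
      = (K * Zfun τ lam Ψ 2 (Function.update x 1 z)) * pairProd τ (Fin.elim0 : Fin 0 → ℂ) z
          * pairProd τ (fun _ : Fin 1 => x 0) z - (L * prefac τ z) * 1 * P z := by
    intro z
    have e0 : Function.update x 1 z 0 = x 0 := Function.update_of_ne (by decide) _ _
    have e1 : Function.update x 1 z 1 = z := Function.update_self ..
    rw [defect, vdPair_one, vdPair_two, numPair_one, numPair_two, Fin.prod_univ_two, e0, e1,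
      thPair_swap z]
    simp only [pairProd, Finset.univ_eq_empty, Finset.prod_empty, Fin.prod_univ_one, hK, hL, hP,
      thPair]
    ring
  have hQ := eq_of_points hτ (κ := κ) (by simp [hκ, pnome_ne_zero τ])
    (f := fun z => K * Zfun τ lam Ψ 2 (Function.update x 1 z))
    (q := fun z => L * prefac τ z) (P₁ := fun _ => 1) (P₂ := P)
    (((QP_Zfun hτ H.entire H.p2 H.p3 lam x 1).const_mul K).congr' (by norm_num) rfl ?_)
    ((QP_prefac hτ).const_mul L)
    (QP.one.congr' (by norm_num) rfl (by simp)) hPQ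
    (Fin.elim0 : Fin 0 → ℂ) (fun _ : Fin 1 => x 0)
    ⟨fun i => i.elim0, fun i => i.elim0, fun i => i.elim0⟩
    ⟨fun i j hij => absurd (Subsingleton.elim i j) hij,
      fun i j hij => absurd (Subsingleton.elim i j) hij,
      fun _ => by simpa [sg] using hx.two 0 h0 0 true⟩
    (fun l => l.elim0)
    (fun _ => ⟨by simp only [hP]; ring, by simp only [hP, hh_neg_left]; ring⟩)
    (evalPt τ fun _ : Fin 1 => x 0)
    (by simp)
    (evalPt_separated (lam := lam) hτ (hx.comp (f := fun _ : Fin 1 => (0 : Fin 2))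
      fun i j _ => Subsingleton.elim i j))
    ?_ (x 1)
  · have := hdef (x 1)
    rw [Function.update_eq_self] at this
    rw [this, sub_eq_zero]
    simpa only [Function.update_eq_self] using hQ
  · rw [hκ, show 2 * 2 + 2 = 4 + (2 * 0 + 2 * 1) by norm_num, pow_add, mul_inv]
    ring
  · rintro (⟨j, s, t⟩ | i)
    · right
      have hpt : evalPt τ (fun _ : Fin 1 => x 0) (Sum.inl (j, s, t))
          = sg t * (2 * ηc - sg s * x 0) := rfl
      rw [hpt]
      refine ⟨by simp [pairProd], ?_, ?_⟩
      · have h2 : th1 (2 * ηc) τ ≠ 0 := by rw [th1_two_eta]; exact th1_eta_ne_zero hτ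
        have h4 : ∀ t, th1 (x 0 - sg t * (2 * ηc - sg s * x 0)) τ ≠ 0 := fun t => by
          cases s <;> cases t
          · convert hx.two _ (eta_mem_stepConsts (2 * ηc) (by simp)) 0 true using 2
            simp [sg]; ring
          · convert neg_ne_zero.mpr h2 using 1
            rw [← th1_neg]; congr 1; simp [sg]
          · convert h2 using 2
            simp [sg]
          · convert hx.two _ (eta_mem_stepConsts (-(2 * ηc)) (by simp)) 0 true using 2
            simp [sg]; ring
        rw [pairProd, Fin.prod_univ_one]
        refine mul_ne_zero (h4 t) ?_
        convert h4 (!t) using 2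
        cases t <;> simp [sg] <;> ring
      · rw [← sub_eq_zero, ← hdef]
        obtain ⟨h4, h4'⟩ := th4_special_ne_zero hτ hx 0
        have e0 : ∀ z, Function.update x 1 z 0 = x 0 := fun z =>
          Function.update_of_ne (by decide) _ _
        refine defect_eq_zero_of_special (n := 0) H _ 0 s t ?_ ?_ ?_ fun y hy1 _ =>
          defect_two_special H y hy1
        · exact (Function.update_self ..).trans (by
            rw [show (Fin.castSucc 0 : Fin 2) = 0 from rfl, e0])
        · exact (e0 _).symm ▸ h4
        · have : Function.update x 1 (sg t * (2 * ηc - sg s * x 0)) 1 = _ := Function.update_self ..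
          exact this.symm ▸ h4' s t
    · left
      have hpt : evalPt τ (fun _ : Fin 1 => x 0) (Sum.inr i) = prefPt τ i := rfl
      rw [hpt, prefac_prefPt, Zfun_prefPt hτ H.entire H.p1 H.p2 H.p3 H.p5 lam _ 1 i
        (Function.update_self ..)]
      simp

end

end

section

section

variable {τ lam : ℂ} {Ψ : PsiFam}

lemma listSeparated_nil : ListSeparated τ [] :=
  ⟨fun i => i.elim0, fun i => i.elim0, fun i => i.elim0⟩

lemma listSeparated_singleton {b : ℂ} (hb : th1 (2 * b) τ ≠ 0) : ListSeparated τ [b] where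
  sub i j hij := absurd (Subsingleton.elim (α := Fin 1) i j) hij
  add i j hij := absurd (Subsingleton.elim (α := Fin 1) i j) hij
  dbl i := by simpa [Subsingleton.elim (α := Fin 1) i 0] using hb

lemma listSeparated_pair {a b : ℂ} (ha : th1 (2 * a) τ ≠ 0) (hb : th1 (2 * b) τ ≠ 0)
    (hs : th1 (a - b) τ ≠ 0) (ht : th1 (a + b) τ ≠ 0) : ListSeparated τ [a, b] where
  sub := by
    have hs' := th1_sub_ne_zero_comm hs
    change ∀ i j : Fin 2, _
    simpa [Fin.forall_fin_two] using ⟨hs, hs'⟩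
  add := by
    change ∀ i j : Fin 2, _
    simpa [Fin.forall_fin_two, add_comm b a] using ht
  dbl := by
    change ∀ i : Fin 2, _
    simpa [Fin.forall_fin_two] using ⟨ha, hb⟩

lemma th1_two_beta_ne_zero (hτ : 0 < τ.im) : th1 (2 * β2c) τ ≠ 0 :=
  th1_rat_ne_zero hτ 5 3 (by rw [β2c, ηc]; push_cast; ring) (by norm_num)

/-- The parameter `λ` is generic: the boundary arguments are separated. -/
structure LamGeneric (τ lam : ℂ) : Prop where
  dbl : th1 (2 * (ηc + lam)) τ ≠ 0
  sub : th1 (β2c - (ηc + lam)) τ ≠ 0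
  add : th1 (β2c + (ηc + lam)) τ ≠ 0

theorem defect_even_of_generic (H : PsiHyp τ Ψ) (hlam : LamGeneric τ lam) (k : ℕ)
    (x : Fin (2 * k) → ℂ) :
    defect τ lam Ψ k (k + 1) [] [β2c, ηc + lam] ((-1) ^ k) x = 0 := by
  induction k with
  | zero => simpa using defect_zero_pairs H x
  | succ k ih =>
    rcases Nat.eq_zero_or_pos k with rfl | hk
    · simpa using defect_two_pairs H x
    · rw [pow_succ, mul_neg_one]
      exact defect_step (n := 2 * k) H (by omega) (by omega) (by omega) (by simp)
        (by simp; ring) (by simp) (by simp) listSeparated_nil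
        (listSeparated_pair (th1_two_beta_ne_zero H.im_pos) hlam.dbl hlam.sub hlam.add)
        (by simp) ih x

theorem defect_odd_of_generic (H : PsiHyp τ Ψ) (hlam : LamGeneric τ lam) (k : ℕ)
    (x : Fin (2 * k + 1) → ℂ) :
    defect τ lam Ψ (k + 1) (k + 1) [β2c] [ηc + lam] ((-1) ^ k * th2 (ηc + lam) τ) x = 0 := by
  induction k with
  | zero => simpa using defect_one_pair H x
  | succ k ih =>
    rw [pow_succ, mul_neg_one, neg_mul]
    exact defect_step (n := 2 * k + 1) H (by omega) (by omega) (by omega) (by simp; ring)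
      (by simp; ring) (by simp) (by simp)
      (listSeparated_singleton (th1_two_beta_ne_zero H.im_pos))
      (listSeparated_singleton hlam.dbl) (by simp) ih x

lemma generic_lamGeneric (hτ : 0 < τ.im) :
    Generic fun w : Fin 1 → ℂ => LamGeneric τ (w 0) := by
  have hc := SepEntire.coord (0 : Fin 1)
  have hv := (SepEntire.const (ι := Fin 1) ηc).add hc
  have h1 := generic_th1 hτ ((SepEntire.const 2).mul hv) 0 (2 * ηc) 2 two_ne_zero
    (fun z => by simp; ring)
  have h2 := generic_th1 hτ ((SepEntire.const β2c).sub hv) 0 (β2c - ηc) (-1) (by norm_num)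
    (fun z => by simp; ring)
  have h3 := generic_th1 hτ ((SepEntire.const β2c).add hv) 0 (β2c + ηc) 1 one_ne_zero
    (fun z => by simp; ring)
  exact ((h1.and h2).and h3).mono fun w hw => ⟨hw.1.1, hw.1.2, hw.2⟩

lemma sepEntire_extL_list {ι : Type*} [DecidableEq ι] {n k : ℕ} (x : Fin n → ℂ)
    {l : (ι → ℂ) → List ℂ} (hl : ∀ i, SepEntire fun w => (l w).getD i 0) (q : Fin k) :
    SepEntire fun w => (extL x (l w) : Fin k → ℂ) q := by
  unfold extL
  by_cases h : (q : ℕ) < n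
  · simpa [h] using SepEntire.const _
  · simpa only [h, dite_false] using hl _

lemma sepEntire_defect_lam (hτ : 0 < τ.im) {n : ℕ} (x : Fin n → ℂ) (m₁ m₂ : ℕ)
    {l₁ l₂ : (Fin 1 → ℂ) → List ℂ} (hl₁ : ∀ i, SepEntire fun w => (l₁ w).getD i 0)
    (hl₂ : ∀ i, SepEntire fun w => (l₂ w).getD i 0) {c : (Fin 1 → ℂ) → ℂ} (hc : SepEntire c) :
    SepEntire fun w => defect τ (w 0) Ψ m₁ m₂ (l₁ w) (l₂ w) (c w) x := by
  have hV : ∀ (m : ℕ) {l : (Fin 1 → ℂ) → List ℂ}, (∀ i, SepEntire fun w => (l w).getD i 0) →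
      SepEntire fun w => vdPair τ m (l w) x := fun m l hl =>
    (SepEntire.vdTheta hτ fun _ => sepEntire_extL_list x hl _).mul
      (SepEntire.vdTheta hτ fun _ => sepEntire_extL_list x hl _)
  have hN : ∀ (m : ℕ) {l : (Fin 1 → ℂ) → List ℂ}, (∀ i, SepEntire fun w => (l w).getD i 0) →
      SepEntire fun w => numPair τ m (l w) x := fun m l hl =>
    SepEntire.tsuNum hτ (fun _ => sepEntire_extL_list x hl _) fun _ => sepEntire_extL_list x hl _
  exact ((((SepEntire.coord 0).comp_entire (differentiable_Zfun_lam hτ x)).mul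
    (SepEntire.const _)).mul ((hV m₁ hl₁).mul (hV m₂ hl₂))).sub
    (((SepEntire.const _).mul hc).mul ((hN m₁ hl₁).mul (hN m₂ hl₂)))

lemma sepEntire_getD_nil (i : ℕ) :
    SepEntire fun _ : Fin 1 → ℂ => ([] : List ℂ).getD i 0 :=
  SepEntire.const _

lemma sepEntire_getD_cons {f : (Fin 1 → ℂ) → ℂ} (hf : SepEntire f) {l : (Fin 1 → ℂ) → List ℂ}
    (hl : ∀ i, SepEntire fun w => (l w).getD i 0) (i : ℕ) :
    SepEntire fun w => (f w :: l w).getD i 0 := by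
  cases i with
  | zero => simpa using hf
  | succ i => simpa using hl i

theorem defect_even (H : PsiHyp τ Ψ) (k : ℕ) (x : Fin (2 * k) → ℂ) :
    defect τ lam Ψ k (k + 1) [] [β2c, ηc + lam] ((-1) ^ k) x = 0 := by
  have hv := (SepEntire.const (ι := Fin 1) ηc).add (SepEntire.coord 0)
  exact (generic_lamGeneric H.im_pos).eq_zero (sepEntire_defect_lam H.im_pos x k (k + 1)
    sepEntire_getD_nil (sepEntire_getD_cons (SepEntire.const β2c)
      (sepEntire_getD_cons hv sepEntire_getD_nil)) (SepEntire.const ((-1) ^ k)))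
    (fun w hw => defect_even_of_generic H hw k x) fun _ => lam

theorem defect_odd (H : PsiHyp τ Ψ) (k : ℕ) (x : Fin (2 * k + 1) → ℂ) :
    defect τ lam Ψ (k + 1) (k + 1) [β2c] [ηc + lam] ((-1) ^ k * th2 (ηc + lam) τ) x = 0 := by
  have hv := (SepEntire.const (ι := Fin 1) ηc).add (SepEntire.coord 0)
  exact (generic_lamGeneric H.im_pos).eq_zero (sepEntire_defect_lam H.im_pos x (k + 1) (k + 1)
    (sepEntire_getD_cons (SepEntire.const β2c) sepEntire_getD_nil)
    (sepEntire_getD_cons hv sepEntire_getD_nil)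
    ((SepEntire.const ((-1) ^ k)).mul (hv.comp_entire (differentiable_th2 H.im_pos))))
    (fun w hw => defect_odd_of_generic H hw k x) fun _ => lam

lemma tsuchiya_mul_vdPair {n m : ℕ} {l : List ℂ} {x : Fin n → ℂ}
    (h : tsuDefined τ m (extL x l)) :
    vdPair τ m l x ≠ 0 ∧ tsuchiya τ m (extL x l) * vdPair τ m l x = numPair τ m l x := by
  obtain ⟨h1, h2, h3⟩ := h
  have hvd : ∀ y : Fin m → ℂ, (∀ i j, i ≠ j → th1 (y j - y i) τ ≠ 0 ∧ th1 (y j + y i) τ ≠ 0) →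
      vdTheta τ y ≠ 0 := fun y hy => Finset.prod_ne_zero_iff.mpr fun i _ =>
    Finset.prod_ne_zero_iff.mpr fun j _ => by
      split_ifs with hij
      · exact mul_ne_zero (hy i j hij.ne).1 (hy i j hij.ne).2
      · exact one_ne_zero
  have hV : vdPair τ m l x ≠ 0 := mul_ne_zero (hvd _ h1) (hvd _ h2)
  refine ⟨hV, ?_⟩
  rw [numPair, tsuNum_eq (headHalf m l x) (tailHalf m l x) h3, tsuchiya, mul_right_comm]
  congr 1
  exact div_mul_cancel₀ _ hV

lemma Zfun_eq_of_defect (hτ : 0 < τ.im) {n m₁ m₂ : ℕ} {l₁ l₂ : List ℂ} {c : ℂ} {x : Fin n → ℂ}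
    (hd₁ : tsuDefined τ m₁ (extL x l₁)) (hd₂ : tsuDefined τ m₂ (extL x l₂))
    (h : defect τ lam Ψ m₁ m₂ l₁ l₂ c x = 0) :
    Zfun τ lam Ψ n x = (∏ i, prefac τ (x i)) * (c / th4 0 (2 * τ) ^ n
      * tsuchiya τ m₁ (extL x l₁) * tsuchiya τ m₂ (extL x l₂)) := by
  obtain ⟨hV₁, e₁⟩ := tsuchiya_mul_vdPair hd₁
  obtain ⟨hV₂, e₂⟩ := tsuchiya_mul_vdPair hd₂
  have ht := pow_ne_zero n (th4_zero_ne_zero hτ)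
  rw [defect, ← e₁, ← e₂] at h
  refine mul_right_cancel₀ (mul_ne_zero ht (mul_ne_zero hV₁ hV₂)) ?_
  have hc : c / th4 0 (2 * τ) ^ n * th4 0 (2 * τ) ^ n = c := div_mul_cancel₀ _ ht
  linear_combination h - (∏ i, prefac τ (x i)) * tsuchiya τ m₁ (extL x l₁)
    * tsuchiya τ m₂ (extL x l₂) * vdPair τ m₁ l₁ x * vdPair τ m₂ l₂ x * hc

lemma extL_nil {k : ℕ} (x : Fin k → ℂ) : (extL x [] : Fin k → ℂ) = x := by
  funext q
  simp [extL]

end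

end

theorem stmt14 (τ lam : ℂ) (hτ : 0 < τ.im) (Ψ : PsiFam)
    (hent : PsiEntire Ψ) (h1 : PsiP1 τ Ψ) (h2 : PsiP2 τ Ψ) (h3 : PsiP3 τ Ψ)
    (h4 : PsiP4 Ψ) (h5 : PsiP5 τ Ψ) (h6 : PsiP6 Ψ) :
    (∀ (k : ℕ) (x : Fin (2*k) → ℂ),
      tsuDefined τ k x →
      tsuDefined τ (k+1) (extL x [β2c, ηc + lam]) →
      Zfun τ lam Ψ (2*k) x
        = (∏ i : Fin (2*k), th4 (2*(ηc + x i)) (2*τ) * th1 (ηc + x i) τ * th1 (ηc - x i) τ)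
          * ((-1:ℂ)^k / th4 0 (2*τ) ^ (2*k)
              * tsuchiya τ k x * tsuchiya τ (k+1) (extL x [β2c, ηc + lam]))) ∧
    (∀ (k : ℕ) (x : Fin (2*k+1) → ℂ),
      tsuDefined τ (k+1) (extL x [β2c]) →
      tsuDefined τ (k+1) (extL x [ηc + lam]) →
      Zfun τ lam Ψ (2*k+1) x
        = (∏ i : Fin (2*k+1), th4 (2*(ηc + x i)) (2*τ) * th1 (ηc + x i) τ * th1 (ηc - x i) τ)
          * ((-1:ℂ)^k * th2 (ηc + lam) τ / th4 0 (2*τ) ^ (2*k+1)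
              * tsuchiya τ (k+1) (extL x [β2c]) * tsuchiya τ (k+1) (extL x [ηc + lam]))) := by
  have H : PsiHyp τ Ψ := ⟨hτ, hent, h1, h2, h3, h5, h6⟩
  refine ⟨fun k x hd₁ hd₂ => ?_, fun k x hd₁ hd₂ =>
    Zfun_eq_of_defect hτ hd₁ hd₂ (defect_odd H k x)⟩
  have h := Zfun_eq_of_defect hτ (by rwa [extL_nil]) hd₂ (defect_even H k x)
  rw [extL_nil] at h
  exact h

end
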